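/- Let ℓ be a prime and let K|k and L|l be function fields over algebraically closed fields with char k ≠ ℓ, char l ≠ ℓ, and trdeg(K|k) ≥ 5. Then the following are equivalent: (i) there exists a field isomorphism K^i → L^i between the perfect closures (any such isomorphism necessarily maps k onto l); (ii) there exists a group isomorphism φ : k^M_1(K) → k^M_1(L) that is compatible with k^M_2 and compatible with 𝔊^1_rat. -/

import Mathlib

/-! Common definitions: mod-ℓ Milnor K-theory, K^×/(K^×)^ℓ, Ω_K, relative algebraic
closure, transcendence degree predicates, discrete valuations, etc. -/

noncomputable section

open scoped TensorProduct

universe u v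

/-- The `n`-fold tensor power (over `ℤ`) of the multiplicative group `Kˣ`,
written additively. -/
abbrev MilnorPre (n : ℕ) (K : Type*) [Field K] : Type _ :=
  PiTensorProduct ℤ (fun _ : Fin n => Additive Kˣ)

/-- The submodule of Steinberg relations: generated by all `a₁ ⊗ ⋯ ⊗ aₙ`
with `aᵢ + aⱼ = 1` for some `i < j`. -/
def SteinbergRel (n : ℕ) (K : Type*) [Field K] : Submodule ℤ (MilnorPre n K) :=
  Submodule.span ℤ
    {x | ∃ a : Fin n → Kˣ,
      (∃ i j : Fin n, i < j ∧ ((a i : K) + (a j : K) = 1)) ∧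
        x = PiTensorProduct.tprod ℤ (fun i => Additive.ofMul (a i))}

/-- The `n`-th Milnor K-group `K^M_n(K)`: the quotient of the `n`-fold tensor
power of `K^×` by the Steinberg relations. -/
abbrev MilnorK (n : ℕ) (K : Type*) [Field K] : Type _ :=
  MilnorPre n K ⧸ SteinbergRel n K

/-- The mod-`ℓ` Milnor K-group `k^M_n(K) = K^M_n(K)/ℓ`. -/
abbrev MilnorKMod (ℓ n : ℕ) (K : Type*) [Field K] : Type _ :=
  MilnorK n K ⧸ LinearMap.range ((ℓ : ℤ) • (LinearMap.id : MilnorK n K →ₗ[ℤ] MilnorK n K))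

/-- The symbol `{a₁, …, aₙ}` in `k^M_n(K)`. -/
def milnorSymbol (ℓ : ℕ) {n : ℕ} {K : Type*} [Field K] (a : Fin n → Kˣ) :
    MilnorKMod ℓ n K :=
  Submodule.Quotient.mk (Submodule.Quotient.mk
    (PiTensorProduct.tprod ℤ (fun i => Additive.ofMul (a i))))

/-- `k^M_1(K) = K^×/(K^×)^ℓ`, written multiplicatively. -/
abbrev K1 (ℓ : ℕ) (K : Type*) [Field K] : Type _ :=
  Kˣ ⧸ (powMonoidHom ℓ : Kˣ →* Kˣ).range

/-- The projection `K^× → K^×/(K^×)^ℓ`. -/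
def K1proj (ℓ : ℕ) (K : Type*) [Field K] : Kˣ →* K1 ℓ K :=
  QuotientGroup.mk' _

/-- The subgroup of `Kˣ` consisting of the units lying in an intermediate field `L`. -/
def fieldUnits {k K : Type*} [Field k] [Field K] [Algebra k K]
    (L : IntermediateField k K) : Subgroup Kˣ where
  carrier := {x : Kˣ | (x : K) ∈ L}
  one_mem' := by simpa using one_mem L
  mul_mem' := by
    intro a b ha hb
    simpa using mul_mem ha hb
  inv_mem' := by
    intro a ha
    simpa using inv_mem (show (a : K) ∈ L from ha)

/-- `Ω_K(L)`: the image of `L^×` in `K^×/(K^×)^ℓ`. -/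
def Omega (ℓ : ℕ) {k K : Type*} [Field k] [Field K] [Algebra k K]
    (L : IntermediateField k K) : Subgroup (K1 ℓ K) :=
  (fieldUnits L).map (K1proj ℓ K)

/-- A subextension `L` of `K|k` is relatively algebraically closed in `K` if every
element of `K` algebraic over `L` lies in `L`. -/
def RelAlgClosed {k K : Type*} [Field k] [Field K] [Algebra k K]
    (L : IntermediateField k K) : Prop :=
  ∀ x : K, IsAlgebraic L x → x ∈ L

/-- `K` is a function field over `k`: a finitely generated field extension. -/
def IsFunctionField (k K : Type*) [Field k] [Field K] [Algebra k K] : Prop :=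
  ∃ s : Finset K, IntermediateField.adjoin k (s : Set K) = ⊤

/-- `trdeg(K|k) = d`: there is a transcendence basis indexed by `Fin d`. -/
def HasTrdeg (k : Type*) (K : Type*) [Field k] [Field K] [Algebra k K] (d : ℕ) : Prop :=
  ∃ x : Fin d → K, IsTranscendenceBasis k x

/-- `trdeg(K|k) ≥ m`: there are `m` algebraically independent elements. -/
def TrdegGe (k : Type*) (K : Type*) [Field k] [Field K] [Algebra k K] (m : ℕ) : Prop :=
  ∃ x : Fin m → K, AlgebraicIndependent k x

/-- `dim^M_K(S) ≥ d` for a subset `S ⊆ k^M_1(K)`: there are `s₁, …, s_d ∈ S` with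
`{s₁, …, s_d} ≠ 0` in `k^M_d(K)`. -/
def dimMge (ℓ : ℕ) {K : Type*} [Field K] (S : Set (K1 ℓ K)) (d : ℕ) : Prop :=
  ∃ a : Fin d → Kˣ, (∀ i, K1proj ℓ K (a i) ∈ S) ∧ milnorSymbol ℓ a ≠ 0

/-- `dim^M_K(S) = r`. -/
def dimMeq (ℓ : ℕ) {K : Type*} [Field K] (S : Set (K1 ℓ K)) (r : ℕ) : Prop :=
  dimMge ℓ S r ∧ ¬ dimMge ℓ S (r + 1)

/-- `t` is a general element of `K` over `k`: `t ∉ k` and `k(t)` is relatively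
algebraically closed in `K`. -/
def IsGeneralElement (k : Type*) {K : Type*} [Field k] [Field K] [Algebra k K] (t : K) : Prop :=
  t ∉ (⊥ : IntermediateField k K) ∧ RelAlgClosed (IntermediateField.adjoin k {t})

/-- A rational subgroup of `k^M_1(K)`: `Ω_K(k(t))` for a general element `t`. -/
def IsRationalSubgroup (ℓ : ℕ) (k : Type*) {K : Type*} [Field k] [Field K] [Algebra k K]
    (A : Subgroup (K1 ℓ K)) : Prop :=
  ∃ t : K, IsGeneralElement k t ∧ A = Omega ℓ (IntermediateField.adjoin k {t})

/-- `𝔊^r(K|k)`: the subgroups `Ω_K(L)` for `L` relatively algebraically closed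
in `K` of transcendence degree `r` over `k`. -/
def GSet (ℓ : ℕ) (k : Type*) {K : Type*} [Field k] [Field K] [Algebra k K] (r : ℕ) :
    Set (Subgroup (K1 ℓ K)) :=
  {A | ∃ L : IntermediateField k K, RelAlgClosed L ∧ HasTrdeg k L r ∧ A = Omega ℓ L}

/-- `𝔐^1(K)`: subgroups maximal among the subgroups `B` of `k^M_1(K)`
with `dim^M_K(B) = 1`. -/
def M1Set (ℓ : ℕ) (K : Type*) [Field K] : Set (Subgroup (K1 ℓ K)) :=
  {A | dimMeq ℓ (A : Set (K1 ℓ K)) 1 ∧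
    ∀ B : Subgroup (K1 ℓ K), dimMeq ℓ (B : Set (K1 ℓ K)) 1 → A ≤ B → B = A}

/-- Condition (a) and (b) of the maximality characterization of `𝔊^r`:
`B` is generated by rational subgroups and `dim^M_K(B) = r`. -/
def SpannedByRatWithDim (ℓ : ℕ) (k : Type*) {K : Type*} [Field k] [Field K] [Algebra k K]
    (r : ℕ) (B : Subgroup (K1 ℓ K)) : Prop :=
  (∃ S : Set (Subgroup (K1 ℓ K)), (∀ T ∈ S, IsRationalSubgroup ℓ k T) ∧ B = sSup S) ∧
    dimMeq ℓ (B : Set (K1 ℓ K)) r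

/-- A discrete valuation of a field `F`: a surjective homomorphism `F^× → ℤ`
satisfying the ultrametric inequality. -/
structure DiscreteValuation (F : Type*) [Field F] where
  v : Fˣ → ℤ
  map_mul' : ∀ x y : Fˣ, v (x * y) = v x + v y
  surjective' : Function.Surjective v
  min_le' : ∀ x y z : Fˣ, (x : F) + (y : F) = (z : F) → min (v x) (v y) ≤ v z

lemma DiscreteValuation.v_one {F : Type*} [Field F] (w : DiscreteValuation F) : w.v 1 = 0 := by
  have h := w.map_mul' 1 1
  simp only [mul_one] at h
  omega

/-- A discrete valuation of `F` is trivial on the base field `k`. -/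
def DiscreteValuation.TrivialOn (k : Type*) {F : Type*} [Field k] [Field F] [Algebra k F]
    (w : DiscreteValuation F) : Prop :=
  ∀ (c : k) (hc : algebraMap k F c ≠ 0), w.v (Units.mk0 _ hc) = 0

/-- The unit group `U_w ⊆ F^×` of a discrete valuation. -/
def DiscreteValuation.units {F : Type*} [Field F] (w : DiscreteValuation F) : Subgroup Fˣ where
  carrier := {x : Fˣ | w.v x = 0}
  one_mem' := w.v_one
  mul_mem' := by
    intro a b ha hb
    have h := w.map_mul' a b
    simp only [Set.mem_setOf_eq] at ha hb ⊢
    omega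
  inv_mem' := by
    intro a ha
    have h := w.map_mul' a a⁻¹
    rw [mul_inv_cancel] at h
    have h1 := w.v_one
    simp only [Set.mem_setOf_eq] at ha ⊢
    omega

/-- `𝔘_v`: the image of the unit group `U_v` in `K^×/(K^×)^ℓ`. -/
def DiscreteValuation.unitsImage (ℓ : ℕ) {F : Type*} [Field F] (w : DiscreteValuation F) :
    Subgroup (K1 ℓ F) :=
  w.units.map (K1proj ℓ F)

/-- For a discrete valuation `w` of an intermediate field `F` of `K|k`, the image of
the unit group `U_w` in `K^×/(K^×)^ℓ`. -/
def unitsImageIn (ℓ : ℕ) {k K : Type*} [Field k] [Field K] [Algebra k K]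
    (F : IntermediateField k K) (w : DiscreteValuation F) : Subgroup (K1 ℓ K) :=
  (w.units.map (Units.map (algebraMap F K).toMonoidHom)).map (K1proj ℓ K)

/-- The residue field of `v` has transcendence degree `≥ m` over `k`: there are
`v`-units `x₁, …, x_m` whose residues are algebraically independent over `k`,
expressed by saying that every nonzero polynomial over `k` evaluated at the `xᵢ`
is a unit of value `0`. -/
def DiscreteValuation.ResidueTrdegGe (k : Type*) {K : Type*} [Field k] [Field K] [Algebra k K]
    (v : DiscreteValuation K) (m : ℕ) : Prop :=
  ∃ x : Fin m → Kˣ, (∀ i, v.v (x i) = 0) ∧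
    ∀ P : MvPolynomial (Fin m) k, P ≠ 0 →
      ∃ u : Kˣ, (u : K) = MvPolynomial.aeval (fun i => ((x i : K))) P ∧ v.v u = 0

/-- A divisorial-type valuation of `K|k` (where `d = trdeg(K|k)`): a discrete valuation
trivial on `k` whose residue field has transcendence degree exactly `d - 1` over `k`. -/
def IsDivisorialType (k : Type*) {K : Type*} [Field k] [Field K] [Algebra k K] (d : ℕ)
    (v : DiscreteValuation K) : Prop :=
  v.TrivialOn k ∧ v.ResidueTrdegGe k (d - 1) ∧ ¬ v.ResidueTrdegGe k d

/-- `Δ_A`: the set of subgroups `A ⊓ 𝔘_v`, for `v` ranging over the divisorial-type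
valuations of `K` with `A ⊄ 𝔘_v`. -/
def DeltaA (ℓ : ℕ) (k : Type*) {K : Type*} [Field k] [Field K] [Algebra k K] (d : ℕ)
    (A : Subgroup (K1 ℓ K)) : Set (Subgroup (K1 ℓ K)) :=
  {T | ∃ v : DiscreteValuation K, IsDivisorialType k d v ∧
    ¬ A ≤ v.unitsImage ℓ ∧ T = A ⊓ v.unitsImage ℓ}

/-- A good rational subgroup: a rational subgroup `A = Ω_K(k(t))` such that for every
discrete valuation `w` of `k(t)` trivial on `k`, the image of `U_w` in `K^×/(K^×)^ℓ`
belongs to `Δ_A`. -/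
def IsGoodRationalSubgroup (ℓ : ℕ) (k : Type*) {K : Type*} [Field k] [Field K] [Algebra k K]
    (d : ℕ) (A : Subgroup (K1 ℓ K)) : Prop :=
  ∃ t : K, IsGeneralElement k t ∧ A = Omega ℓ (IntermediateField.adjoin k {t}) ∧
    ∀ w : DiscreteValuation (IntermediateField.adjoin k {t}), w.TrivialOn k →
      unitsImageIn ℓ (IntermediateField.adjoin k {t}) w ∈ DeltaA ℓ k d A

/-- A very general element: a general element `t` such that `Ω_K(k(t))` is a good
rational subgroup. -/
def IsVeryGeneral (ℓ : ℕ) (k : Type*) {K : Type*} [Field k] [Field K] [Algebra k K]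
    (d : ℕ) (t : K) : Prop :=
  IsGeneralElement k t ∧ IsGoodRationalSubgroup ℓ k d (Omega ℓ (IntermediateField.adjoin k {t}))

/-- `x` is separable in `K`: in characteristic `p > 0`, `x` is not a `p`-th power;
in characteristic `0` every element is separable. -/
def IsSeparableIn (K : Type*) [Field K] (x : K) : Prop :=
  ∀ p : ℕ, p.Prime → CharP K p → ¬ ∃ y : K, y ^ p = x

/-- A perfect closure of `K`: a perfect field which is a purely inseparable
extension of `K`. -/
structure PerfectClosureOf (K : Type u) [Field K] : Type (u + 1) where
  carrier : Type u
  [fieldInst : Field carrier]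
  [algebraInst : Algebra K carrier]
  purelyInseparable : IsPurelyInseparable K carrier
  perfect : PerfectField carrier

attribute [instance] PerfectClosureOf.fieldInst PerfectClosureOf.algebraInst

/-- A group isomorphism `φ : k^M_1(K) → k^M_1(L)` is induced by a field isomorphism
`σ : K^i → L^i` of the perfect closures, via the canonical identifications
`k^M_1(K) ≅ k^M_1(K^i)` and `k^M_1(L) ≅ k^M_1(L^i)`. -/
def InducesOnK1 (ℓ : ℕ) {K : Type u} {L : Type v} [Field K] [Field L]
    (PK : PerfectClosureOf K) (PL : PerfectClosureOf L)
    (σ : PK.carrier ≃+* PL.carrier) (φ : K1 ℓ K ≃* K1 ℓ L) : Prop :=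
  ∀ (x : Kˣ) (y : Lˣ),
    (φ (K1proj ℓ K x) = K1proj ℓ L y ↔
      ∃ z : (PL.carrier)ˣ,
        Units.map σ.toRingHom.toMonoidHom
            (Units.map (algebraMap K PK.carrier).toMonoidHom x) =
          Units.map (algebraMap L PL.carrier).toMonoidHom y * z ^ ℓ)

/-- `φ : k^M_1(K) → k^M_1(L)` is compatible with `k^M_2`: `φ ⊗ φ` descends, along the
multiplication maps, to an isomorphism `k^M_2(K) → k^M_2(L)`; equivalently, there is an
additive isomorphism `k^M_2(K) ≃ k^M_2(L)` carrying `{a, b}` to `{a', b'}` whenever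
`φ` carries the class of `a` (resp. `b`) to the class of `a'` (resp. `b'`). -/
def CompatWithK2 (ℓ : ℕ) {K L : Type*} [Field K] [Field L] (φ : K1 ℓ K ≃* K1 ℓ L) : Prop :=
  ∃ ψ : MilnorKMod ℓ 2 K ≃+ MilnorKMod ℓ 2 L,
    ∀ (a b : Kˣ) (a' b' : Lˣ),
      φ (K1proj ℓ K a) = K1proj ℓ L a' → φ (K1proj ℓ K b) = K1proj ℓ L b' →
        ψ (milnorSymbol ℓ ![a, b]) = milnorSymbol ℓ ![a', b']

/-- `φ : k^M_1(K) → k^M_1(L)` is compatible with `𝔊^1_rat`: it maps rational subgroups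
bijectively onto rational subgroups. -/
def CompatWithRat (ℓ : ℕ) (k : Type*) (l : Type*) {K L : Type*}
    [Field k] [Field K] [Algebra k K] [Field l] [Field L] [Algebra l L]
    (φ : K1 ℓ K ≃* K1 ℓ L) : Prop :=
  (∀ A : Subgroup (K1 ℓ K), IsRationalSubgroup ℓ k A →
     IsRationalSubgroup ℓ l (A.map φ.toMonoidHom)) ∧
  (∀ B : Subgroup (K1 ℓ L), IsRationalSubgroup ℓ l B →
     ∃ A : Subgroup (K1 ℓ K), IsRationalSubgroup ℓ k A ∧ A.map φ.toMonoidHom = B)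

/-- Two isomorphisms of perfect closures differ by a power of the Frobenius
(in characteristic `0`, they are equal). -/
def FrobTwistEquiv {Ki Li : Type*} [Field Ki] [Field Li] (σ σ' : Ki ≃+* Li) : Prop :=
  σ = σ' ∨ ∃ p : ℕ, p.Prime ∧ CharP Ki p ∧
    ((∃ n : ℕ, ∀ x, σ' x = σ (x ^ p ^ n)) ∨ (∃ n : ℕ, ∀ x, σ x = σ' (x ^ p ^ n)))

namespace MilnorRec

open Polynomial

section Classes

variable {ℓ : ℕ} {F : Type*} [Field F]

/-- The group `Fˣ / (Fˣ)^ℓ`. -/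
def Cl (ℓ : ℕ) (F : Type*) [Field F] : Type _ := Fˣ ⧸ (powMonoidHom ℓ : Fˣ →* Fˣ).range

instance : CommGroup (Cl ℓ F) :=
  inferInstanceAs (CommGroup (Fˣ ⧸ (powMonoidHom ℓ : Fˣ →* Fˣ).range))

/-- The projection onto `Fˣ / (Fˣ)^ℓ`. -/
def Cl.mk (ℓ : ℕ) (F : Type*) [Field F] : Fˣ →* Cl ℓ F :=
  QuotientGroup.mk' (powMonoidHom ℓ : Fˣ →* Fˣ).range

/-- The class of `z` in `Fˣ / (Fˣ)^ℓ`, with the convention that `0` has trivial class. -/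
def cls (ℓ : ℕ) {F : Type*} [Field F] (z : F) : Cl ℓ F :=
  open Classical in if h : z = 0 then 1 else Cl.mk ℓ F (Units.mk0 z h)

lemma cls_of_ne {z : F} (h : z ≠ 0) : cls ℓ z = Cl.mk ℓ F (Units.mk0 z h) := by
  simp [cls, h]

lemma cls_unit (u : Fˣ) : cls ℓ (u : F) = Cl.mk ℓ F u := by
  rw [cls_of_ne u.ne_zero, Units.mk0_val]

@[simp] lemma cls_zero : cls ℓ (0 : F) = 1 := by simp [cls]

@[simp] lemma cls_one : cls ℓ (1 : F) = 1 := by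
  rw [← Units.val_one, cls_unit, map_one]

lemma cls_mul {a b : F} (ha : a ≠ 0) (hb : b ≠ 0) : cls ℓ (a * b) = cls ℓ a * cls ℓ b := by
  rw [cls_of_ne ha, cls_of_ne hb, cls_of_ne (mul_ne_zero ha hb), ← map_mul]
  congr 1
  ext; simp

lemma cls_inv (a : F) : cls ℓ a⁻¹ = (cls ℓ a)⁻¹ := by
  rcases eq_or_ne a 0 with rfl | ha
  · simp
  · rw [eq_inv_iff_mul_eq_one, ← cls_mul (inv_ne_zero ha) ha, inv_mul_cancel₀ ha, cls_one]

lemma cls_div {a b : F} (ha : a ≠ 0) (hb : b ≠ 0) : cls ℓ (a / b) = cls ℓ a / cls ℓ b := by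
  rw [div_eq_mul_inv, cls_mul ha (inv_ne_zero hb), cls_inv, div_eq_mul_inv]

lemma cls_pow {a : F} (ha : a ≠ 0) (n : ℕ) : cls ℓ (a ^ n) = cls ℓ a ^ n := by
  induction n with
  | zero => simp
  | succ n ih => rw [pow_succ, cls_mul (pow_ne_zero _ ha) ha, ih, pow_succ]

lemma cls_surj (c : Cl ℓ F) : ∃ z : F, z ≠ 0 ∧ cls ℓ z = c := by
  obtain ⟨u, rfl⟩ := QuotientGroup.mk'_surjective _ c
  exact ⟨u, u.ne_zero, cls_unit u⟩

lemma cls_eq_one_iff {a : F} (ha : a ≠ 0) : cls ℓ a = 1 ↔ ∃ w : F, w ≠ 0 ∧ a = w ^ ℓ := by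
  rw [cls_of_ne ha]
  unfold Cl.mk
  erw [QuotientGroup.mk'_apply, QuotientGroup.eq_one_iff]
  constructor
  · rintro ⟨w, hw⟩
    exact ⟨w, w.ne_zero, by simpa using (congrArg Units.val hw).symm⟩
  · rintro ⟨w, hw, h⟩
    exact ⟨Units.mk0 w hw, by ext; simp [h]⟩

lemma cls_eq_iff {a b : F} (ha : a ≠ 0) (hb : b ≠ 0) :
    cls ℓ a = cls ℓ b ↔ ∃ w : F, w ≠ 0 ∧ a = b * w ^ ℓ := by
  rw [← div_eq_one, ← cls_div ha hb, cls_eq_one_iff (div_ne_zero ha hb)]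
  simp only [div_eq_iff hb, mul_comm]

lemma Cl_pow (c : Cl ℓ F) : c ^ ℓ = 1 := by
  obtain ⟨z, hz, rfl⟩ := cls_surj c
  rw [← cls_pow hz, cls_eq_one_iff (pow_ne_zero _ hz)]
  exact ⟨z, hz, rfl⟩

lemma Cl_pow_congr {m n : ℕ} (h : (m : ZMod ℓ) = n) (c : Cl ℓ F) : c ^ m = c ^ n := by
  rw [ZMod.natCast_eq_natCast_iff] at h
  rw [pow_eq_pow_mod m (Cl_pow c), pow_eq_pow_mod n (Cl_pow c), h]

lemma cls_algebraMap {k : Type*} [Field k] [Algebra k F] [IsAlgClosed k] (hℓ : ℓ ≠ 0) (c : k) :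
    cls ℓ (algebraMap k F c) = 1 := by
  rcases eq_or_ne c 0 with rfl | hc
  · simp
  obtain ⟨d, rfl⟩ := IsAlgClosed.exists_pow_nat_eq c (Nat.pos_of_ne_zero hℓ)
  have hd : d ≠ 0 := by rintro rfl; simp [hℓ] at hc
  have hd' : algebraMap k F d ≠ 0 := by simpa using hd
  rw [map_pow, cls_pow hd', Cl_pow]

/-- A homomorphism from `Fˣ / (Fˣ)^ℓ` to `ℤ/ℓ`. -/
structure KChar (ℓ : ℕ) (F : Type*) [Field F] where
  toFun : Cl ℓ F → ZMod ℓ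
  map_mul' : ∀ a b, toFun (a * b) = toFun a + toFun b

instance : CoeFun (KChar ℓ F) (fun _ => Cl ℓ F → ZMod ℓ) := ⟨KChar.toFun⟩

namespace KChar

section

variable (v : KChar ℓ F)

lemma map_mul (a b : Cl ℓ F) : v (a * b) = v a + v b := v.map_mul' a b

@[simp] lemma map_one : v 1 = 0 := by
  have := v.map_mul 1 1
  rw [mul_one] at this
  linear_combination -this

lemma map_inv (a : Cl ℓ F) : v a⁻¹ = - v a := by
  have := v.map_mul a⁻¹ a
  rw [inv_mul_cancel, map_one] at this
  linear_combination -this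

lemma map_div (a b : Cl ℓ F) : v (a / b) = v a - v b := by
  rw [div_eq_mul_inv, map_mul, map_inv, sub_eq_add_neg]

lemma map_pow (a : Cl ℓ F) (n : ℕ) : v (a ^ n) = n * v a := by
  induction n with
  | zero => simp
  | succ n ih => rw [pow_succ, map_mul, ih]; push_cast; ring

/-- Pull a character back along an isomorphism. -/
def comap {F' : Type*} [Field F'] (Φ : Cl ℓ F' ≃* Cl ℓ F) : KChar ℓ F' where
  toFun a := v (Φ a)
  map_mul' a b := by rw [_root_.map_mul, v.map_mul]

@[simp] lemma comap_apply {F' : Type*} [Field F'] (Φ : Cl ℓ F' ≃* Cl ℓ F) (a : Cl ℓ F') :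
    v.comap Φ a = v (Φ a) := rfl

end

/-- A character from a function on the field which is additive on nonzero elements. -/
def ofFun (V : F → ZMod ℓ) (hV : ∀ a b, a ≠ 0 → b ≠ 0 → V (a * b) = V a + V b) : KChar ℓ F where
  toFun c := V (cls_surj c).choose
  map_mul' a b := by
    have key : ∀ x y : F, x ≠ 0 → y ≠ 0 → cls ℓ x = cls ℓ y → V x = V y := by
      intro x y hx hy h
      obtain ⟨w, hw, rfl⟩ := (cls_eq_iff hx hy).1 h
      have hp : ∀ n : ℕ, V (w ^ (n + 1)) = (n + 1 : ℕ) * V w := by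
        intro n
        induction n with
        | zero => simp
        | succ n ih => rw [pow_succ, hV _ _ (pow_ne_zero _ hw) hw, ih]; push_cast; ring
      rw [hV _ _ hy (pow_ne_zero _ hw)]
      rcases ℓ with _ | n
      · have h1 := hV 1 1 one_ne_zero one_ne_zero
        rw [mul_one] at h1
        rw [pow_zero]
        linear_combination -h1
      · rw [hp, ZMod.natCast_self]; ring
    obtain ⟨ha, ha'⟩ := (cls_surj a).choose_spec
    obtain ⟨hb, hb'⟩ := (cls_surj b).choose_spec
    obtain ⟨hab, hab'⟩ := (cls_surj (a * b)).choose_spec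
    rw [← hV _ _ ha hb]
    refine key _ _ hab (mul_ne_zero ha hb) ?_
    rw [hab', cls_mul ha hb, ha', hb']

lemma ofFun_cls (V : F → ZMod ℓ) (hV : ∀ a b, a ≠ 0 → b ≠ 0 → V (a * b) = V a + V b) {z : F}
    (hz : z ≠ 0) : ofFun V hV (cls ℓ z) = V z := by
  obtain ⟨ha, ha'⟩ := (cls_surj (cls ℓ z)).choose_spec
  obtain ⟨w, hw, h⟩ := (cls_eq_iff ha hz).1 ha'
  change V (cls_surj (cls ℓ z)).choose = V z
  rw [h]
  have hp : ∀ n : ℕ, V (w ^ (n + 1)) = (n + 1 : ℕ) * V w := by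
    intro n
    induction n with
    | zero => simp
    | succ n ih => rw [pow_succ, hV _ _ (pow_ne_zero _ hw) hw, ih]; push_cast; ring
  rw [hV _ _ hz (pow_ne_zero _ hw)]
  rcases ℓ with _ | n
  · have h1 := hV 1 1 one_ne_zero one_ne_zero
    rw [mul_one] at h1
    rw [pow_zero]
    linear_combination -h1
  · rw [hp, ZMod.natCast_self]; ring

end KChar

/-- The pair `(v, w)` of characters kills all Steinberg symbols. -/
def IsSt (v w : KChar ℓ F) : Prop :=
  ∀ a b : F, a ≠ 0 → b ≠ 0 → a + b = 1 →
    v (cls ℓ a) * w (cls ℓ b) = w (cls ℓ a) * v (cls ℓ b)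

/-- Characters extend uniquely along purely inseparable extensions. -/
lemma exists_kchar_of_pi (p : ℕ) [ExpChar F p] [Fact ℓ.Prime] (hp : (p : ZMod ℓ) ≠ 0)
    (D : Subfield F) (hD : ∀ z : F, ∃ n : ℕ, z ^ p ^ n ∈ D) (V : F → ZMod ℓ)
    (hV : ∀ a ∈ D, ∀ b ∈ D, a ≠ 0 → b ≠ 0 → V (a * b) = V a + V b) :
    ∃ v : KChar ℓ F, ∀ (z : F) (n : ℕ), z ≠ 0 → z ^ p ^ n ∈ D →
      v (cls ℓ z) = (p : ZMod ℓ)⁻¹ ^ n * V (z ^ p ^ n) := by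
  classical
  have hpow : ∀ a ∈ D, a ≠ 0 → ∀ n : ℕ, V (a ^ n) = n * V a := by
    intro a ha ha0 n
    induction n with
    | zero =>
      have h1 := hV 1 D.one_mem 1 D.one_mem one_ne_zero one_ne_zero
      simpa using h1
    | succ n ih =>
      rw [pow_succ, hV _ (pow_mem ha n) _ ha (pow_ne_zero _ ha0) ha0, ih]; push_cast; ring
  have indep : ∀ (z : F) (m n : ℕ), z ≠ 0 → z ^ p ^ m ∈ D → m ≤ n →
      (p : ZMod ℓ)⁻¹ ^ m * V (z ^ p ^ m) = (p : ZMod ℓ)⁻¹ ^ n * V (z ^ p ^ n) := by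
    intro z m n hz hm hmn
    obtain ⟨d, rfl⟩ := Nat.exists_eq_add_of_le hmn
    rw [pow_add p, pow_mul, hpow _ hm (pow_ne_zero _ hz), pow_add]
    push_cast
    have : (p : ZMod ℓ)⁻¹ ^ d * (p : ZMod ℓ) ^ d = 1 := by
      rw [← mul_pow, inv_mul_cancel₀ hp, one_pow]
    linear_combination (-(p : ZMod ℓ)⁻¹ ^ m * V (z ^ p ^ m)) * this
  have indep' : ∀ (z : F) (m n : ℕ), z ≠ 0 → z ^ p ^ m ∈ D → z ^ p ^ n ∈ D →
      (p : ZMod ℓ)⁻¹ ^ m * V (z ^ p ^ m) = (p : ZMod ℓ)⁻¹ ^ n * V (z ^ p ^ n) := by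
    intro z m n hz hm hn
    rcases le_total m n with h | h
    · exact indep z m n hz hm h
    · exact (indep z n m hz hn h).symm
  choose N hN using hD
  have up : ∀ (z : F) (m n : ℕ), z ^ p ^ m ∈ D → m ≤ n → z ^ p ^ n ∈ D := by
    intro z m n hm hmn
    obtain ⟨d, rfl⟩ := Nat.exists_eq_add_of_le hmn
    rw [pow_add p, pow_mul]
    exact pow_mem hm _
  refine ⟨KChar.ofFun (fun z => (p : ZMod ℓ)⁻¹ ^ N z * V (z ^ p ^ N z)) ?_, ?_⟩
  · intro a b ha hb
    have h1 := up a (N a) (N a + N b) (hN a) (by omega)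
    have h2 := up b (N b) (N a + N b) (hN b) (by omega)
    rw [indep' a (N a) (N a + N b) ha (hN a) h1, indep' b (N b) (N a + N b) hb (hN b) h2,
      indep' (a * b) (N (a * b)) (N a + N b) (mul_ne_zero ha hb) (hN _)
        (by rw [mul_pow]; exact mul_mem h1 h2), mul_pow,
      hV _ h1 _ h2 (pow_ne_zero _ ha) (pow_ne_zero _ hb), mul_add]
  · intro z n hz hn
    rw [KChar.ofFun_cls _ _ hz]
    exact indep' z _ _ hz (hN z) hn

lemma isSt_of_pi (p : ℕ) [ExpChar F p] {v w : KChar ℓ F}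
    (D : Subfield F) (hD : ∀ z : F, ∃ n : ℕ, z ^ p ^ n ∈ D) (V W : F → ZMod ℓ)
    (hv : ∀ (z : F) (n : ℕ), z ≠ 0 → z ^ p ^ n ∈ D →
      v (cls ℓ z) = (p : ZMod ℓ)⁻¹ ^ n * V (z ^ p ^ n))
    (hw : ∀ (z : F) (n : ℕ), z ≠ 0 → z ^ p ^ n ∈ D →
      w (cls ℓ z) = (p : ZMod ℓ)⁻¹ ^ n * W (z ^ p ^ n))
    (hS : ∀ a ∈ D, ∀ b ∈ D, a ≠ 0 → b ≠ 0 → a + b = 1 → V a * W b = W a * V b) : IsSt v w := by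
  intro a b ha hb hab
  obtain ⟨n, hn⟩ := hD a
  have hsum : a ^ p ^ n + b ^ p ^ n = 1 := by
    rw [← add_pow_expChar_pow, hab, one_pow]
  have hn' : b ^ p ^ n ∈ D := by
    rw [eq_sub_of_add_eq' hsum]; exact sub_mem D.one_mem hn
  rw [hv a n ha hn, hv b n hb hn', hw a n ha hn, hw b n hb hn']
  linear_combination ((p : ZMod ℓ)⁻¹ ^ n) ^ 2 *
    hS _ hn _ hn' (pow_ne_zero _ ha) (pow_ne_zero _ hb) hsum

end Classes

end MilnorRec

namespace MilnorRec

open Polynomial IntermediateField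

section Orders

variable {ℓ : ℕ} (p : ℕ) {k F : Type*} [Field k] [Field F] [Algebra k F]

/-- `t` is general up to `p`-powers: it is transcendental, and every element algebraic over `k(t)`
has a `p`-power in `k(t)`. -/
def PGen (k : Type*) {F : Type*} [Field k] [Field F] [Algebra k F] (t : F) : Prop :=
  Transcendental k t ∧ ∀ y : F, IsAlgebraic k⟮t⟯ y → ∃ n : ℕ, y ^ p ^ n ∈ k⟮t⟯

lemma Transcendental.aeval_ne_zero {t : F} (ht : Transcendental k t) {P : k[X]} (hP : P ≠ 0) :
    aeval t P ≠ 0 := fun h => ht ⟨P, hP, h⟩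

lemma Transcendental.aeval_injective {t : F} (ht : Transcendental k t) {P Q : k[X]}
    (h : aeval t P = aeval t Q) : P = Q := by
  by_contra hne
  exact ht ⟨P - Q, sub_ne_zero.2 hne, by rw [map_sub, h, sub_self]⟩

lemma transcendental_iff_notMem_range [IsAlgClosed k] {t : F} :
    Transcendental k t ↔ t ∉ Set.range (algebraMap k F) := by
  rw [Transcendental, not_iff_not]
  constructor
  · intro h
    exact minpoly.mem_range_of_degree_eq_one k t
      (IsAlgClosed.degree_eq_one_of_irreducible k (minpoly.irreducible h.isIntegral))
  · rintro ⟨a, rfl⟩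
    exact isAlgebraic_algebraMap a

lemma mem_adjoin_iff_exists_poly {t z : F} :
    z ∈ k⟮t⟯ ↔ ∃ N D : k[X], aeval t D ≠ 0 ∧ z * aeval t D = aeval t N := by
  rw [mem_adjoin_simple_iff]
  constructor
  · rintro ⟨r, s, rfl⟩
    by_cases hs : aeval t s = 0
    · exact ⟨0, 1, by simp, by simp [hs]⟩
    · exact ⟨r, s, hs, by field_simp⟩
  · rintro ⟨N, D, hD, h⟩
    exact ⟨N, D, by rw [eq_div_iff hD, h]⟩

variable {p}

lemma PGen.cast_rootMultiplicity_eq [Fact ℓ.Prime] (hp : (p : ZMod ℓ) ≠ 0) {t : F}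
    (ht : PGen p k t) {P Q : k[X]} (hP : P ≠ 0) (hQ : Q ≠ 0)
    (h : cls ℓ (aeval t P) = cls ℓ (aeval t Q)) (a : k) :
    (P.rootMultiplicity a : ZMod ℓ) = Q.rootMultiplicity a := by
  have hℓ : ℓ ≠ 0 := (Fact.out : ℓ.Prime).ne_zero
  have hP' := Transcendental.aeval_ne_zero ht.1 hP
  have hQ' := Transcendental.aeval_ne_zero ht.1 hQ
  obtain ⟨w, hw, e⟩ := (cls_eq_iff hP' hQ').1 h
  have hwa : IsAlgebraic k⟮t⟯ w := by
    refine IsAlgebraic.of_pow (n := ℓ) (Nat.pos_of_ne_zero hℓ) ?_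
    have : w ^ ℓ ∈ k⟮t⟯ := by
      rw [show w ^ ℓ = aeval t P / aeval t Q by rw [e]; field_simp]
      exact (mem_adjoin_simple_iff k _).2 ⟨P, Q, rfl⟩
    exact isAlgebraic_algebraMap (⟨w ^ ℓ, this⟩ : k⟮t⟯)
  obtain ⟨n, hn⟩ := ht.2 w hwa
  obtain ⟨N, D, hD, hND⟩ := mem_adjoin_iff_exists_poly.1 hn
  have hD0 : D ≠ 0 := by rintro rfl; simp at hD
  have hN0 : N ≠ 0 := by
    rintro rfl
    simp only [map_zero, mul_eq_zero, hD, or_false] at hND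
    exact pow_ne_zero _ hw hND
  have key : P ^ p ^ n * D ^ ℓ = Q ^ p ^ n * N ^ ℓ := by
    apply Transcendental.aeval_injective ht.1
    simp only [map_mul, map_pow]
    rw [← hND, e]; ring
  have hpow : ∀ (R : k[X]) (m : ℕ), R ≠ 0 →
      (R ^ m).rootMultiplicity a = m * R.rootMultiplicity a := by
    classical
    intro R m hR
    rw [← count_roots, ← count_roots, roots_pow, Multiset.count_nsmul]
  have h2 := congrArg (rootMultiplicity a) key
  rw [rootMultiplicity_mul (mul_ne_zero (pow_ne_zero _ hP) (pow_ne_zero _ hD0)),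
    rootMultiplicity_mul (mul_ne_zero (pow_ne_zero _ hQ) (pow_ne_zero _ hN0)),
    hpow _ _ hP, hpow _ _ hQ, hpow _ _ hD0, hpow _ _ hN0] at h2
  have h3 := congrArg (Nat.cast : ℕ → ZMod ℓ) h2
  push_cast at h3
  rw [CharP.cast_eq_zero (ZMod ℓ) ℓ, zero_mul, zero_mul, add_zero, add_zero] at h3
  exact mul_left_cancel₀ (pow_ne_zero _ hp) h3

lemma sub_algebraMap_ne_zero {t : F} (ht : Transcendental k t) (a : k) :
    t - algebraMap k F a ≠ 0 := by
  have := Transcendental.aeval_ne_zero ht (X_sub_C_ne_zero a)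
  simpa using this

section
variable [IsAlgClosed k] [Fact ℓ.Prime]

lemma cls_aeval_eq_prod {t : F} (ht : Transcendental k t) {P : k[X]} (hP : P ≠ 0) :
    cls ℓ (aeval t P) = (P.roots.map fun a => cls ℓ (t - algebraMap k F a)).prod := by
  have hℓ : ℓ ≠ 0 := (Fact.out : ℓ.Prime).ne_zero
  have hprod : ∀ s : Multiset k, (s.map fun a => (t - algebraMap k F a)).prod ≠ 0 ∧
      cls ℓ (s.map fun a => (t - algebraMap k F a)).prod =
        (s.map fun a => cls ℓ (t - algebraMap k F a)).prod := by
    intro s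
    induction s using Multiset.induction_on with
    | empty => simp
    | cons a s ih =>
      simp only [Multiset.map_cons, Multiset.prod_cons]
      exact ⟨mul_ne_zero (sub_algebraMap_ne_zero ht a) ih.1,
        by rw [cls_mul (sub_algebraMap_ne_zero ht a) ih.1, ih.2]⟩
  have h1 : aeval t P = algebraMap k F P.leadingCoeff *
      (P.roots.map fun a => (t - algebraMap k F a)).prod := by
    conv_lhs => rw [(IsAlgClosed.splits P).eq_prod_roots]
    rw [map_mul, aeval_C, map_multiset_prod, Multiset.map_map]
    simp
  rw [h1, cls_mul (by simpa using hP) (hprod _).1, cls_algebraMap hℓ, one_mul, (hprod _).2]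

lemma cls_aeval_congr {t : F} (ht : Transcendental k t) {P Q : k[X]} (hP : P ≠ 0) (hQ : Q ≠ 0)
    (h : ∀ a, (P.rootMultiplicity a : ZMod ℓ) = Q.rootMultiplicity a) :
    cls ℓ (aeval t P) = cls ℓ (aeval t Q) := by
  classical
  rw [cls_aeval_eq_prod ht hP, cls_aeval_eq_prod ht hQ, Finset.prod_multiset_map_count,
    Finset.prod_multiset_map_count,
    Finset.prod_subset (Finset.subset_union_left (s₁ := P.roots.toFinset) (s₂ := Q.roots.toFinset)),
    Finset.prod_subset (Finset.subset_union_right (s₁ := P.roots.toFinset) (s₂ := Q.roots.toFinset))]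
  · refine Finset.prod_congr rfl fun a _ => Cl_pow_congr ?_ _
    simpa using h a
  · intro a _ ha
    rw [Multiset.mem_toFinset] at ha
    rw [Multiset.count_eq_zero_of_notMem ha, pow_zero]
  · intro a _ ha
    rw [Multiset.mem_toFinset] at ha
    rw [Multiset.count_eq_zero_of_notMem ha, pow_zero]

end

/-- The group of classes of nonzero elements of `k(t)`. -/
def RA (ℓ : ℕ) [Fact ℓ.Prime] (k : Type*) {F : Type*} [Field k] [Field F] [Algebra k F] (t : F) :
    Subgroup (Cl ℓ F) where
  carrier := {c | ∃ P : k[X], aeval t P ≠ 0 ∧ cls ℓ (aeval t P) = c}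
  one_mem' := ⟨1, by simp, by simp⟩
  mul_mem' := by
    rintro _ _ ⟨P, hP, rfl⟩ ⟨Q, hQ, rfl⟩
    exact ⟨P * Q, by simp [hP, hQ], by rw [map_mul, cls_mul hP hQ]⟩
  inv_mem' := by
    rintro _ ⟨P, hP, rfl⟩
    refine ⟨P ^ (ℓ - 1), by simp [hP], ?_⟩
    rw [map_pow, cls_pow hP, eq_inv_iff_mul_eq_one, ← pow_succ,
      Nat.sub_add_cancel (Fact.out : ℓ.Prime).one_le, Cl_pow]

variable [Fact ℓ.Prime]

lemma cls_mem_RA {t : F} {P : k[X]} : cls ℓ (aeval t P) ∈ RA ℓ k t := by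
  by_cases h : aeval t P = 0
  · rw [h, cls_zero]; exact one_mem _
  · exact ⟨P, h, rfl⟩

lemma exists_poly_of_mem_RA {t : F} {c : Cl ℓ F} (hc : c ∈ RA ℓ k t) :
    ∃ P : k[X], P ≠ 0 ∧ cls ℓ (aeval t P) = c := by
  obtain ⟨P, hP, h⟩ := hc
  exact ⟨P, by rintro rfl; simp at hP, h⟩

open Classical in
/-- The order mod `ℓ` at `a` of a class represented by a polynomial in `t`. -/
def ordc (k : Type*) {F : Type*} [Field k] [Field F] [Algebra k F] (t : F) (a : k)
    (c : Cl ℓ F) : ZMod ℓ :=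
  if h : ∃ P : k[X], P ≠ 0 ∧ cls ℓ (aeval t P) = c then (h.choose.rootMultiplicity a : ZMod ℓ)
  else 0

section
variable (hp : (p : ZMod ℓ) ≠ 0) {t : F} (ht : PGen p k t)
include hp ht

lemma ordc_cls {P : k[X]} (hP : P ≠ 0) (a : k) :
    ordc k t a (cls ℓ (aeval t P)) = P.rootMultiplicity a := by
  have h : ∃ Q : k[X], Q ≠ 0 ∧ cls ℓ (aeval t Q) = cls ℓ (aeval t P) := ⟨P, hP, rfl⟩
  rw [ordc, dif_pos h]
  exact ht.cast_rootMultiplicity_eq hp h.choose_spec.1 hP h.choose_spec.2 a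

lemma ordc_sub [DecidableEq k] (a b : k) :
    ordc k t a (cls ℓ (t - algebraMap k F b)) = if a = b then 1 else 0 := by
  have h := ordc_cls (ℓ := ℓ) hp ht (X_sub_C_ne_zero b) a
  rw [map_sub, aeval_X, aeval_C] at h
  rw [h, rootMultiplicity_X_sub_C]
  split_ifs <;> simp

lemma ordc_mul {c d : Cl ℓ F} (hc : c ∈ RA ℓ k t) (hd : d ∈ RA ℓ k t) (a : k) :
    ordc k t a (c * d) = ordc k t a c + ordc k t a d := by
  obtain ⟨P, hP, rfl⟩ := exists_poly_of_mem_RA hc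
  obtain ⟨Q, hQ, rfl⟩ := exists_poly_of_mem_RA hd
  rw [← cls_mul (Transcendental.aeval_ne_zero ht.1 hP) (Transcendental.aeval_ne_zero ht.1 hQ),
    ← map_mul, ordc_cls hp ht hP, ordc_cls hp ht hQ, ordc_cls hp ht (mul_ne_zero hP hQ),
    rootMultiplicity_mul (mul_ne_zero hP hQ), Nat.cast_add]

lemma ordc_one (a : k) : ordc k t a (1 : Cl ℓ F) = 0 := by
  have := ordc_mul hp ht (one_mem _) (one_mem (RA ℓ k t)) a
  rw [mul_one] at this
  linear_combination -this

lemma ordc_inv {c : Cl ℓ F} (hc : c ∈ RA ℓ k t) (a : k) :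
    ordc k t a c⁻¹ = - ordc k t a c := by
  have := ordc_mul hp ht (inv_mem hc) hc a
  rw [inv_mul_cancel, ordc_one hp ht] at this
  linear_combination -this

lemma ordc_div {c d : Cl ℓ F} (hc : c ∈ RA ℓ k t) (hd : d ∈ RA ℓ k t) (a : k) :
    ordc k t a (c / d) = ordc k t a c - ordc k t a d := by
  rw [div_eq_mul_inv, ordc_mul hp ht hc (inv_mem hd), ordc_inv hp ht hd, sub_eq_add_neg]

lemma ordc_ext [IsAlgClosed k] {c d : Cl ℓ F} (hc : c ∈ RA ℓ k t) (hd : d ∈ RA ℓ k t)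
    (h : ∀ a, ordc k t a c = ordc k t a d) : c = d := by
  obtain ⟨P, hP, rfl⟩ := exists_poly_of_mem_RA hc
  obtain ⟨Q, hQ, rfl⟩ := exists_poly_of_mem_RA hd
  refine cls_aeval_congr ht.1 hP hQ fun a => ?_
  rw [← ordc_cls hp ht hP, ← ordc_cls hp ht hQ, h]

end

lemma cls_sub_mem_RA {t : F} (a : k) : cls ℓ (t - algebraMap k F a) ∈ RA ℓ k t := by
  have := cls_mem_RA (ℓ := ℓ) (t := t) (P := X - C a)
  simpa using this

end Orders

end MilnorRec

namespace MilnorRec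

open Polynomial

section Hensel

lemma powerSeries_hensel {A : Type*} [CommRing A] (g : (PowerSeries A)[X]) (hg : g.Monic) (a : A)
    (h : (g.map PowerSeries.constantCoeff).eval a = 0)
    (h' : IsUnit ((g.map PowerSeries.constantCoeff).derivative.eval a)) :
    ∃ r : PowerSeries A, g.eval r = 0 ∧ PowerSeries.constantCoeff r = a := by
  have hcc : ∀ f : (PowerSeries A)[X], PowerSeries.constantCoeff (f.eval (PowerSeries.C a)) =
      (f.map PowerSeries.constantCoeff).eval a := by
    intro f
    rw [eval_map, ← eval₂_hom, PowerSeries.constantCoeff_C]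
  obtain ⟨r, hr, hr'⟩ := HenselianRing.is_henselian (I := Ideal.span {(PowerSeries.X : PowerSeries A)})
    g hg (PowerSeries.C a) (by
      rw [Ideal.mem_span_singleton, PowerSeries.X_dvd_iff, hcc, h]) (by
      apply IsUnit.map
      rw [PowerSeries.isUnit_iff_constantCoeff, hcc, ← derivative_map]
      exact h')
  refine ⟨r, hr, ?_⟩
  rw [Ideal.mem_span_singleton, PowerSeries.X_dvd_iff, map_sub, sub_eq_zero] at hr'
  simpa using hr'

/-- The ring of iterated power series in two variables. -/
abbrev PS2 (E : Type*) [Field E] : Type _ := PowerSeries (PowerSeries E)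

/-- The constant term of an iterated power series. -/
def ct (E : Type*) [Field E] : PS2 E →+* E :=
  (PowerSeries.constantCoeff (R := E)).comp PowerSeries.constantCoeff

variable {E : Type*} [Field E]

lemma ps2_hensel (g : (PS2 E)[X]) (hg : g.Monic) (a : E) (h : (g.map (ct E)).eval a = 0)
    (h' : (g.map (ct E)).derivative.eval a ≠ 0) :
    ∃ r : PS2 E, g.eval r = 0 ∧ ct E r = a := by
  unfold ct at h h'
  rw [← Polynomial.map_map] at h h'
  obtain ⟨b, hb, hb'⟩ := powerSeries_hensel _ (hg.map _) a h h'.isUnit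
  obtain ⟨r, hr, hr'⟩ := powerSeries_hensel g hg b hb (by
    rw [PowerSeries.isUnit_iff_constantCoeff]
    have e : PowerSeries.constantCoeff (eval b (derivative (g.map PowerSeries.constantCoeff))) =
        eval a (derivative ((g.map PowerSeries.constantCoeff).map PowerSeries.constantCoeff)) := by
      rw [derivative_map _ (PowerSeries.constantCoeff (R := E)), eval_map, ← hb', eval₂_hom]
    rw [e]
    exact h'.isUnit)
  exact ⟨r, hr, by simp [ct, hr', hb']⟩

lemma isUnit_ps2_iff (f : PS2 E) : IsUnit f ↔ ct E f ≠ 0 := by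
  rw [PowerSeries.isUnit_iff_constantCoeff, PowerSeries.isUnit_iff_constantCoeff, isUnit_iff_ne_zero]
  rfl

/-- The roots of a monic polynomial with separable constant term lie in the power series ring. -/
lemma exists_ps2_of_root [IsAlgClosed E] {Ω : Type*} [Field Ω] (j : PS2 E →+* Ω)
    (hj : Function.Injective j) (g : (PS2 E)[X]) (hg : g.Monic) (hs : (g.map (ct E)).Separable)
    (z : Ω) (hz : g.eval₂ j z = 0) : ∃ r : PS2 E, j r = z := by
  classical
  have hroot : ∀ a : (g.map (ct E)).rootSet E, ∃ r : PS2 E, g.eval r = 0 ∧ ct E r = a := by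
    intro a
    have ha : (g.map (ct E)).eval (a : E) = 0 := by
      have := a.2
      rw [mem_rootSet] at this
      simpa using this.2
    refine ps2_hensel g hg a ha ?_
    exact hs.aeval_derivative_ne_zero (by simpa using ha)
  choose ρ hρ hρ' using hroot
  have hinj : Function.Injective fun a => j (ρ a) := by
    intro a b hab
    have := congrArg (ct E) (hj hab)
    rw [hρ', hρ'] at this
    exact Subtype.ext this
  have hcard : (Finset.univ.image fun a => j (ρ a)).card = g.natDegree := by
    rw [Finset.card_image_of_injective _ hinj, Finset.card_univ,
      card_rootSet_eq_natDegree hs (IsAlgClosed.splits _), hg.natDegree_map]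
  by_contra hcon
  push Not at hcon
  have hsub : insert z (Finset.univ.image fun a => j (ρ a)) ⊆ (g.map j).roots.toFinset := by
    intro w hw
    rw [Multiset.mem_toFinset, mem_roots (hg.map j).ne_zero, IsRoot, eval_map]
    rw [Finset.mem_insert] at hw
    rcases hw with rfl | hw
    · exact hz
    · obtain ⟨a, -, rfl⟩ := Finset.mem_image.1 hw
      rw [eval₂_at_apply, hρ, map_zero]
  have h1 := (Finset.card_le_card hsub).trans (Multiset.toFinset_card_le _)
  rw [Finset.card_insert_of_notMem, hcard] at h1
  · have h2 := (g.map j).card_roots'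
    rw [hg.natDegree_map] at h2
    omega
  · intro h
    obtain ⟨a, -, h⟩ := Finset.mem_image.1 h
    exact hcon _ h

end Hensel

section Valuations

variable {E : Type*} [Field E]

/-- Iterated Laurent series. -/
abbrev LS2 (E : Type*) [Field E] : Type _ := LaurentSeries (LaurentSeries E)

/-- The inclusion of iterated power series in iterated Laurent series. -/
def toLS2 (E : Type*) [Field E] : PS2 E →+* LS2 E :=
  (HahnSeries.ofPowerSeries ℤ (LaurentSeries E)).comp
    (PowerSeries.map (HahnSeries.ofPowerSeries ℤ E))

/-- The first component of the rank two valuation. -/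
def V1 (f : LS2 E) : ℤ := HahnSeries.order f

/-- The second component of the rank two valuation. -/
def V2 (f : LS2 E) : ℤ := HahnSeries.order (HahnSeries.leadingCoeff f)

lemma toLS2_injective : Function.Injective (toLS2 E) := by
  unfold toLS2
  rw [RingHom.coe_comp]
  exact HahnSeries.ofPowerSeries_injective.comp
    (PowerSeries.map_injective _ HahnSeries.ofPowerSeries_injective)

lemma V1_mul {a b : LS2 E} (ha : a ≠ 0) (hb : b ≠ 0) : V1 (a * b) = V1 a + V1 b :=
  HahnSeries.order_mul ha hb

lemma V2_mul {a b : LS2 E} (ha : a ≠ 0) (hb : b ≠ 0) : V2 (a * b) = V2 a + V2 b := by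
  rw [V2, HahnSeries.leadingCoeff_mul, HahnSeries.order_mul
    (HahnSeries.leadingCoeff_ne_zero.2 ha) (HahnSeries.leadingCoeff_ne_zero.2 hb)]
  rfl

lemma V_steinberg {a b : LS2 E} (ha : a ≠ 0) (hb : b ≠ 0) (hab : a + b = 1) :
    V1 a * V2 b = V2 a * V1 b := by
  have hone1 : V1 (1 : LS2 E) = 0 := HahnSeries.order_one
  have hone2 : V2 (1 : LS2 E) = 0 := by simp [V2]
  have key : ∀ a b : LS2 E, a ≠ 0 → b ≠ 0 → a + b = 1 → V1 a < V1 b → V1 a = 0 ∧ V2 a = 0 := by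
    intro a b ha hb hab hlt
    have hlt' : a.orderTop < b.orderTop := by
      rw [← HahnSeries.order_eq_orderTop_of_ne_zero ha,
        ← HahnSeries.order_eq_orderTop_of_ne_zero hb]
      exact_mod_cast hlt
    have h1 := HahnSeries.leadingCoeff_add_eq_left hlt'
    have h2 := HahnSeries.orderTop_add_eq_left hlt'
    rw [hab] at h1 h2
    constructor
    · rw [← HahnSeries.order_eq_orderTop_of_ne_zero ha, HahnSeries.orderTop_one] at h2
      exact_mod_cast h2.symm
    · rw [← hone2, V2, V2, h1]
  rcases lt_trichotomy (V1 a) (V1 b) with h | h | h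
  · obtain ⟨h1, h2⟩ := key a b ha hb hab h
    rw [h1, h2]; ring
  · by_cases h0 : V1 a = 0
    · rw [← h, h0]; ring
    · have hco : a.coeff (V1 a) + b.coeff (V1 b) = 0 := by
        rw [← h, ← HahnSeries.coeff_add, hab, HahnSeries.coeff_one, if_neg h0]
      have : V2 a = V2 b := by
        have h1 : a.leadingCoeff = - b.leadingCoeff := by
          rw [HahnSeries.leadingCoeff_eq, HahnSeries.leadingCoeff_eq]
          exact eq_neg_of_add_eq_zero_left hco
        rw [V2, V2, h1, HahnSeries.order_neg]
      rw [this, h]; ring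
  · obtain ⟨h1, h2⟩ := key b a hb ha (by rw [add_comm, hab]) h
    rw [h1, h2]; ring

lemma order_ofPowerSeries_of_ne {R : Type*} [Semiring R] {f : PowerSeries R}
    (h : PowerSeries.constantCoeff f ≠ 0) :
    HahnSeries.order (HahnSeries.ofPowerSeries ℤ R f) = 0 ∧
    HahnSeries.leadingCoeff (HahnSeries.ofPowerSeries ℤ R f) = PowerSeries.constantCoeff f := by
  have hc : (HahnSeries.ofPowerSeries ℤ R f).coeff 0 = PowerSeries.constantCoeff f := by
    simpa using HahnSeries.ofPowerSeries_apply_coeff (Γ := ℤ) f 0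
  have hne : (HahnSeries.ofPowerSeries ℤ R f).coeff 0 ≠ 0 := by rwa [hc]
  have h1 : HahnSeries.order (HahnSeries.ofPowerSeries ℤ R f) = 0 := by
    apply le_antisymm
    · exact HahnSeries.order_le_of_coeff_ne_zero hne
    · by_contra hlt
      push Not at hlt
      have h0 : HahnSeries.ofPowerSeries ℤ R f ≠ 0 := by rintro h0; simp [h0] at hne
      apply HahnSeries.coeff_order_eq_zero.not.2 h0
      rw [HahnSeries.ofPowerSeries_apply]
      apply HahnSeries.embDomain_of_notMem_range
      rintro ⟨n, hn⟩
      rw [← HahnSeries.ofPowerSeries_apply] at hn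
      have : (n : ℤ) < 0 := by
        refine lt_of_eq_of_lt ?_ hlt
        exact hn
      omega
  exact ⟨h1, by rw [HahnSeries.leadingCoeff_eq, h1, hc]⟩

lemma V_toLS2_of_ne {f : PS2 E} (h : PowerSeries.constantCoeff f ≠ 0) :
    V1 (toLS2 E f) = 0 ∧ V2 (toLS2 E f) =
      HahnSeries.order (HahnSeries.ofPowerSeries ℤ E (PowerSeries.constantCoeff f)) := by
  have hcc : PowerSeries.constantCoeff (PowerSeries.map (HahnSeries.ofPowerSeries ℤ E) f) =
      HahnSeries.ofPowerSeries ℤ E (PowerSeries.constantCoeff f) := by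
    rw [← PowerSeries.coeff_zero_eq_constantCoeff_apply, PowerSeries.coeff_map,
      PowerSeries.coeff_zero_eq_constantCoeff_apply]
  have hne : PowerSeries.constantCoeff (PowerSeries.map (HahnSeries.ofPowerSeries ℤ E) f) ≠ 0 := by
    rw [hcc]
    exact (map_ne_zero_iff _ HahnSeries.ofPowerSeries_injective).2 h
  obtain ⟨h1, h2⟩ := order_ofPowerSeries_of_ne hne
  exact ⟨h1, by rw [← hcc, ← h2]; rfl⟩

lemma V_toLS2_unit {f : PS2 E} (h : ct E f ≠ 0) : V1 (toLS2 E f) = 0 ∧ V2 (toLS2 E f) = 0 := by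
  have h0 : PowerSeries.constantCoeff f ≠ 0 := by
    intro h0
    apply h
    simp [ct, h0]
  obtain ⟨h1, h2⟩ := V_toLS2_of_ne h0
  exact ⟨h1, h2.trans (order_ofPowerSeries_of_ne h).1⟩

lemma V1_toLS2_X : V1 (toLS2 E PowerSeries.X) = 1 := by
  simp [toLS2, V1]

lemma V2_toLS2_X : V2 (toLS2 E PowerSeries.X) = 0 := by
  simp [toLS2, V2]

lemma V_toLS2_C_X : V1 (toLS2 E (PowerSeries.C PowerSeries.X)) = 0 ∧
    V2 (toLS2 E (PowerSeries.C PowerSeries.X)) = 1 := by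
  have h := V_toLS2_of_ne (E := E) (f := PowerSeries.C PowerSeries.X) (by simp [PowerSeries.X_ne_zero])
  refine ⟨h.1, h.2.trans ?_⟩
  simp

end Valuations

section Clearing

/-- Common denominators for polynomials over a ring of fractions. -/
lemma exists_clear_denom {A B : Type*} [CommRing A] [CommRing B] (φ : A →+* B) (S : Submonoid A)
    (h : ∀ z : B, ∃ b ∈ S, ∃ a, φ a = φ b * z) (f : B[X]) :
    ∃ b ∈ S, ∃ g : A[X], g.map φ = C (φ b) * f := by
  induction f using Polynomial.induction_on' with
  | add f₁ f₂ h₁ h₂ =>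
    obtain ⟨b₁, hb₁, g₁, hg₁⟩ := h₁
    obtain ⟨b₂, hb₂, g₂, hg₂⟩ := h₂
    refine ⟨b₁ * b₂, S.mul_mem hb₁ hb₂, C b₂ * g₁ + C b₁ * g₂, ?_⟩
    simp only [Polynomial.map_add, Polynomial.map_mul, map_C, hg₁, hg₂, map_mul]
    ring
  | monomial n z =>
    obtain ⟨b, hb, a, ha⟩ := h z
    exact ⟨b, hb, monomial n a, by rw [map_monomial, ha, C_mul_monomial]⟩

end Clearing

section Generic

/-- A property of pairs of scalars that holds outside a plane curve. -/
def Gen {k : Type*} [Field k] (P : k → k → Prop) : Prop :=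
  ∃ D : k[X][X], D ≠ 0 ∧ ∀ α β, evalEval α β D ≠ 0 → P α β

variable {k : Type*} [Field k]

lemma Gen.mono {P Q : k → k → Prop} (hP : Gen P) (h : ∀ α β, P α β → Q α β) : Gen Q := by
  obtain ⟨D, hD, H⟩ := hP
  exact ⟨D, hD, fun α β hαβ => h α β (H α β hαβ)⟩

lemma Gen.and {P Q : k → k → Prop} (hP : Gen P) (hQ : Gen Q) : Gen fun α β => P α β ∧ Q α β := by
  obtain ⟨D, hD, H⟩ := hP
  obtain ⟨D', hD', H'⟩ := hQ
  refine ⟨D * D', mul_ne_zero hD hD', fun α β h => ?_⟩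
  rw [evalEval_mul] at h
  exact ⟨H α β (left_ne_zero_of_mul h), H' α β (right_ne_zero_of_mul h)⟩

lemma Gen.of_forall {P : k → k → Prop} (h : ∀ α β, P α β) : Gen P :=
  ⟨1, one_ne_zero, fun α β _ => h α β⟩

lemma Gen.ne_zero {D : k[X][X]} (hD : D ≠ 0) : Gen fun α β => evalEval α β D ≠ 0 :=
  ⟨D, hD, fun _ _ h => h⟩

lemma Gen.finset {ι : Type*} (s : Finset ι) {P : ι → k → k → Prop} (h : ∀ i ∈ s, Gen (P i)) :
    Gen fun α β => ∀ i ∈ s, P i α β := by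
  classical
  induction s using Finset.induction_on with
  | empty => exact Gen.of_forall fun _ _ _ h => absurd h (Finset.notMem_empty _)
  | insert a s _ ih =>
    refine ((h a (Finset.mem_insert_self _ _)).and
      (ih fun i hi => h i (Finset.mem_insert_of_mem hi))).mono fun α β hαβ i hi => ?_
    rcases Finset.mem_insert.1 hi with rfl | hi
    · exact hαβ.1
    · exact hαβ.2 i hi

/-- Generic properties hold for almost all first coordinates and almost all second coordinates. -/
lemma Gen.eventually {P : k → k → Prop} (h : Gen P) :
    ∀ᶠ α in Filter.cofinite, ∀ᶠ β in Filter.cofinite, P α β := by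
  obtain ⟨D, hD, H⟩ := h
  obtain ⟨n, hn⟩ : ∃ n, D.coeff n ≠ 0 := by
    by_contra! hcon
    exact hD (Polynomial.ext fun n => by simpa using hcon n)
  have h1 : ∀ᶠ α in Filter.cofinite, (D.coeff n).eval α ≠ 0 := by
    rw [Filter.eventually_cofinite]
    refine (finite_setOfPred_isRoot hn).subset fun α hα => ?_
    simpa using hα
  filter_upwards [h1] with α hα
  have hne : D.map (evalRingHom α) ≠ 0 := fun h0 => hα (by
    have := congrArg (fun f => coeff f n) h0
    simpa using this)
  have h2 : ∀ᶠ β in Filter.cofinite, (D.map (evalRingHom α)).eval β ≠ 0 := by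
    rw [Filter.eventually_cofinite]
    refine (finite_setOfPred_isRoot hne).subset fun β hβ => ?_
    simpa using hβ
  filter_upwards [h2] with β hβ
  refine H α β ?_
  rwa [← map_evalRingHom_eval]

/-- No nonzero bivariate polynomial vanishes at the pair. -/
def Indep (k : Type*) {A : Type*} [Field k] [Field A] [Algebra k A] (x y : A) : Prop :=
  ∀ D : k[X][X], aevalAeval x y D = 0 → D = 0

end Generic

section Psi

variable {E : Type*} [Field E]

/-- Taylor expansion of bivariate polynomials. -/
def psi (α β : E) : E[X][X] →+* PS2 E :=
  (coeToPowerSeries.ringHom.comp (mapRingHom (coeToPowerSeries.ringHom.comp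
    (taylorAlgHom α).toRingHom))).comp (taylorAlgHom (C β)).toRingHom

lemma psi_injective (α β : E) : Function.Injective (psi α β) := by
  unfold psi
  simp only [RingHom.coe_comp]
  refine (((Polynomial.coe_injective _).comp (Polynomial.map_injective _ ?_))).comp
    (taylor_injective _)
  exact (Polynomial.coe_injective _).comp (taylor_injective _)

lemma psi_C (α β : E) (p : E[X]) :
    psi α β (C p) = PowerSeries.C ((taylor α p : E[X]) : PowerSeries E) := by
  simp [psi]

lemma psi_X (α β : E) :
    psi α β X = PowerSeries.X + PowerSeries.C (PowerSeries.C β) := by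
  simp [psi]

lemma psi_CX (α β : E) :
    psi α β (C X) = PowerSeries.C (PowerSeries.X + PowerSeries.C α) := by
  rw [psi_C]; simp

lemma psi_CC (α β c : E) : psi α β (C (C c)) = PowerSeries.C (PowerSeries.C c) := by
  rw [psi_C]; simp

lemma ct_psi (α β : E) (D : E[X][X]) : ct E (psi α β D) = evalEval α β D := by
  have : (ct E).comp (psi α β) = evalEvalRingHom α β := by
    refine Polynomial.ringHom_ext' (Polynomial.ringHom_ext' ?_ ?_) ?_
    · ext c; simp [psi_CC, ct]
    · simp [psi_CX, ct]
    · simp [psi_X, ct]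
  exact congrArg (fun f => f D) this

end Psi

section Embeddings

variable {E : Type u} {A : Type v} [Field E] [Field A] [Algebra E A]

/-- The algebraic closure of the field of iterated Laurent series. -/
abbrev Om (E : Type*) [Field E] : Type _ := AlgebraicClosure (LS2 E)

/-- The inclusion of iterated power series in `Om E`. -/
def toOm (E : Type*) [Field E] : PS2 E →+* Om E :=
  (algebraMap (LS2 E) (Om E)).comp (toLS2 E)

lemma toOm_injective : Function.Injective (toOm E) := by
  unfold toOm
  rw [RingHom.coe_comp]
  exact (algebraMap (LS2 E) (Om E)).injective.comp toLS2_injective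

/-- The embedding `ι` extends the Taylor expansion at `(α, β)`. -/
def IsEmb (x y : A) (α β : E) (ι : A →+* Om E) : Prop :=
  ∀ D : E[X][X], ι (aevalAeval x y D) = toOm E (psi α β D)

lemma exists_denom {x y : A} {z : A} (hz : z ∈ IntermediateField.adjoin E {x, y}) :
    ∃ N D : E[X][X], aevalAeval x y D ≠ 0 ∧ z * aevalAeval x y D = aevalAeval x y N := by
  have hr : Algebra.adjoin E {x, y} = (aevalAeval (R := E) x y).range := by
    refine le_antisymm (Algebra.adjoin_le ?_) ?_
    · rintro _ (rfl | rfl)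
      · exact ⟨C X, by simp⟩
      · exact ⟨X, by simp⟩
    · rintro _ ⟨D, rfl⟩
      have hx : x ∈ Algebra.adjoin E {x, y} := Algebra.subset_adjoin (by simp)
      have hy : y ∈ Algebra.adjoin E {x, y} := Algebra.subset_adjoin (by simp)
      change aevalAeval x y D ∈ _
      induction D using Polynomial.induction_on' with
      | add p q hp hq => rw [map_add]; exact add_mem hp hq
      | monomial n p =>
        rw [← C_mul_X_pow_eq_monomial, map_mul, map_pow, aevalAeval_Y, aevalAeval_C]
        exact mul_mem (Algebra.adjoin_mono (by simp) (aeval_mem_adjoin_singleton E x))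
          (pow_mem hy n)
  rw [IntermediateField.mem_adjoin_iff_div, hr] at hz
  obtain ⟨_, ⟨N, rfl⟩, _, ⟨D, rfl⟩, rfl⟩ := hz
  by_cases h : aevalAeval x y D = 0
  · exact ⟨0, 1, by simp, by simp [h]⟩
  · exact ⟨N, D, h, div_mul_cancel₀ _ h⟩

lemma aevalAeval_mem_adjoin (x y : A) (D : E[X][X]) :
    aevalAeval x y D ∈ IntermediateField.adjoin E {x, y} := by
  have hy : y ∈ IntermediateField.adjoin E {x, y} := IntermediateField.subset_adjoin _ _ (by simp)
  have hx : x ∈ IntermediateField.adjoin E {x, y} := IntermediateField.subset_adjoin _ _ (by simp)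
  induction D using Polynomial.induction_on' with
  | add p q hp hq => rw [map_add]; exact add_mem hp hq
  | monomial n p =>
    rw [← C_mul_X_pow_eq_monomial, map_mul, map_pow, aevalAeval_Y, aevalAeval_C]
    refine mul_mem ?_ (pow_mem hy n)
    have := (aeval (R := E) (⟨x, hx⟩ : IntermediateField.adjoin E {x, y}) p).2
    rwa [← IntermediateField.aeval_coe] at this

lemma exists_lift_of_isAlgebraic {R S Ω : Type*} [CommRing R] [IsDomain R] [CommRing S] [IsDomain S]
    [Field Ω] [IsAlgClosed Ω] (f : R →+* S) (g : R →+* Ω) (hf : Function.Injective f)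
    (hg : Function.Injective g) (h : ∀ z, ∃ P : R[X], P ≠ 0 ∧ P.eval₂ f z = 0) :
    ∃ ι : S →+* Ω, ∀ r, ι (f r) = g r := by
  let _ : Algebra R S := f.toAlgebra
  let _ : Algebra R Ω := g.toAlgebra
  have : FaithfulSMul R S := (faithfulSMul_iff_algebraMap_injective _ _).2 hf
  have : FaithfulSMul R Ω := (faithfulSMul_iff_algebraMap_injective _ _).2 hg
  have : Algebra.IsAlgebraic R S := ⟨h⟩
  let ι : S →ₐ[R] Ω := IsAlgClosed.lift
  exact ⟨ι.toRingHom, fun D => ι.commutes D⟩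

/-- Bivariate polynomials in two elements, as elements of the field they generate. -/
def evAdjoin (x y : A) : E[X][X] →+* IntermediateField.adjoin E {x, y} :=
  (aevalAeval (R := E) x y).toRingHom.codRestrict _ (aevalAeval_mem_adjoin x y)

lemma coe_evAdjoin (x y : A) (D : E[X][X]) :
    (evAdjoin x y D : A) = aevalAeval x y D := rfl

lemma evAdjoin_injective {x y : A} (hxy : Indep E x y) :
    Function.Injective (evAdjoin (E := E) x y) := by
  rw [injective_iff_map_eq_zero]
  intro r hr
  exact hxy r (by rw [← coe_evAdjoin, hr]; rfl)

lemma evAdjoin_denom (x y : A) (z : IntermediateField.adjoin E {x, y}) :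
    ∃ b ∈ nonZeroDivisors E[X][X], ∃ a, evAdjoin x y a = evAdjoin x y b * z := by
  obtain ⟨N, D, hD, h⟩ := exists_denom z.2
  refine ⟨D, mem_nonZeroDivisors_of_ne_zero fun h0 => hD (by rw [h0, map_zero]), N, ?_⟩
  exact Subtype.ext (by rw [mul_comm]; exact h.symm)

lemma exists_isEmb {x y : A} (hxy : Indep E x y)
    (halg : Algebra.IsAlgebraic (IntermediateField.adjoin E {x, y}) A) (α β : E) :
    ∃ ι : A →+* Om E, IsEmb x y α β ι := by
  refine exists_lift_of_isAlgebraic (aevalAeval (R := E) x y).toRingHom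
    ((toOm E).comp (psi α β)) ((injective_iff_map_eq_zero _).2 hxy)
    (toOm_injective.comp (psi_injective α β)) fun z => ?_
  obtain ⟨P, hP, hz⟩ := halg.isAlgebraic z
  obtain ⟨d, hd, Q, hQ⟩ := exists_clear_denom _ _ (evAdjoin_denom x y) P
  have hd' : evAdjoin x y d ≠ 0 := fun h0 => nonZeroDivisors.ne_zero hd
    (evAdjoin_injective hxy (by rw [h0, map_zero]))
  refine ⟨Q, fun h0 => ?_, ?_⟩
  · rw [h0, Polynomial.map_zero] at hQ
    exact mul_ne_zero (C_ne_zero.2 hd') hP hQ.symm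
  · change eval₂ ((algebraMap (IntermediateField.adjoin E {x, y}) A).comp (evAdjoin x y)) z Q = 0
    rw [← eval₂_map, hQ, eval₂_mul, ← aeval_def, ← aeval_def, hz, mul_zero]

/-- Separable elements have power series expansions at general points. -/
lemma gen_mem_ps2 [IsAlgClosed E] {x y : A} (hxy : Indep E x y) {z : A}
    (hz : IsSeparable (IntermediateField.adjoin E {x, y}) z) :
    Gen fun α β : E => ∀ ι : A →+* Om E, IsEmb x y α β ι → ∃ r, toOm E r = ι z := by
  classical
  set M := IntermediateField.adjoin E {x, y}
  let φ : E[X][X] →+* M := evAdjoin x y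
  have hinj : Function.Injective φ := evAdjoin_injective hxy
  have hcl := evAdjoin_denom (E := E) x y
  have h_integral : IsIntegral M z := hz.isIntegral
  obtain ⟨a, b, hab⟩ := hz
  set m := minpoly M z
  have hm : m.Monic := minpoly.monic h_integral
  obtain ⟨d₀, hd₀, g, hg⟩ := exists_clear_denom φ _ hcl m
  obtain ⟨d₁, hd₁, a', ha'⟩ := exists_clear_denom φ _ hcl a
  obtain ⟨d₂, hd₂, b', hb'⟩ := exists_clear_denom φ _ hcl b
  have hd₀' := nonZeroDivisors.ne_zero hd₀
  have hd₁' := nonZeroDivisors.ne_zero hd₁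
  have hd₂' := nonZeroDivisors.ne_zero hd₂
  have hlc : g.leadingCoeff = d₀ := by
    apply hinj
    rw [← leadingCoeff_map_of_injective hinj, hg, leadingCoeff_mul, leadingCoeff_C,
      hm.leadingCoeff, mul_one]
  have hbez : C d₂ * a' * g + C d₁ * b' * derivative g = C (d₀ * d₁ * d₂) := by
    apply Polynomial.map_injective φ hinj
    simp only [Polynomial.map_add, Polynomial.map_mul, map_C, ← derivative_map, hg, ha', hb',
      derivative_mul, derivative_C, map_mul]
    linear_combination (C (φ d₀) * C (φ d₁) * C (φ d₂)) * hab
  refine ⟨d₀ * d₁ * d₂, mul_ne_zero (mul_ne_zero hd₀' hd₁') hd₂', fun α β hne ι hι => ?_⟩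
  have hlcu : IsUnit (psi α β d₀) := by
    rw [isUnit_ps2_iff, ct_psi]
    rw [evalEval_mul, evalEval_mul] at hne
    exact left_ne_zero_of_mul (left_ne_zero_of_mul hne)
  obtain ⟨u, hu⟩ := hlcu
  have hlc' : (g.map (psi α β)).leadingCoeff = u := by
    rw [leadingCoeff_map_of_injective (psi_injective α β), hlc, hu]
  refine exists_ps2_of_root (toOm E) toOm_injective (C (↑u⁻¹ : PS2 E) * g.map (psi α β))
    (monic_C_mul_of_mul_leadingCoeff_eq_one (by rw [hlc']; simp)) ?_ (ι z) ?_
  · have hsep : (g.map (evalEvalRingHom α β)).Separable := by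
      refine ⟨C (evalEval α β (d₀ * d₁ * d₂))⁻¹ * (C d₂ * a').map (evalEvalRingHom α β),
        C (evalEval α β (d₀ * d₁ * d₂))⁻¹ * (C d₁ * b').map (evalEvalRingHom α β), ?_⟩
      rw [derivative_map, mul_assoc (C _), mul_assoc (C _), ← mul_add, ← Polynomial.map_mul,
        ← Polynomial.map_mul, ← Polynomial.map_add, hbez, map_C, ← C_mul]
      change C (_ * evalEval α β _) = 1
      rw [inv_mul_cancel₀ hne, C_1]
    have hcomp : (ct E).comp (psi α β) = evalEvalRingHom α β := RingHom.ext (ct_psi α β)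
    rw [Polynomial.map_mul, map_C, Polynomial.map_map, hcomp]
    refine Separable.unit_mul ?_ hsep
    rw [isUnit_C, isUnit_iff_ne_zero]
    exact ((isUnit_ps2_iff _).1 (Units.isUnit _))
  · rw [eval₂_mul, eval₂_map]
    have hcomp : (toOm E).comp (psi α β) = (ι.comp (algebraMap M A)).comp φ :=
      RingHom.ext fun D => (hι D).symm
    rw [hcomp, ← eval₂_map, hg, eval₂_mul, ← hom_eval₂ m]
    have : eval₂ (algebraMap M A) z m = 0 := minpoly.aeval M z
    rw [this, map_zero, mul_zero, mul_zero]

end Embeddings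

end MilnorRec

namespace MilnorRec

open Polynomial IntermediateField

section FieldBasics

variable {k : Type*} {A : Type*} [Field k] [Field A] [Algebra k A]

lemma isAlgebraic_of_subset {F F' : Type*} [Field F] [Field F'] [Algebra F A] [Algebra F' A]
    {K₁ : IntermediateField F A} {K₂ : IntermediateField F' A} (h : ∀ z ∈ K₁, z ∈ K₂) {z : A}
    (hz : IsAlgebraic K₁ z) : IsAlgebraic K₂ z := by
  obtain ⟨P, hP, hz⟩ := hz
  let φ : K₁ →+* K₂ := ((algebraMap K₁ A).codRestrict K₂ fun w => h _ w.2)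
  refine ⟨P.map φ, (Polynomial.map_ne_zero_iff φ.injective).2 hP, ?_⟩
  rw [aeval_def, eval₂_map]
  exact hz

lemma indep_iff_algebraicIndependent {x y : A} :
    Indep k x y ↔ AlgebraicIndependent k ![x, y] := by
  let θ : k[X][X] →ₐ[k] MvPolynomial (Fin 2) k := aevalAeval (MvPolynomial.X 0) (MvPolynomial.X 1)
  let θ' : MvPolynomial (Fin 2) k →ₐ[k] k[X][X] := MvPolynomial.aeval ![C X, X]
  have h1 : θ'.comp θ = AlgHom.id k _ := by
    apply AlgHom.coe_ringHom_injective
    refine Polynomial.ringHom_ext' (Polynomial.ringHom_ext' ?_ ?_) ?_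
    · ext c; simp [θ, θ', algebraMap_def]
    · simp [θ, θ']
    · simp [θ, θ']
  have h2 : (MvPolynomial.aeval ![x, y]).comp θ = aevalAeval (R := k) x y := by
    apply AlgHom.coe_ringHom_injective
    refine Polynomial.ringHom_ext' (Polynomial.ringHom_ext' ?_ ?_) ?_
    · ext c; simp [θ]
    · simp [θ]
    · simp [θ]
  have h3 : (aevalAeval (R := k) x y).comp θ' = MvPolynomial.aeval ![x, y] := by
    ext i; fin_cases i <;> simp [θ']
  have h4 : θ.comp θ' = AlgHom.id k _ := by
    ext i; fin_cases i <;> simp [θ, θ']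
  rw [AlgebraicIndependent, injective_iff_map_eq_zero]
  constructor
  · intro h P hP
    have := h (θ' P) (by rw [← hP, ← h3]; rfl)
    rw [← AlgHom.id_apply (R := k) P, ← h4, AlgHom.comp_apply, this, map_zero]
  · intro h D hD
    have := h (θ D) (by rw [← hD, ← h2]; rfl)
    rw [← AlgHom.id_apply (R := k) D, ← h1, AlgHom.comp_apply, this, map_zero]

lemma Indep.symm {x y : A} (h : Indep k x y) : Indep k y x := by
  intro D hD
  have := h (Bivariate.swap D) (by rw [Bivariate.aevalAeval_swap]; exact hD)
  simpa using this

/-- Polynomials in an element, as elements of the field it generates. -/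
def evSimple (k : Type*) {A : Type*} [Field k] [Field A] [Algebra k A] (x : A) : k[X] →+* k⟮x⟯ :=
  (aeval (R := k) x).toRingHom.codRestrict _ fun P =>
    mem_adjoin_iff_exists_poly.2 ⟨P, 1, by simp, by simp⟩

lemma coe_evSimple (x : A) (P : k[X]) : (evSimple k x P : A) = aeval x P := rfl

lemma evSimple_injective {x : A} (hx : Transcendental k x) :
    Function.Injective (evSimple k x) := fun P Q h =>
  Transcendental.aeval_injective hx (by rw [← coe_evSimple, h, coe_evSimple])

lemma evSimple_denom (x : A) (z : k⟮x⟯) :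
    ∃ b ∈ nonZeroDivisors k[X], ∃ a, evSimple k x a = evSimple k x b * z := by
  obtain ⟨N, D, hD, hz⟩ := mem_adjoin_iff_exists_poly.1 z.2
  refine ⟨D, mem_nonZeroDivisors_of_ne_zero fun h0 => hD (by rw [h0, map_zero]), N, ?_⟩
  exact Subtype.ext (by rw [mul_comm]; exact hz.symm)

lemma aevalAeval_eq_eval₂ (x y : A) (D : k[X][X]) :
    aevalAeval x y D = eval₂ ((algebraMap k⟮x⟯ A).comp (evSimple k x)) y D := by
  have : (aevalAeval x y : k[X][X] →ₐ[k] A).toRingHom =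
      eval₂RingHom ((algebraMap k⟮x⟯ A).comp (evSimple k x)) y := by
    refine Polynomial.ringHom_ext' (Polynomial.ringHom_ext' ?_ ?_) ?_
    · ext c; simp [coe_evSimple]
    · simp [coe_evSimple]
    · simp
  exact congrArg (fun f => f D) this

lemma indep_iff {x y : A} :
    Indep k x y ↔ Transcendental k x ∧ ¬ IsAlgebraic k⟮x⟯ y := by
  constructor
  · intro h
    have hx : Transcendental k x := by
      rintro ⟨P, hP, hPx⟩
      exact hP (C_injective (by rw [h (C P) (by rw [aevalAeval_C, hPx]), C_0]))
    refine ⟨hx, ?_⟩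
    rintro ⟨P, hP, hPy⟩
    obtain ⟨b, hb, g, hg⟩ := exists_clear_denom _ _ (evSimple_denom x) P
    have hb' : evSimple k x b ≠ 0 := fun h0 => nonZeroDivisors.ne_zero hb
      (evSimple_injective hx (by rw [h0, map_zero]))
    have hg0 : g = 0 := by
      refine h g ?_
      rw [aevalAeval_eq_eval₂, ← eval₂_map, hg, eval₂_mul, ← aeval_def, ← aeval_def, hPy, mul_zero]
    rw [hg0, Polynomial.map_zero] at hg
    exact mul_ne_zero (C_ne_zero.2 hb') hP hg.symm
  · rintro ⟨hx, hy⟩ D hD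
    by_contra hne
    apply hy
    refine ⟨D.map (evSimple k x), (Polynomial.map_ne_zero_iff (evSimple_injective hx)).2 hne, ?_⟩
    rw [aeval_def, eval₂_map, ← hD, aevalAeval_eq_eval₂]

lemma Indep.left {x y : A} (h : Indep k x y) : Transcendental k x := (indep_iff.1 h).1

lemma Indep.right {x y : A} (h : Indep k x y) : Transcendental k y := h.symm.left

lemma Indep.ne {x y : A} (h : Indep k x y) : x ≠ y := by
  rintro rfl
  exact (indep_iff.1 h).2 (isAlgebraic_algebraMap (⟨x, mem_adjoin_simple_self k x⟩ : k⟮x⟯))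

open scoped IntermediateField.algebraAdjoinAdjoin in
/-- An algebraically closed subfield over which a given independent family has only two
members left. -/
lemma exists_big_field [IsAlgClosed A] {Z : Set A} (hZ : AlgebraicIndepOn k id Z) {x y : A}
    (hx : x ∈ Z) (hy : y ∈ Z) (hxy : x ≠ y) :
    ∃ E : IntermediateField k A, IsAlgClosed E ∧ Indep E x y ∧
      Algebra.IsAlgebraic (adjoin E {x, y}) A ∧ Z \ {x, y} ⊆ E := by
  obtain ⟨t, hZt, ht⟩ := exists_isTranscendenceBasis_superset hZ
  let U : Set A := t \ {x, y}
  let F₀ := adjoin k U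
  let E₁ := algebraicClosure F₀ A
  let E : IntermediateField k A := E₁.restrictScalars k
  have hUE : ∀ z ∈ U, z ∈ E := fun z hz =>
    E₁.algebraMap_mem (⟨z, subset_adjoin k U hz⟩ : F₀)
  refine ⟨E, (algebraicClosure.isAlgClosure F₀ A).isAlgClosed, ?_, ⟨fun z => ?_⟩, ?_⟩
  · let s : Set t := {i | (i : A) ∈ U}
    have hs : ((↑) : t → A) '' s = U := by
      ext z; constructor
      · rintro ⟨i, hi, rfl⟩; exact hi
      · intro hz; exact ⟨⟨z, hz.1⟩, hz, rfl⟩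
    have hdis : Disjoint s ({⟨x, hZt hx⟩, ⟨y, hZt hy⟩} : Set t) := by
      rw [Set.disjoint_left]
      rintro i hi (rfl | rfl)
      · exact hi.2 (by simp)
      · exact hi.2 (by simp)
    have h1 := ht.1.adjoin_of_disjoint hdis
    rw [hs] at h1
    have h2 : AlgebraicIndependent (Algebra.adjoin k U) ![x, y] := by
      have := h1.comp ![⟨⟨x, hZt hx⟩, by simp⟩, ⟨⟨y, hZt hy⟩, by simp⟩] (by
        intro i j hij
        fin_cases i <;> fin_cases j <;> simp_all)
      convert this using 1
      ext i; fin_cases i <;> rfl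
    have h3 : AlgebraicIndependent F₀ ![x, y] := h2.extendScalars F₀
    have h4 : AlgebraicIndependent E₁ ![x, y] := h3.algebraicClosure
    exact indep_iff_algebraicIndependent.2 h4
  · have h1 := ht.isAlgebraic_field.isAlgebraic z
    refine isAlgebraic_of_subset ?_ h1
    have : adjoin k (Set.range ((↑) : t → A)) ≤ (adjoin E {x, y}).restrictScalars k := by
      rw [adjoin_le_iff]
      rintro _ ⟨z, rfl⟩
      by_cases hz : (z : A) ∈ U
      · exact (adjoin E {x, y}).algebraMap_mem (⟨z, hUE _ hz⟩ : E)
      · refine subset_adjoin E {x, y} ?_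
        by_contra hcon
        exact hz ⟨z.2, hcon⟩
    exact this
  · rintro z ⟨hz, hz'⟩
    exact hUE z ⟨hZt hz, hz'⟩

end FieldBasics

section Flags

/-- A Steinberg pair of characters coming from a flag `point ∈ curve`, where the curve is
`y = β` and the point has coordinates `x = α`, `s = γ`. -/
def Fl (ℓ : ℕ) (l : Type*) {F : Type*} [Field l] [Field F] [Algebra l F] (x y s : F)
    (α β γ : l) (j : ZMod ℓ) : Prop :=
  ∃ v w : KChar ℓ F, IsSt v w ∧ ∀ P : l[X], P ≠ 0 →
    (v (cls ℓ (aeval x P)) = 0 ∧ w (cls ℓ (aeval x P)) = (P.rootMultiplicity α : ℕ)) ∧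
    (v (cls ℓ (aeval y P)) = (P.rootMultiplicity β : ℕ) ∧ w (cls ℓ (aeval y P)) = 0) ∧
    (v (cls ℓ (aeval s P)) = 0 ∧ w (cls ℓ (aeval s P)) = j * (P.rootMultiplicity γ : ℕ))

lemma aeval_pow_expChar {l F : Type*} [Field l] [Field F] [Algebra l F] (p : ℕ) [ExpChar l p]
    [ExpChar F p] (n : ℕ) (s : F) (P : l[X]) :
    aeval s P ^ p ^ n = aeval (s ^ p ^ n) (P.map (iterateFrobenius l p n)) := by
  rw [← iterateFrobenius_def (R := F), aeval_def, hom_eval₂, aeval_def, eval₂_map,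
    iterateFrobenius_def (R := F)]
  congr 1
  ext c
  simp [iterateFrobenius_def]

lemma Fl.of_pow {ℓ : ℕ} [Fact ℓ.Prime] {l F : Type*} [Field l] [Field F] [Algebra l F] {p : ℕ}
    [ExpChar l p] [ExpChar F p] (hp : (p : ZMod ℓ) ≠ 0) {x y s : F} {α β γ : l} {j : ZMod ℓ}
    (n : ℕ) (hs : Transcendental l s) (h : Fl ℓ l x y (s ^ p ^ n) α β (γ ^ p ^ n) j) :
    Fl ℓ l x y s α β γ ((p : ZMod ℓ)⁻¹ ^ n * j) := by
  obtain ⟨v, w, hst, H⟩ := h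
  refine ⟨v, w, hst, fun P hP => ⟨(H P hP).1, (H P hP).2.1, ?_⟩⟩
  have hinj : Function.Injective (iterateFrobenius l p n) := (iterateFrobenius l p n).injective
  have hP' := (Polynomial.map_ne_zero_iff hinj).2 hP
  obtain ⟨h1, h2⟩ := (H _ hP').2.2
  have h3 : (P.map (iterateFrobenius l p n)).rootMultiplicity (γ ^ p ^ n) =
      P.rootMultiplicity γ := by
    rw [← iterateFrobenius_def (R := l), ← eq_rootMultiplicity_map hinj]
  have h0 : aeval s P ≠ 0 := Transcendental.aeval_ne_zero hs hP
  rw [← aeval_pow_expChar, cls_pow h0, KChar.map_pow] at h1 h2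
  rw [h3] at h2
  have hq : ((p ^ n : ℕ) : ZMod ℓ) ≠ 0 := by push_cast; exact pow_ne_zero _ hp
  constructor
  · exact (mul_eq_zero.1 h1).resolve_left hq
  · rw [mul_assoc, ← h2]
    push_cast
    rw [← mul_assoc, ← mul_pow, inv_mul_cancel₀ hp, one_pow, one_mul]

variable {ℓ : ℕ} {E : Type*} [Field E] {F : Type*} [Field F]

lemma exists_kchar_of_emb [Fact ℓ.Prime] {p : ℕ} [ExpChar F p] (hp : (p : ZMod ℓ) ≠ 0)
    (θ : F →+* Om E)
    (hθ : ∀ z, ∃ (n : ℕ) (f : LS2 E), algebraMap (LS2 E) (Om E) f = θ z ^ p ^ n) :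
    ∃ v w : KChar ℓ F, IsSt v w ∧ ∀ z ≠ 0, ∀ f : LS2 E, algebraMap (LS2 E) (Om E) f = θ z →
      v (cls ℓ z) = (V1 f : ZMod ℓ) ∧ w (cls ℓ z) = (V2 f : ZMod ℓ) := by
  let D : Subfield F := (algebraMap (LS2 E) (Om E)).fieldRange.comap θ
  have hD : ∀ z, ∃ n : ℕ, z ^ p ^ n ∈ D := fun z => by
    obtain ⟨n, f, hf⟩ := hθ z
    exact ⟨n, f, by rw [hf, map_pow]⟩
  have hmem : ∀ z, z ∈ D → ∃ f, algebraMap (LS2 E) (Om E) f = θ z := fun z hz => hz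
  let lift : F → LS2 E := fun z => Function.invFun (algebraMap (LS2 E) (Om E)) (θ z)
  have hinj : Function.Injective (algebraMap (LS2 E) (Om E)) :=
    (algebraMap (LS2 E) (Om E)).injective
  have hlift : ∀ z f, algebraMap (LS2 E) (Om E) f = θ z → lift z = f := fun z f h => by
    simp only [lift, ← h]
    exact Function.leftInverse_invFun hinj f
  have hlift' : ∀ z ∈ D, algebraMap (LS2 E) (Om E) (lift z) = θ z := fun z hz => by
    obtain ⟨f, hf⟩ := hmem z hz
    rw [hlift z f hf, hf]
  have hne : ∀ z ∈ D, z ≠ 0 → lift z ≠ 0 := fun z hz h0 h => by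
    have := hlift' z hz
    rw [h, map_zero] at this
    exact h0 ((map_eq_zero θ).1 this.symm)
  have hmul : ∀ a ∈ D, ∀ b ∈ D, lift (a * b) = lift a * lift b := fun a ha b hb =>
    hlift _ _ (by rw [map_mul, map_mul, hlift' a ha, hlift' b hb])
  have hadd : ∀ a ∈ D, ∀ b ∈ D, lift (a + b) = lift a + lift b := fun a ha b hb =>
    hlift _ _ (by rw [map_add, map_add, hlift' a ha, hlift' b hb])
  obtain ⟨v, hv⟩ := exists_kchar_of_pi p hp D hD (fun z => ((V1 (lift z) : ℤ) : ZMod ℓ)) (by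
    intro a ha b hb ha0 hb0
    rw [hmul a ha b hb, V1_mul (hne a ha ha0) (hne b hb hb0), Int.cast_add])
  obtain ⟨w, hw⟩ := exists_kchar_of_pi p hp D hD (fun z => ((V2 (lift z) : ℤ) : ZMod ℓ)) (by
    intro a ha b hb ha0 hb0
    rw [hmul a ha b hb, V2_mul (hne a ha ha0) (hne b hb hb0), Int.cast_add])
  refine ⟨v, w, isSt_of_pi p D hD (fun z => ((V1 (lift z) : ℤ) : ZMod ℓ))
    (fun z => ((V2 (lift z) : ℤ) : ZMod ℓ)) hv hw ?_, ?_⟩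
  · intro a ha b hb ha0 hb0 hab
    have h1 : lift a + lift b = 1 := by
      rw [← hadd a ha b hb, hab]
      exact hlift _ _ (by rw [map_one, map_one])
    exact_mod_cast congrArg (Int.cast : ℤ → ZMod ℓ)
      (V_steinberg (hne a ha ha0) (hne b hb hb0) h1)
  · intro z hz f hf
    have hzD : z ^ p ^ 0 ∈ D := by rw [pow_zero, pow_one]; exact ⟨f, hf⟩
    have h1 := hv z 0 hz hzD
    have h2 := hw z 0 hz hzD
    rw [pow_zero, pow_zero, pow_one, one_mul, hlift z f hf] at h1 h2
    exact ⟨h1, h2⟩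

variable {l : Type*} [Field l] [Algebra l F] [Algebra l E]

/-- The embedding of the scalars in the double power series ring. -/
def scal (l E : Type*) [Field l] [Field E] [Algebra l E] : l →+* PS2 E :=
  (PowerSeries.C).comp ((PowerSeries.C).comp (algebraMap l E))

lemma ct_scal (c : l) : ct E (scal l E c) = algebraMap l E c := by simp [ct, scal]

lemma emb_aeval {θ : F →+* Om E} (hθl : ∀ c : l, θ (algebraMap l F c) = toOm E (scal l E c))
    {t : F} {r : PS2 E} (hr : toOm E r = θ t) (P : l[X]) :
    θ (aeval t P) = toOm E (P.eval₂ (scal l E) r) := by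
  rw [aeval_def, hom_eval₂, hom_eval₂, hr]
  congr 1
  ext c
  exact hθl c

lemma ct_eval₂_scal (r : PS2 E) (P : l[X]) :
    ct E (P.eval₂ (scal l E) r) = aeval (ct E r) P := by
  rw [hom_eval₂, aeval_def]
  exact congrArg (fun f => eval₂ f _ P) (RingHom.ext ct_scal)

lemma V_eval₂_of_forall_ne [IsAlgClosed l] {r : PS2 E} (h : ∀ γ : l, ct E r ≠ algebraMap l E γ)
    {P : l[X]} (hP : P ≠ 0) :
    V1 (toLS2 E (P.eval₂ (scal l E) r)) = 0 ∧ V2 (toLS2 E (P.eval₂ (scal l E) r)) = 0 := by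
  refine V_toLS2_unit ?_
  rw [ct_eval₂_scal]
  refine Transcendental.aeval_ne_zero ((transcendental_iff_notMem_range).2 ?_) hP
  rintro ⟨γ, hγ⟩
  exact h γ hγ.symm

lemma V_pow {f : LS2 E} (hf : f ≠ 0) (n : ℕ) : V1 (f ^ n) = n * V1 f ∧ V2 (f ^ n) = n * V2 f := by
  induction n with
  | zero =>
    have := V_toLS2_unit (E := E) (f := 1) (by simp)
    rw [map_one] at this
    simpa using this
  | succ n ih =>
    rw [pow_succ, V1_mul (pow_ne_zero n hf) hf, V2_mul (pow_ne_zero n hf) hf, ih.1, ih.2]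
    push_cast
    constructor <;> ring

lemma V_eval₂ {r : PS2 E} {γ : l} (h : ct E r = algebraMap l E γ) (hr : r ≠ scal l E γ)
    {P : l[X]} (hP : P ≠ 0) :
    V1 (toLS2 E (P.eval₂ (scal l E) r)) =
        P.rootMultiplicity γ * V1 (toLS2 E (r - scal l E γ)) ∧
      V2 (toLS2 E (P.eval₂ (scal l E) r)) =
        P.rootMultiplicity γ * V2 (toLS2 E (r - scal l E γ)) := by
  obtain ⟨Q, hQ, hdvd⟩ := exists_eq_pow_rootMultiplicity_mul_and_not_dvd P hP γ
  have hQ0 : ct E (Q.eval₂ (scal l E) r) ≠ 0 := by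
    rw [ct_eval₂_scal, h, aeval_algebraMap_apply_eq_algebraMap_eval, Ne,
      map_eq_zero_iff _ (algebraMap l E).injective]
    rwa [dvd_iff_isRoot] at hdvd
  have hu := V_toLS2_unit hQ0
  have hQ1 : toLS2 E (Q.eval₂ (scal l E) r) ≠ 0 := by
    intro h0
    rw [map_eq_zero_iff _ toLS2_injective] at h0
    rw [h0, map_zero] at hQ0
    exact hQ0 rfl
  have hr1 : toLS2 E (r - scal l E γ) ≠ 0 := by
    rw [Ne, map_eq_zero_iff _ toLS2_injective, sub_eq_zero]
    exact hr
  have he : P.eval₂ (scal l E) r =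
      (r - scal l E γ) ^ (P.rootMultiplicity γ) * Q.eval₂ (scal l E) r := by
    conv_lhs => rw [hQ]
    simp [eval₂_mul, eval₂_pow, eval₂_sub]
  rw [he, map_mul, map_pow, V1_mul (pow_ne_zero _ hr1) hQ1, V2_mul (pow_ne_zero _ hr1) hQ1,
    (V_pow hr1 _).1, (V_pow hr1 _).2, hu.1, hu.2]
  simp

lemma fl_of_emb [Fact ℓ.Prime] [IsAlgClosed l] {p : ℕ} [ExpChar F p] (hp : (p : ZMod ℓ) ≠ 0)
    {x y s : F} {α β : l}
    (hx : Transcendental l x) (hy : Transcendental l y) (hs : Transcendental l s)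
    (θ : F →+* Om E)
    (hθ : ∀ z, ∃ (n : ℕ) (f : LS2 E), algebraMap (LS2 E) (Om E) f = θ z ^ p ^ n)
    (hθl : ∀ c : l, θ (algebraMap l F c) = toOm E (scal l E c))
    (hθx : θ x = toOm E (PowerSeries.C PowerSeries.X + scal l E α))
    (hθy : θ y = toOm E (PowerSeries.X + scal l E β)) {r : PS2 E} (hr : toOm E r = θ s)
    (hrc : ∀ γ : l, PowerSeries.constantCoeff r ≠ PowerSeries.C (algebraMap l E γ)) :
    (∀ γ : l, ct E r = algebraMap l E γ → ∃ j, Fl ℓ l x y s α β γ j) ∧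
      ((∀ γ : l, ct E r ≠ algebraMap l E γ) → ∀ γ, Fl ℓ l x y s α β γ 0) := by
  obtain ⟨v, w, hst, H⟩ := exists_kchar_of_emb hp θ hθ
  have main : ∀ (t : F) (r : PS2 E), Transcendental l t → toOm E r = θ t → ∀ P : l[X], P ≠ 0 →
      v (cls ℓ (aeval t P)) = (V1 (toLS2 E (P.eval₂ (scal l E) r)) : ZMod ℓ) ∧
      w (cls ℓ (aeval t P)) = (V2 (toLS2 E (P.eval₂ (scal l E) r)) : ZMod ℓ) := by
    intro t r ht hr P hP
    exact H _ (Transcendental.aeval_ne_zero ht hP) _ (emb_aeval hθl hr P).symm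
  have hX : ∀ P : l[X], P ≠ 0 → v (cls ℓ (aeval x P)) = 0 ∧
      w (cls ℓ (aeval x P)) = (P.rootMultiplicity α : ℕ) := by
    intro P hP
    have h1 := main x _ hx hθx.symm P hP
    have h2 := V_eval₂ (E := E) (r := PowerSeries.C PowerSeries.X + scal l E α) (γ := α)
      (by rw [map_add, ct_scal]; simp [ct])
      (by simp [map_eq_zero_iff _ PowerSeries.C_injective, PowerSeries.X_ne_zero]) hP
    rw [add_sub_cancel_right, V_toLS2_C_X.1, V_toLS2_C_X.2] at h2
    rw [h1.1, h1.2, h2.1, h2.2]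
    simp
  have hY : ∀ P : l[X], P ≠ 0 → v (cls ℓ (aeval y P)) = (P.rootMultiplicity β : ℕ) ∧
      w (cls ℓ (aeval y P)) = 0 := by
    intro P hP
    have h1 := main y _ hy hθy.symm P hP
    have h2 := V_eval₂ (E := E) (r := PowerSeries.X + scal l E β) (γ := β)
      (by rw [map_add, ct_scal]; simp [ct])
      (by simp [PowerSeries.X_ne_zero]) hP
    rw [add_sub_cancel_right, V1_toLS2_X, V2_toLS2_X] at h2
    rw [h1.1, h1.2, h2.1, h2.2]
    simp
  constructor
  · intro γ hγ
    refine ⟨(V2 (toLS2 E (r - scal l E γ)) : ZMod ℓ), v, w, hst, fun P hP =>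
      ⟨hX P hP, hY P hP, ?_⟩⟩
    have h1 := main s _ hs hr P hP
    have hne : PowerSeries.constantCoeff (r - scal l E γ) ≠ 0 := by
      rw [map_sub, sub_ne_zero]
      simpa [scal] using hrc γ
    have h2 := V_eval₂ (E := E) hγ (by rintro rfl; simp at hne) hP
    rw [h1.1, h1.2, h2.1, h2.2, (V_toLS2_of_ne hne).1]
    push_cast
    exact ⟨by simp, by ring⟩
  · intro h γ
    refine ⟨v, w, hst, fun P hP => ⟨hX P hP, hY P hP, ?_⟩⟩
    have h1 := main s _ hs hr P hP
    have h2 := V_eval₂_of_forall_ne h hP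
    rw [h1.1, h1.2, h2.1, h2.2]
    simp

end Flags

section Descent

/-- Apply an additive map to the coefficients of a polynomial. -/
def mapCoeff {R S : Type*} [Semiring R] [Semiring S] (f : R →+ S) : R[X] →+ S[X] where
  toFun P := ∑ i ∈ P.support, monomial i (f (P.coeff i))
  map_zero' := by simp
  map_add' P Q := by
    have key : ∀ (P : R[X]) (n : ℕ),
        (∑ i ∈ P.support, monomial i (f (P.coeff i))).coeff n = f (P.coeff n) := by
      intro P n
      simp only [finsetSum_coeff, coeff_monomial, Finset.sum_ite_eq', mem_support_iff]
      split_ifs with h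
      · rfl
      · rw [notMem_support_iff.1 h, map_zero]
    ext n
    rw [coeff_add, key, key, key, coeff_add, map_add]

lemma coeff_mapCoeff {R S : Type*} [Semiring R] [Semiring S] (f : R →+ S) (P : R[X]) (n : ℕ) :
    (mapCoeff f P).coeff n = f (P.coeff n) := by
  change (∑ i ∈ P.support, monomial i (f (P.coeff i))).coeff n = _
  simp only [finsetSum_coeff, coeff_monomial, Finset.sum_ite_eq', mem_support_iff]
  split_ifs with h
  · rfl
  · rw [notMem_support_iff.1 h, map_zero]

lemma mapCoeff_monomial {R S : Type*} [Semiring R] [Semiring S] (f : R →+ S) (n : ℕ) (c : R) :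
    mapCoeff f (monomial n c) = monomial n (f c) := by
  ext m
  rw [coeff_mapCoeff, coeff_monomial, coeff_monomial]
  split_ifs <;> simp

variable {l E : Type*} [Field l] [Field E] [Algebra l E]

lemma eval_mapCoeff (φ : E →ₗ[l] l) (P : E[X]) (c : l) :
    (mapCoeff φ.toAddMonoidHom P).eval c = φ (P.eval (algebraMap l E c)) := by
  induction P using Polynomial.induction_on' with
  | add P Q hP hQ => simp [hP, hQ]
  | monomial n a =>
    rw [mapCoeff_monomial, eval_monomial, eval_monomial, ← map_pow, mul_comm a, ← Algebra.smul_def,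
      map_smul, smul_eq_mul, mul_comm]
    rfl

lemma evalEval_mapCoeff (φ : E →ₗ[l] l) (D : E[X][X]) (α β : l) :
    evalEval α β (mapCoeff (mapCoeff φ.toAddMonoidHom) D) =
      φ (evalEval (algebraMap l E α) (algebraMap l E β) D) := by
  induction D using Polynomial.induction_on' with
  | add P Q hP hQ => simp [hP, hQ]
  | monomial n a =>
    rw [mapCoeff_monomial, evalEval, evalEval, eval_monomial, eval_monomial, eval_mul, eval_mul,
      eval_mapCoeff, ← C_pow, ← C_pow, eval_C, eval_C, ← map_pow, mul_comm (eval _ a),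
      ← Algebra.smul_def, map_smul, smul_eq_mul, mul_comm]

lemma exists_coeff_coeff_ne {R : Type*} [Semiring R] {D : R[X][X]} (hD : D ≠ 0) :
    ∃ i j, (D.coeff i).coeff j ≠ 0 := by
  by_contra! h
  exact hD (Polynomial.ext fun i => Polynomial.ext fun j => by simpa using h i j)

lemma Gen.restrict {P : E → E → Prop} (h : Gen P) :
    Gen fun α β : l => P (algebraMap l E α) (algebraMap l E β) := by
  obtain ⟨D, hD, H⟩ := h
  obtain ⟨i, j, hij⟩ := exists_coeff_coeff_ne hD
  obtain ⟨φ, hφ⟩ := Module.Projective.exists_dual_ne_zero l hij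
  refine ⟨mapCoeff (mapCoeff φ.toAddMonoidHom) D, ?_, ?_⟩
  · intro h0
    apply hφ
    have := congrArg (fun Q => (Q.coeff i).coeff j) h0
    simpa [coeff_mapCoeff] using this
  · intro α β h0
    refine H _ _ fun h1 => h0 ?_
    rw [evalEval_mapCoeff, h1, map_zero]

lemma Gen.exists {k : Type*} [Field k] [Infinite k] {P : k → k → Prop} (h : Gen P) :
    ∃ α β, P α β := by
  obtain ⟨α, h⟩ := h.eventually.exists
  exact ⟨α, h.exists⟩

end Descent

section GenericFlags

variable {l A : Type*} [Field l] [Field A] [Algebra l A]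
  {E : IntermediateField l A} {x y : A}

lemma gen_ct_ne_zero [IsAlgClosed E] (hxy : Indep E x y) {z : A} (hz0 : z ≠ 0)
    (hz : IsSeparable (adjoin E {x, y}) z) :
    Gen fun α β : E => ∀ ι : A →+* Om E, IsEmb x y α β ι → ∀ r, toOm E r = ι z → ct E r ≠ 0 := by
  refine (gen_mem_ps2 hxy (Field.isSeparable_inv hz)).mono ?_
  intro α β H ι hι r hr
  obtain ⟨r', hr'⟩ := H ι hι
  rw [map_inv₀] at hr'
  refine (isUnit_ps2_iff r).1 (IsUnit.of_mul_eq_one r' (toOm_injective ?_))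
  rw [map_mul, map_one, hr, hr', mul_inv_cancel₀ ((map_ne_zero ι).2 hz0)]

lemma exists_pow_isSeparable {M : Type*} [Field M] [Algebra M A] [Algebra.IsAlgebraic M A]
    (p : ℕ) [ExpChar A p] (z : A) : ∃ n : ℕ, IsSeparable M (z ^ p ^ n) := by
  have : ExpChar M p := (algebraMap M A).expChar (algebraMap M A).injective p
  obtain ⟨n, w, hw⟩ := (isPurelyInseparable_iff_pow_mem (separableClosure M A) p).1
    (separableClosure.isPurelyInseparable M A) z
  refine ⟨n, ?_⟩
  rw [← hw]
  exact mem_separableClosure_iff.1 w.2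

variable {F : Type*} [Field F] [Algebra l F] [Algebra F A] [IsScalarTower l F A]

lemma gen_pow_mem [IsAlgClosed E] (hxy : Indep E x y) (halg : Algebra.IsAlgebraic (adjoin E {x, y}) A)
    {p : ℕ} [ExpChar F p] (hfg : ∃ s : Finset F, ∀ z : F, ∃ n : ℕ, z ^ p ^ n ∈ adjoin l (s : Set F)) :
    Gen fun α β : E => ∀ ι : A →+* Om E, IsEmb x y α β ι → ∀ z : F, ∃ (n : ℕ) (f : LS2 E),
      algebraMap (LS2 E) (Om E) f = ι (algebraMap F A z) ^ p ^ n := by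
  obtain ⟨s, hs⟩ := hfg
  have : ExpChar A p := expChar_of_injective_algebraMap (algebraMap F A).injective p
  have : ∀ z : F, ∃ n : ℕ, IsSeparable (adjoin E {x, y}) (algebraMap F A z ^ p ^ n) :=
    fun z => exists_pow_isSeparable p _
  choose m hm using this
  refine (Gen.finset s fun z _ => gen_mem_ps2 hxy (hm z)).mono ?_
  intro α β H ι hι z
  have : ExpChar (Om E) p := expChar_of_injective_ringHom ι.injective p
  have : ExpChar (LS2 E) p :=
    (algebraMap (LS2 E) (Om E)).expChar (algebraMap (LS2 E) (Om E)).injective p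
  let T : Subfield F := (perfectClosure (LS2 E) (Om E)).toSubfield.comap (ι.comp (algebraMap F A))
  have hT : ∀ z, z ∈ T ↔ ∃ n : ℕ, ι (algebraMap F A z) ^ p ^ n ∈
      (algebraMap (LS2 E) (Om E)).range := fun z => mem_perfectClosure_iff_pow_mem p
  have hscal : ∀ c : l, algebraMap l F c ∈ T := by
    intro c
    rw [hT]
    refine ⟨0, toLS2 E (scal l E c), ?_⟩
    have := hι (C (C (algebraMap l E c)))
    rw [psi_CC, aevalAeval_C, aeval_C] at this
    rw [pow_zero, pow_one, ← IsScalarTower.algebraMap_apply l F A]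
    exact this.symm
  have hgen : ∀ g ∈ s, g ∈ T := by
    intro g hg
    obtain ⟨r, hr⟩ := H g hg ι hι
    rw [hT]
    refine ⟨m g, toLS2 E r, ?_⟩
    rw [← map_pow, ← hr]
    rfl
  let T' : IntermediateField l F := { T with algebraMap_mem' := hscal }
  have hle : adjoin l (s : Set F) ≤ T' := adjoin_le_iff.2 hgen
  obtain ⟨n, hn⟩ := hs z
  have h1 : z ^ p ^ n ∈ T := hle hn
  obtain ⟨n', f, hf⟩ := (hT _).1 h1
  refine ⟨n + n', f, ?_⟩
  rw [hf, map_pow, map_pow, ← pow_mul, pow_add]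

lemma gen_fl {ℓ : ℕ} [Fact ℓ.Prime] [IsAlgClosed l] [IsAlgClosed E] {p : ℕ} [ExpChar F p]
    (hp : (p : ZMod ℓ) ≠ 0)
    (hfg : ∃ s : Finset F, ∀ z : F, ∃ n : ℕ, z ^ p ^ n ∈ adjoin l (s : Set F))
    {x y s : F} (hx : Transcendental l x) (hy : Transcendental l y) (hs : Transcendental l s)
    (hxy : Indep E (algebraMap F A x) (algebraMap F A y))
    (halg : Algebra.IsAlgebraic (adjoin E {algebraMap F A x, algebraMap F A y}) A)
    (hsep : IsSeparable (adjoin E {algebraMap F A x, algebraMap F A y}) (algebraMap F A s))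
    (hnc : Gen fun α β : E => ∀ ι : A →+* Om E,
      IsEmb (algebraMap F A x) (algebraMap F A y) α β ι → ∀ r, toOm E r = ι (algebraMap F A s) →
        ∀ γ : l, PowerSeries.constantCoeff r ≠ PowerSeries.C (algebraMap l E γ)) :
    Gen fun α β : l => ∀ ι : A →+* Om E,
      IsEmb (algebraMap F A x) (algebraMap F A y) (algebraMap l E α) (algebraMap l E β) ι →
        ∃ r, toOm E r = ι (algebraMap F A s) ∧
          (∀ γ : l, ct E r = algebraMap l E γ → ∃ j, Fl ℓ l x y s α β γ j) ∧
            ((∀ γ : l, ct E r ≠ algebraMap l E γ) → ∀ γ, Fl ℓ l x y s α β γ 0) := by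
  refine (((gen_mem_ps2 hxy hsep).and ((gen_pow_mem hxy halg hfg).and hnc)).restrict).mono ?_
  rintro α β ⟨h1, h2, h3⟩ ι hι
  obtain ⟨r, hr⟩ := h1 ι hι
  refine ⟨r, hr, ?_⟩
  refine fl_of_emb hp hx hy hs (ι.comp (algebraMap F A)) (h2 ι hι) ?_ ?_ ?_ hr (h3 ι hι r hr)
  · intro c
    have := hι (C (C (algebraMap l E c)))
    rw [psi_CC, aevalAeval_C, aeval_C] at this
    rw [RingHom.comp_apply, ← IsScalarTower.algebraMap_apply l F A]
    exact this
  · have := hι (C X)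
    rw [psi_CX, aevalAeval_C, aeval_X, map_add] at this
    exact this
  · have := hι X
    have h : aevalAeval (R := E) (algebraMap F A x) (algebraMap F A y) X = algebraMap F A y := by
      simp
    rw [psi_X, h] at this
    exact this

end GenericFlags

section NonConstant

variable {l A : Type*} [Field l] [Field A] [Algebra l A]

lemma mem_adjoin_pair_iff {x y z : A} : z ∈ adjoin l⟮x⟯ {y} ↔ z ∈ adjoin l {x, y} := by
  have := adjoin_adjoin_left l ({x} : Set A) {y}
  rw [Set.singleton_union] at this
  rw [← this]
  rfl

/-- Exchange property for algebraic dependence of three elements. -/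
lemma isAlgebraic_exchange {x y s : A} (hys : Indep l y s)
    (h : IsAlgebraic (adjoin l {x, y}) s) : IsAlgebraic (adjoin l {y, s}) x := by
  by_contra hx
  have h1 : Indep l⟮y⟯ s x := by
    refine indep_iff.2 ⟨(indep_iff.1 hys).2, fun h' => hx ?_⟩
    exact isAlgebraic_of_subset (fun z hz => mem_adjoin_pair_iff.1 hz) h'
  refine (indep_iff.1 h1.symm).2 (isAlgebraic_of_subset (fun z hz => ?_) h)
  rw [mem_adjoin_pair_iff, Set.pair_comm]
  exact hz

variable {E : IntermediateField l A} {x y : A}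

lemma gen_constantCoeff_ne [IsAlgClosed E] {s : A} (hxy : Indep E x y)
    (hys : Indep l y s) (hsep : IsSeparable (adjoin E {x, y}) s)
    (hs : IsAlgebraic (adjoin l {x, y}) s) :
    Gen fun α β : E => ∀ ι : A →+* Om E, IsEmb x y α β ι → ∀ r, toOm E r = ι s →
        ∀ γ : l, PowerSeries.constantCoeff r ≠ PowerSeries.C (algebraMap l E γ) := by
  obtain ⟨P, hP, hPx⟩ := isAlgebraic_exchange hys hs
  obtain ⟨b, hb, H, hH⟩ := exists_clear_denom _ _ (evAdjoin_denom y s) P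
  have hb' : evAdjoin y s b ≠ 0 := fun h0 => nonZeroDivisors.ne_zero hb
    (evAdjoin_injective hys (by rw [h0, map_zero]))
  have hH0 : H ≠ 0 := by
    rintro rfl
    rw [Polynomial.map_zero] at hH
    exact mul_ne_zero (C_ne_zero.2 hb') hP hH.symm
  have hHx : H.eval₂ (aevalAeval (R := l) y s).toRingHom x = 0 := by
    have h1 : (aevalAeval (R := l) y s).toRingHom =
        (algebraMap (adjoin l {y, s}) A).comp (evAdjoin y s) := rfl
    rw [h1, ← eval₂_map, hH, eval₂_mul, ← aeval_def (x := x), ← aeval_def (x := x), hPx, mul_zero]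
  set h := H.leadingCoeff with hh
  have hh0 : aevalAeval (R := l) y s h ≠ 0 := fun h0 => hH0 (leadingCoeff_eq_zero.1 (hys _ h0))
  have hsep' : IsSeparable (adjoin E {x, y}) (aevalAeval (R := l) y s h) := by
    let T : IntermediateField l A :=
      { (separableClosure (adjoin E {x, y}) A).toSubfield with
        algebraMap_mem' := fun c => (separableClosure (adjoin E {x, y}) A).algebraMap_mem
          (⟨algebraMap l A c, (adjoin E {x, y}).algebraMap_mem (algebraMap l E c)⟩) }
    have hle : adjoin l {y, s} ≤ T := by
      rw [adjoin_le_iff]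
      rintro z (rfl | rfl)
      · exact (separableClosure (adjoin E {x, z}) A).algebraMap_mem
          (⟨z, subset_adjoin _ _ (by simp)⟩ : adjoin E {x, z})
      · exact mem_separableClosure_iff.2 hsep
    exact mem_separableClosure_iff.1 (hle (aevalAeval_mem_adjoin y s h))
  refine (gen_ct_ne_zero hxy hh0 hsep').mono ?_
  intro α β hct ι hι r hr γ hγ
  let e' : l[X][X] →+* PS2 E :=
    eval₂RingHom (eval₂RingHom (scal l E) (PowerSeries.X + PowerSeries.C (PowerSeries.C β))) r
  have he' : ∀ D, toOm E (e' D) = ι (aevalAeval (R := l) y s D) := by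
    have : (toOm E).comp e' = ι.comp (aevalAeval (R := l) y s).toRingHom := by
      refine Polynomial.ringHom_ext' (Polynomial.ringHom_ext' ?_ ?_) ?_
      · ext c
        have := hι (C (C (algebraMap l E c)))
        rw [psi_CC, aevalAeval_C, aeval_C] at this
        simpa [e', scal] using this.symm
      · have := hι X
        have h' : aevalAeval (R := E) x y X = y := by simp
        rw [psi_X, h'] at this
        simpa [e'] using this.symm
      · simpa [e'] using hr
    exact fun D => congrArg (fun f => f D) this
  let e'' : l[X][X] →+* E := evalEvalRingHom (β) (algebraMap l E γ) |>.comp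
    (mapRingHom (mapRingHom (algebraMap l E)))
  have he'' : ∀ D, PowerSeries.constantCoeff (e' D) = PowerSeries.C (e'' D) := by
    have : (PowerSeries.constantCoeff).comp e' = (PowerSeries.C).comp e'' := by
      refine Polynomial.ringHom_ext' (Polynomial.ringHom_ext' ?_ ?_) ?_
      · ext c : 1; simp [e', e'', scal]
      · simp [e', e'']
      · simpa [e', e'', evalEval] using hγ
    exact fun D => congrArg (fun f => f D) this
  have hne : e'' h ≠ 0 := by
    have := hct ι hι (e' h) (he' h)
    intro h0
    apply this
    rw [ct, RingHom.comp_apply, he'', h0, map_zero, map_zero]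
  have hroot : H.eval₂ e' (PowerSeries.C (PowerSeries.X + PowerSeries.C α)) = 0 := by
    apply toOm_injective
    rw [hom_eval₂, map_zero]
    have h1 : toOm E (PowerSeries.C (PowerSeries.X + PowerSeries.C α)) = ι x := by
      have := hι (C X)
      rw [psi_CX, aevalAeval_C, aeval_X] at this
      exact this.symm
    have h2 : (toOm E).comp e' = ι.comp (aevalAeval (R := l) y s).toRingHom := RingHom.ext he'
    rw [h1, h2, ← hom_eval₂, hHx, map_zero]
  have hroot' : (H.map e'').eval₂ PowerSeries.C (PowerSeries.X + PowerSeries.C α) = 0 := by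
    have := congrArg PowerSeries.constantCoeff hroot
    rw [hom_eval₂, map_zero] at this
    rw [eval₂_map, ← this]
    have h2 : (PowerSeries.constantCoeff).comp e' = (PowerSeries.C).comp e'' := RingHom.ext he''
    rw [h2]
    simp
  have hcoe : (((H.map e'').comp (X + C α) : E[X]) : PowerSeries E) =
      (H.map e'').eval₂ PowerSeries.C (PowerSeries.X + PowerSeries.C α) := by
    rw [comp, ← Polynomial.coeToPowerSeries.ringHom_apply, hom_eval₂]
    congr 1
    · ext c : 1; simp
    · simp
  rw [hroot'] at hcoe
  have h3 : (H.map e'').comp (X + C α) = 0 := by simpa using hcoe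
  have h4 : H.map e'' = 0 := by
    have := congrArg (fun Q => Q.comp (X - C α)) h3
    simpa [comp_assoc] using this
  apply hne
  have := congrArg (fun Q => Q.coeff H.natDegree) h4
  simpa [coeff_map] using this

lemma aevalAeval_map (x y : A) (D : l[X][X]) :
    aevalAeval (R := E) x y (D.map (mapRingHom (algebraMap l E))) = aevalAeval (R := l) x y D := by
  have : (aevalAeval (R := E) x y).toRingHom.comp (mapRingHom (mapRingHom (algebraMap l E))) =
      (aevalAeval (R := l) x y).toRingHom := by
    refine Polynomial.ringHom_ext' (Polynomial.ringHom_ext' ?_ ?_) ?_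
    · ext c
      simp
    · simp
    · simp
  exact congrArg (fun f => f D) this

lemma evalEval_map (α β : l) (D : l[X][X]) :
    evalEval (algebraMap l E α) (algebraMap l E β) (D.map (mapRingHom (algebraMap l E))) =
      algebraMap l E (evalEval α β D) := by
  have : (evalEvalRingHom (algebraMap l E α) (algebraMap l E β)).comp
      (mapRingHom (mapRingHom (algebraMap l E))) =
      (algebraMap l E).comp (evalEvalRingHom α β) := by
    refine Polynomial.ringHom_ext' (Polynomial.ringHom_ext' ?_ ?_) ?_
    · ext c
      simp
    · simp
    · simp
  exact congrArg (fun f => f D) this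

lemma gen_ct_mem [IsAlgClosed l] [IsAlgClosed E] {s : A} (hxyl : Indep l x y)
    (hs' : IsAlgebraic (adjoin l {x, y}) s) :
    Gen fun α β : l => ∀ ι : A →+* Om E, IsEmb x y (algebraMap l E α) (algebraMap l E β) ι →
      ∀ r, toOm E r = ι s → ∃ γ : l, ct E r = algebraMap l E γ := by
  obtain ⟨P, hP, hPx⟩ := hs'
  obtain ⟨b, hb, H, hH⟩ := exists_clear_denom _ _ (evAdjoin_denom x y) P
  have hb' : evAdjoin x y b ≠ 0 := fun h0 => nonZeroDivisors.ne_zero hb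
    (evAdjoin_injective hxyl (by rw [h0, map_zero]))
  have hH0 : H ≠ 0 := by
    rintro rfl
    rw [Polynomial.map_zero] at hH
    exact mul_ne_zero (C_ne_zero.2 hb') hP hH.symm
  have hHx : H.eval₂ (aevalAeval (R := l) x y).toRingHom s = 0 := by
    have h1 : (aevalAeval (R := l) x y).toRingHom =
        (algebraMap (adjoin l {x, y}) A).comp (evAdjoin x y) := rfl
    rw [h1, ← eval₂_map, hH, eval₂_mul, ← aeval_def (x := s), ← aeval_def (x := s), hPx, mul_zero]
  refine (Gen.ne_zero (leadingCoeff_ne_zero.2 hH0)).mono ?_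
  intro α β hαβ ι hι r hr
  let e' : l[X][X] →+* PS2 E := (psi (algebraMap l E α) (algebraMap l E β)).comp
    (mapRingHom (mapRingHom (algebraMap l E)))
  have h2 : (toOm E).comp e' = ι.comp (aevalAeval (R := l) x y).toRingHom := by
    refine RingHom.ext fun D => ?_
    have := hι (D.map (mapRingHom (algebraMap l E)))
    rw [aevalAeval_map] at this
    exact this.symm
  have hroot : H.eval₂ e' r = 0 := by
    apply toOm_injective
    rw [hom_eval₂, map_zero, hr, h2, ← hom_eval₂, hHx, map_zero]
  have h3 : (ct E).comp e' = (algebraMap l E).comp (evalEvalRingHom α β) := by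
    refine RingHom.ext fun D => ?_
    have := ct_psi (algebraMap l E α) (algebraMap l E β) (D.map (mapRingHom (algebraMap l E)))
    rw [evalEval_map] at this
    exact this
  have h4 := congrArg (ct E) hroot
  rw [hom_eval₂, map_zero, h3, ← eval₂_map] at h4
  by_contra hcon
  have : Transcendental l (ct E r) := by
    rw [transcendental_iff_notMem_range]
    rintro ⟨γ, hγ⟩
    exact hcon ⟨γ, hγ.symm⟩
  refine this ⟨H.map (evalEvalRingHom α β), ?_, h4⟩
  intro h0
  apply hαβ
  have := congrArg (fun Q => Q.coeff H.natDegree) h0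
  simpa [coeff_map] using this

lemma exists_relation_of_mem_adjoin [IsAlgClosed l] [IsAlgClosed E] {s : A} (hxy : Indep E x y)
    (hxyl : Indep l x y) (halg : Algebra.IsAlgebraic (adjoin E {x, y}) A)
    (hs : s ∈ adjoin E {x, y}) (hs' : IsAlgebraic (adjoin l {x, y}) s) :
    ∃ N D : l[X][X], D ≠ 0 ∧ s * aevalAeval x y D = aevalAeval x y N := by
  obtain ⟨N, D, hD, hND⟩ := exists_denom hs
  have hD0 : D ≠ 0 := by
    rintro rfl
    rw [map_zero] at hD
    exact hD rfl
  have hsep : IsSeparable (adjoin E {x, y}) s :=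
    isSeparable_algebraMap (F := adjoin E {x, y}) (K := A) ⟨s, hs⟩
  obtain ⟨i, j, hij⟩ := exists_coeff_coeff_ne hD0
  obtain ⟨φ, hφ⟩ := Module.Projective.exists_dual_ne_zero l hij
  let Λ : E[X][X] →+ l[X][X] := mapCoeff (mapCoeff φ.toAddMonoidHom)
  have hΛ : Λ D ≠ 0 := by
    intro h0
    apply hφ
    have := congrArg (fun Q => (Q.coeff i).coeff j) h0
    simpa [Λ, coeff_mapCoeff] using this
  let m : l[X][X] →+* E[X][X] := mapRingHom (mapRingHom (algebraMap l E))
  have key : N * m (Λ D) - D * m (Λ N) = 0 := by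
    by_contra hne
    obtain ⟨α, β, h1, h2, h3⟩ := ((Gen.ne_zero hne).restrict (l := l)).and
      ((gen_ct_mem (E := E) hxyl hs').and (gen_mem_ps2 hxy hsep).restrict) |>.exists
    obtain ⟨ι, hι⟩ := exists_isEmb hxy halg (algebraMap l E α) (algebraMap l E β)
    obtain ⟨r, hr⟩ := h3 ι hι
    obtain ⟨γ, hγ⟩ := h2 ι hι r hr
    have h4 : r * psi (algebraMap l E α) (algebraMap l E β) D =
        psi (algebraMap l E α) (algebraMap l E β) N := by
      apply toOm_injective
      rw [map_mul, hr, ← hι, ← hι, ← map_mul, hND]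
    have h5 := congrArg (ct E) h4
    rw [map_mul, ct_psi, ct_psi, hγ] at h5
    apply h1
    have e1 : evalEval (algebraMap l E α) (algebraMap l E β) (m (Λ D)) =
      algebraMap l E (φ (evalEval (algebraMap l E α) (algebraMap l E β) D)) := by
      rw [← evalEval_mapCoeff]; exact evalEval_map _ _ _
    have e2 : evalEval (algebraMap l E α) (algebraMap l E β) (m (Λ N)) =
      algebraMap l E (φ (evalEval (algebraMap l E α) (algebraMap l E β) N)) := by
      rw [← evalEval_mapCoeff]; exact evalEval_map _ _ _
    rw [evalEval_sub, evalEval_mul, evalEval_mul, e1, e2, ← h5, ← Algebra.smul_def, map_smul,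
      smul_eq_mul, map_mul, Algebra.smul_def]
    ring
  refine ⟨Λ N, Λ D, hΛ, ?_⟩
  have h1 := congrArg (aevalAeval (R := E) x y) (sub_eq_zero.1 key)
  have e : ∀ Q, aevalAeval (R := E) x y (m Q) = aevalAeval (R := l) x y Q := aevalAeval_map x y
  rw [map_mul, map_mul, e, e, ← hND] at h1
  refine mul_left_cancel₀ hD ?_
  rw [← h1]
  ring

end NonConstant

section Dichotomy

lemma aevalAeval_algebraMap {l F A : Type*} [Field l] [Field F] [Field A] [Algebra l F]
    [Algebra l A] [Algebra F A] [IsScalarTower l F A] (x y : F) (D : l[X][X]) :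
    aevalAeval (algebraMap F A x) (algebraMap F A y) D = algebraMap F A (aevalAeval x y D) := by
  have : (aevalAeval (R := l) (algebraMap F A x) (algebraMap F A y)) =
      ((IsScalarTower.toAlgHom l F A).comp (aevalAeval x y)) := by
    apply AlgHom.coe_ringHom_injective
    refine Polynomial.ringHom_ext' (Polynomial.ringHom_ext' ?_ ?_) ?_
    · ext c
      simp [← IsScalarTower.algebraMap_apply]
    · simp
    · simp
  exact congrArg (fun f => f D) this

lemma indep_algebraMap_iff {l F A : Type*} [Field l] [Field F] [Field A] [Algebra l F]
    [Algebra l A] [Algebra F A] [IsScalarTower l F A] {x y : F} :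
    Indep l (algebraMap F A x) (algebraMap F A y) ↔ Indep l x y := by
  refine forall_congr' fun D => ?_
  rw [aevalAeval_algebraMap, map_eq_zero_iff _ (algebraMap F A).injective]

variable {ℓ : ℕ} [Fact ℓ.Prime] {l F : Type*} [Field l] [IsAlgClosed l] [Field F] [Algebra l F]
  {p : ℕ} [ExpChar F p]

open scoped IntermediateField.algebraAdjoinAdjoin in
/-- For generic `(α, β)` there are either two flags over `(α, β)` on which `s` takes different
values, or `s` is, up to a Frobenius twist, a rational function of `x` and `y`. -/
lemma flag_dichotomy (hp : (p : ZMod ℓ) ≠ 0)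
    (hfg : ∃ s : Finset F, ∀ z : F, ∃ n : ℕ, z ^ p ^ n ∈ adjoin l (s : Set F))
    {x y s : F} (hxy : Indep l x y) (hys : Indep l y s) (B : Finset l) :
    (Gen fun α β : l => ∃ γ₁ γ₂ j₁ j₂, γ₁ ≠ γ₂ ∧ γ₁ ∉ B ∧ γ₂ ∉ B ∧ Fl ℓ l x y s α β γ₁ j₁ ∧
      Fl ℓ l x y s α β γ₂ j₂) ∨
    ∃ (n : ℕ) (N D : l[X][X]), D ≠ 0 ∧ s ^ p ^ n * aevalAeval x y D = aevalAeval x y N ∧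
      Gen fun α β : l => ∃ γ j, Fl ℓ l x y s α β γ j ∧ evalEval α β D ≠ 0 ∧
        γ ^ p ^ n * evalEval α β D = evalEval α β N := by
  let A := AlgebraicClosure F
  have hexp : ExpChar l p := (algebraMap l F).expChar (algebraMap l F).injective p
  have hexpA : ExpChar A p := expChar_of_injective_algebraMap (algebraMap F A).injective p
  set X := algebraMap F A x with hX
  set Y := algebraMap F A y with hY
  have hxyA : Indep l X Y := indep_algebraMap_iff.2 hxy
  have hysA : Indep l Y (algebraMap F A s) := indep_algebraMap_iff.2 hys
  have hinsert : AlgebraicIndepOn l id ({X, Y} : Set A) := by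
    refine AlgebraicIndependent.to_subtype_range' (indep_iff_algebraicIndependent.1 hxyA) ?_
    simp [Set.pair_comm]
  by_cases hdep : IsAlgebraic (adjoin l {X, Y}) (algebraMap F A s)
  · obtain ⟨E, hE, hEi, hEa, -⟩ := exists_big_field hinsert (by simp) (by simp) hxyA.ne
    obtain ⟨n, hsep⟩ := exists_pow_isSeparable (M := adjoin E {X, Y}) p (algebraMap F A s)
    set S := s ^ p ^ n with hS
    have hSA : algebraMap F A S = algebraMap F A s ^ p ^ n := map_pow _ _ _
    rw [← hSA] at hsep
    have hpn : 0 < p ^ n := pow_pos (expChar_pos F p) n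
    have hyS : Indep l Y (algebraMap F A S) :=
      indep_iff.2 ⟨hysA.left, fun h => (indep_iff.1 hysA).2 ((hSA ▸ h).of_pow hpn)⟩
    have hSt : Transcendental l S := hys.right.pow hpn
    have hSalg : IsAlgebraic (adjoin l {X, Y}) (algebraMap F A S) := by
      rw [hSA]; exact hdep.pow _
    have hnc := gen_constantCoeff_ne hEi hyS hsep hSalg
    have hfl := gen_fl (ℓ := ℓ) hp hfg hxy.left hxy.right hSt hEi hEa hsep hnc
    have hback : ∀ {α β γ : l} {j}, Fl ℓ l x y S α β γ j → ∃ γ' j', γ' ^ p ^ n = γ ∧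
        Fl ℓ l x y s α β γ' j' := by
      intro α β γ j h
      obtain ⟨γ', hγ'⟩ := IsAlgClosed.exists_pow_nat_eq γ hpn
      rw [← hγ'] at h
      exact ⟨γ', _, hγ', h.of_pow hp n hys.right⟩
    by_cases hmem : algebraMap F A S ∈ adjoin E {X, Y}
    · right
      obtain ⟨N, D, hD, hND⟩ := exists_relation_of_mem_adjoin hEi hxyA hEa hmem hSalg
      refine ⟨n, N, D, hD, ?_, ?_⟩
      · apply (algebraMap F A).injective
        rw [map_mul, ← aevalAeval_algebraMap, ← aevalAeval_algebraMap, ← hND]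
      · refine (hfl.and ((Gen.ne_zero hD).and (gen_ct_mem (E := E) hxyA hSalg))).mono ?_
        rintro α β ⟨h1, h2, h3⟩
        obtain ⟨ι, hι⟩ := exists_isEmb hEi hEa (algebraMap l E α) (algebraMap l E β)
        obtain ⟨r, hr, h4, -⟩ := h1 ι hι
        obtain ⟨γ, hγ⟩ := h3 ι hι r hr
        obtain ⟨j, hj⟩ := h4 γ hγ
        obtain ⟨γ', j', hγ', hj'⟩ := hback hj
        refine ⟨γ', j', hj', h2, ?_⟩
        rw [hγ']
        apply (algebraMap l E).injective
        rw [map_mul, ← evalEval_map, ← evalEval_map, ← hγ, ← ct_psi, ← ct_psi, ← map_mul]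
        congr 1
        apply toOm_injective
        rw [map_mul, hr, ← hι, ← hι, aevalAeval_map, aevalAeval_map, ← map_mul, hND]
    · left
      obtain ⟨σ, hσ⟩ : ∃ σ : A ≃ₐ[adjoin E {X, Y}] A, σ (algebraMap F A S) ≠ algebraMap F A S := by
        have hnot : algebraMap F A S ∉ (⊥ : Subalgebra (adjoin E {X, Y}) A) := by
          rintro ⟨w, hw⟩
          exact hmem (hw ▸ w.2)
        have : Normal (adjoin E {X, Y}) A := normal_iff.2 fun z =>
          ⟨(Algebra.IsAlgebraic.isAlgebraic z).isIntegral, IsAlgClosed.splits _⟩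
        obtain ⟨z, hz, hconj⟩ := (notMem_iff_exists_ne_and_isConjRoot hsep
          (IsAlgClosed.splits _)).1 hnot
        obtain ⟨σ, rfl⟩ := hconj.symm.exists_algEquiv
        exact ⟨σ, hz.symm⟩
      have hne : Gen fun α β : E => ∀ ι : A →+* Om E, IsEmb X Y α β ι → ∀ r, toOm E r =
          ι (σ (algebraMap F A S) - algebraMap F A S) → ct E r ≠ 0 :=
        gen_ct_ne_zero hEi (sub_ne_zero.2 hσ) (Field.isSeparable_sub
          (by rw [IsSeparable, minpoly.algEquiv_eq]; exact hsep) hsep)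
      have hneB : Gen fun α β : E => ∀ b ∈ B, ∀ ι : A →+* Om E, IsEmb X Y α β ι → ∀ r,
          toOm E r = ι (algebraMap F A S - algebraMap l A b ^ p ^ n) → ct E r ≠ 0 := by
        refine Gen.finset B fun b _ => gen_ct_ne_zero hEi (sub_ne_zero.2 fun h => ?_)
          (Field.isSeparable_sub hsep ?_)
        · rw [← map_pow] at h
          exact hSt ((isAlgebraic_algebraMap_iff (algebraMap F A).injective).1
            (h ▸ isAlgebraic_algebraMap _))
        · have := isSeparable_algebraMap (F := adjoin E {X, Y}) (K := A)
            (algebraMap E (adjoin E {X, Y}) (algebraMap l E (b ^ p ^ n)))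
          rwa [← IsScalarTower.algebraMap_apply E, ← IsScalarTower.algebraMap_apply l E,
            map_pow] at this
      refine (hfl.and (hne.restrict.and hneB.restrict)).mono ?_
      rintro α β ⟨h1, h2, hB⟩
      obtain ⟨ι, hι⟩ := exists_isEmb hEi hEa (algebraMap l E α) (algebraMap l E β)
      have hι' : IsEmb X Y (algebraMap l E α) (algebraMap l E β) (ι.comp (σ : A →+* A)) := by
        intro D
        rw [← hι]
        have := σ.commutes (evAdjoin X Y D)
        exact congrArg ι this
      obtain ⟨r₁, hr₁, h3, h4⟩ := h1 ι hι
      obtain ⟨r₂, hr₂, h5, h6⟩ := h1 _ hι'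
      have hct : ct E r₂ - ct E r₁ ≠ 0 := by
        rw [← map_sub]
        refine h2 ι hι _ ?_
        rw [map_sub, hr₁, hr₂, map_sub]
        rfl
      have hBι : ∀ ι : A →+* Om E, IsEmb X Y (algebraMap l E α) (algebraMap l E β) ι → ∀ r,
          toOm E r = ι (algebraMap F A S) → ∀ b ∈ B, ct E r ≠ algebraMap l E (b ^ p ^ n) := by
        intro ι hι r hr b hb h
        refine hB b hb ι hι (r - PowerSeries.C (PowerSeries.C (algebraMap l E (b ^ p ^ n)))) ?_ ?_
        · have := hι (C (C (algebraMap l E (b ^ p ^ n))))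
          rw [psi_CC, aevalAeval_C, aeval_C] at this
          rw [map_sub, hr, map_sub, ← map_pow, IsScalarTower.algebraMap_apply l E A]
          exact congrArg _ this.symm
        · rw [map_sub, h, sub_eq_zero]
          simp [ct]
      have hall : (∀ γ, Fl ℓ l x y S α β γ 0) → ∃ γ₁ γ₂ j₁ j₂, γ₁ ≠ γ₂ ∧ γ₁ ∉ B ∧ γ₂ ∉ B ∧
          Fl ℓ l x y s α β γ₁ j₁ ∧ Fl ℓ l x y s α β γ₂ j₂ := by
        classical
        intro h
        obtain ⟨g₁, hg₁⟩ := (B.image (· ^ p ^ n)).exists_notMem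
        obtain ⟨g₂, hg₂⟩ := (insert g₁ (B.image (· ^ p ^ n))).exists_notMem
        rw [Finset.mem_insert, not_or] at hg₂
        obtain ⟨γ₁, j₁, e1, h1⟩ := hback (h g₁)
        obtain ⟨γ₂, j₂, e2, h2⟩ := hback (h g₂)
        refine ⟨γ₁, γ₂, j₁, j₂, ?_, fun hm => hg₁ (e1 ▸ Finset.mem_image_of_mem _ hm),
          fun hm => hg₂.2 (e2 ▸ Finset.mem_image_of_mem _ hm), h1, h2⟩
        rintro rfl
        exact hg₂.1 (e2.symm.trans e1)
      by_cases c1 : ∃ γ : l, ct E r₁ = algebraMap l E γ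
      · by_cases c2 : ∃ γ : l, ct E r₂ = algebraMap l E γ
        · obtain ⟨γ₁, e1⟩ := c1
          obtain ⟨γ₂, e2⟩ := c2
          obtain ⟨j₁, g1⟩ := h3 γ₁ e1
          obtain ⟨j₂, g2⟩ := h5 γ₂ e2
          obtain ⟨γ₁', j₁', f1, g1⟩ := hback g1
          obtain ⟨γ₂', j₂', f2, g2⟩ := hback g2
          refine ⟨γ₁', γ₂', j₁', j₂', ?_, fun hm => hBι ι hι r₁ hr₁ _ hm (f1 ▸ e1),
            fun hm => hBι _ hι' r₂ hr₂ _ hm (f2 ▸ e2), g1, g2⟩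
          rintro rfl
          apply hct
          rw [e1, e2, ← f1, ← f2, sub_self]
        · exact hall (h6 fun γ hγ => c2 ⟨γ, hγ⟩)
      · exact hall (h4 fun γ hγ => c1 ⟨γ, hγ⟩)
  · have hsXY : algebraMap F A s ∉ ({X, Y} : Set A) := fun h =>
      hdep (isAlgebraic_algebraMap (⟨_, subset_adjoin l {X, Y} h⟩ : adjoin l {X, Y}))
    left
    have hZ : AlgebraicIndepOn l id ({algebraMap F A s, X, Y} : Set A) := by
      refine hinsert.insert ?_
      rw [Set.image_id]
      exact fun h => hdep ((IsFractionRing.isAlgebraic_iff _ _ _).1 h)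
    obtain ⟨E, hE, hEi, hEa, hsE⟩ := exists_big_field hZ (x := X) (y := Y) (by simp) (by simp)
      hxyA.ne
    have hsE : algebraMap F A s ∈ E := by
      exact hsE ⟨Set.mem_insert _ _, hsXY⟩
    have hsc : ∀ γ : l, (⟨algebraMap F A s, hsE⟩ : E) ≠ algebraMap l E γ := by
      intro γ hγ
      refine hys.right ((isAlgebraic_algebraMap_iff (algebraMap F A).injective).1 ?_)
      have := congrArg (algebraMap E A) hγ
      rw [← IsScalarTower.algebraMap_apply] at this
      exact (show algebraMap F A s = algebraMap l A γ from this) ▸ isAlgebraic_algebraMap γ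
    have hr : ∀ α β : E, ∀ ι : A →+* Om E, IsEmb X Y α β ι →
        ι (algebraMap F A s) = toOm E (PowerSeries.C (PowerSeries.C ⟨algebraMap F A s, hsE⟩)) := by
      intro α β ι hι
      have := hι (C (C ⟨algebraMap F A s, hsE⟩))
      rw [psi_CC, aevalAeval_C, aeval_C] at this
      exact this
    have hsep : IsSeparable (adjoin E {X, Y}) (algebraMap F A s) :=
      isSeparable_algebraMap (F := adjoin E {X, Y}) (K := A)
        ⟨algebraMap F A s, (adjoin E {X, Y}).algebraMap_mem ⟨algebraMap F A s, hsE⟩⟩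
    refine (gen_fl (ℓ := ℓ) hp hfg hxy.left hxy.right hys.right hEi hEa hsep
      (Gen.of_forall fun α β ι hι r h γ hγ => ?_)).mono ?_
    · rw [hr α β ι hι] at h
      rw [toOm_injective h, PowerSeries.constantCoeff_C] at hγ
      exact hsc γ (PowerSeries.C_injective hγ)
    · intro α β H
      obtain ⟨ι, hι⟩ := exists_isEmb hEi hEa (algebraMap l E α) (algebraMap l E β)
      obtain ⟨r, h, -, h2⟩ := H ι hι
      rw [hr _ _ ι hι] at h
      have h3 := h2 (fun γ hγ => hsc γ (by rw [← hγ, toOm_injective h]; simp [ct]))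
      classical
      obtain ⟨g₁, hg₁⟩ := B.exists_notMem
      obtain ⟨g₂, hg₂⟩ := (insert g₁ B).exists_notMem
      rw [Finset.mem_insert, not_or] at hg₂
      exact ⟨g₁, g₂, 0, 0, Ne.symm hg₂.1, hg₁, hg₂.2, h3 g₁, h3 g₂⟩

end Dichotomy

section Regular

variable {k B A : Type*} [Field k] [Field B] [Field A] [Algebra k B] [Algebra B A] [Algebra k A]
  [IsScalarTower k B A] [IsAlgClosed k]

lemma mem_adjoin_of_isAlgebraic {u z : A} (hu : Transcendental B u) (hz : z ∈ B⟮u⟯)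
    (hzk : IsAlgebraic k⟮u⟯ z) : z ∈ k⟮u⟯ := by
  have huk : Transcendental k u := fun h => hu (h.tower_top B)
  obtain ⟨N, D, hD, hND⟩ := mem_adjoin_iff_exists_poly.1 hz
  obtain ⟨P, hP0, hP⟩ : ∃ P : k[X][X], P ≠ 0 ∧ aevalAeval u z P = 0 := by
    by_contra! h
    exact (indep_iff.1 (fun P hP => by_contra fun h0 => h P h0 hP : Indep k u z)).2 hzk
  have hD0 : D ≠ 0 := by rintro rfl; simp at hD
  set d := P.natDegree
  let G : B[X] := ∑ i ∈ Finset.range (d + 1),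
    (P.coeff i).map (algebraMap k B) * N ^ i * D ^ (d - i)
  have hG : G = 0 := by
    refine Transcendental.aeval_injective hu ?_
    rw [map_zero]
    calc aeval u G = aeval u D ^ d * aevalAeval u z P := by
          rw [aevalAeval_eq_eval₂, eval₂_eq_sum_range, Finset.mul_sum, map_sum]
          refine Finset.sum_congr rfl fun i hi => ?_
          have hi' : i ≤ d := Nat.lt_succ_iff.1 (Finset.mem_range.1 hi)
          rw [map_mul, map_mul, map_pow, map_pow, ← hND, aeval_map_algebraMap, mul_pow,
            ← Nat.sub_add_cancel hi', pow_add, Nat.sub_add_cancel hi']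
          change _ = _ * (aeval u (P.coeff i) * z ^ i)
          ring
      _ = 0 := by rw [hP, mul_zero]
  obtain ⟨i, hi⟩ : ∃ i, D.coeff i ≠ 0 := by
    by_contra! h
    exact hD0 (Polynomial.ext (by simpa using h))
  obtain ⟨φ, hφ⟩ := Module.Projective.exists_dual_ne_zero k hi
  set D' := mapCoeff φ.toAddMonoidHom D with hD'
  set N' := mapCoeff φ.toAddMonoidHom N with hN'
  have hD'0 : D' ≠ 0 := by
    intro h
    apply hφ
    have := congrArg (fun Q => Q.coeff i) h
    simpa [hD', coeff_mapCoeff] using this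
  obtain ⟨j, hj⟩ : ∃ j, P.coeff j ≠ 0 := by
    by_contra! h
    exact hP0 (Polynomial.ext (by simpa using h))
  have key : N * D'.map (algebraMap k B) - N'.map (algebraMap k B) * D = 0 := by
    have hev : ∀ α : k, (P.coeff j).eval α ≠ 0 → D.eval (algebraMap k B α) ≠ 0 →
        (N * D'.map (algebraMap k B) - N'.map (algebraMap k B) * D).eval (algebraMap k B α) = 0 := by
      intro α h1 h2
      obtain ⟨κ, hκ⟩ : ∃ κ : k, N.eval (algebraMap k B α) =
          algebraMap k B κ * D.eval (algebraMap k B α) := by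
        have h3 : IsAlgebraic k (N.eval (algebraMap k B α) / D.eval (algebraMap k B α)) := by
          refine ⟨P.map (evalRingHom α), fun h0 => h1 ?_, ?_⟩
          · have := congrArg (fun Q => Q.coeff j) h0
            simpa using this
          · have h4 := congrArg (fun Q => Q.eval (algebraMap k B α)) hG
            simp only [G, eval_finsetSum, eval_mul, eval_pow, eval_zero] at h4
            have h5 : aeval (N.eval (algebraMap k B α) / D.eval (algebraMap k B α))
                (P.map (evalRingHom α)) * D.eval (algebraMap k B α) ^ d = 0 := by
              rw [← h4, aeval_def, eval₂_map, eval₂_eq_sum_range, Finset.sum_mul]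
              refine Finset.sum_congr rfl fun i hi => ?_
              have hi' : i ≤ d := Nat.lt_succ_iff.1 (Finset.mem_range.1 hi)
              rw [eval_map_algebraMap, aeval_algebraMap_apply]
              have h6 : D.eval (algebraMap k B α) ^ d =
                D.eval (algebraMap k B α) ^ i * D.eval (algebraMap k B α) ^ (d - i) := by
                rw [← pow_add, Nat.add_sub_cancel' hi']
              rw [h6, div_pow]
              field_simp
              simp [mul_comm]
            exact (mul_eq_zero.1 h5).resolve_right (pow_ne_zero _ h2)
        by_contra! hκ
        refine (transcendental_iff_notMem_range (k := k)).2 ?_ h3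
        rintro ⟨κ, h4⟩
        exact hκ κ (by rw [h4]; field_simp)
      rw [eval_sub, eval_mul, eval_mul, eval_map_algebraMap, eval_map_algebraMap,
        aeval_algebraMap_apply_eq_algebraMap_eval, aeval_algebraMap_apply_eq_algebraMap_eval,
        hD', hN', eval_mapCoeff, eval_mapCoeff, hκ, ← Algebra.smul_def κ, map_smul, smul_eq_mul,
        map_mul, Algebra.smul_def]
      ring
    by_contra hne
    have hW : P.coeff j ≠ 0 := hj
    have hprod : ((P.coeff j).map (algebraMap k B)) * D *
        (N * D'.map (algebraMap k B) - N'.map (algebraMap k B) * D) ≠ 0 :=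
      mul_ne_zero (mul_ne_zero ((Polynomial.map_ne_zero_iff (algebraMap k B).injective).2 hj) hD0)
        hne
    apply hprod
    refine Polynomial.eq_zero_of_infinite_isRoot _ (Set.Infinite.mono (s := Set.range
      (algebraMap k B)) ?_ (Set.infinite_range_of_injective (algebraMap k B).injective))
    rintro _ ⟨α, rfl⟩
    rw [Set.mem_ofPred_eq, IsRoot, eval_mul, eval_mul, eval_map_algebraMap, aeval_algebraMap_apply]
    by_cases h1 : (P.coeff j).eval α = 0
    · simp [h1]
    by_cases h2 : D.eval (algebraMap k B α) = 0
    · simp [h2]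
    · rw [hev α h1 h2, mul_zero]
  refine mem_adjoin_iff_exists_poly.2 ⟨N', D', Transcendental.aeval_ne_zero huk hD'0, ?_⟩
  have := congrArg (aeval u) (sub_eq_zero.1 key)
  rw [map_mul, map_mul, aeval_map_algebraMap, aeval_map_algebraMap, ← hND] at this
  exact mul_right_cancel₀ hD (by rw [← this]; ring)

end Regular

section Pencil

lemma finite_adjoin_simple {M A : Type*} [Field M] [Field A] [Algebra M A] [PerfectField M]
    [Algebra.IsAlgebraic M A] (S : Finset A) :
    (Set.image (fun z : A => M⟮z⟯) (adjoin M (S : Set A))).Finite := by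
  have : FiniteDimensional M (adjoin M (S : Set A)) :=
    finiteDimensional_adjoin fun z _ => (Algebra.IsAlgebraic.isAlgebraic z).isIntegral
  have : Finite (IntermediateField M (adjoin M (S : Set A))) :=
    Field.finite_intermediateField_of_exists_primitive_element _ _
      (Field.exists_primitive_element M _)
  refine (Set.finite_range fun E : IntermediateField M (adjoin M (S : Set A)) => lift E).subset ?_
  rintro _ ⟨z, hz, rfl⟩
  exact ⟨M⟮(⟨z, hz⟩ : adjoin M (S : Set A))⟯, lift_adjoin_simple _ _ _⟩

lemma mem_adjoin_perfectField {M A : Type*} [Field M] [Field A] [Algebra M A] [PerfectField M]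
    [Algebra.IsAlgebraic M A] {p : ℕ} [ExpChar A p] (S : Set A) {z : A} {n : ℕ}
    (h : z ^ p ^ n ∈ adjoin M S) : z ∈ adjoin M S := by
  have : PerfectField (adjoin M S) := Algebra.IsAlgebraic.perfectField (K := M)
  have : ExpChar (adjoin M S) p := (algebraMap (adjoin M S) A).expChar
    (algebraMap (adjoin M S) A).injective p
  obtain ⟨w, hw⟩ := (bijective_iterateFrobenius (adjoin M S) p n).2 ⟨_, h⟩
  have hw' : (w : A) ^ p ^ n = z ^ p ^ n := by
    have := congrArg Subtype.val hw
    simpa [iterateFrobenius_def] using this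
  have : (w : A) = z := by
    refine (iterateFrobenius_inj A p n) ?_
    simpa [iterateFrobenius_def] using hw'
  exact this ▸ w.2

variable {k F : Type*} [Field k] [IsAlgClosed k] [Field F] [Algebra k F] {p : ℕ} [ExpChar F p]

omit [IsAlgClosed k] in
lemma Indep.add_mul {A : Type*} [Field A] [Algebra k A] {t z a b : A} (h : Indep k t z)
    (ha : a ∈ k⟮t⟯) (hb : b ∈ k⟮t⟯) (hb0 : b ≠ 0) : Indep k t (a + b * z) := by
  refine indep_iff.2 ⟨h.left, fun h' => (indep_iff.1 h).2 ?_⟩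
  rw [← mem_algebraicClosure_iff] at h' ⊢
  have h1 : a ∈ algebraicClosure k⟮t⟯ A := (algebraicClosure k⟮t⟯ A).algebraMap_mem ⟨a, ha⟩
  have h2 : b ∈ algebraicClosure k⟮t⟯ A := (algebraicClosure k⟮t⟯ A).algebraMap_mem ⟨b, hb⟩
  have h3 : z = (a + b * z - a) / b := by field_simp; ring
  rw [h3]
  exact div_mem (sub_mem h' h1) h2

omit [IsAlgClosed k] in
lemma Indep.add_smul {A : Type*} [Field A] [Algebra k A] {t z : A} (h : Indep k t z)
    {c : k} : Indep k t (z + algebraMap k A c * t) := by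
  have := h.add_mul (a := algebraMap k A c * t) (b := 1) (mul_mem (_root_.algebraMap_mem _ c)
    (mem_adjoin_simple_self k t)) (one_mem _) one_ne_zero
  rwa [one_mul, add_comm] at this

omit [IsAlgClosed k] in
lemma Indep.linear {A : Type*} [Field A] [Algebra k A] {x y : A} (h : Indep k x y) {c c' : k}
    (hc : c ≠ c') : Indep k (x + algebraMap k A c * y) (x + algebraMap k A c' * y) := by
  have h1 : Indep k (x + algebraMap k A c * y) y := h.symm.add_smul.symm
  have h2 := h1.add_mul (a := x + algebraMap k A c * y) (b := algebraMap k A (c' - c))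
    (mem_adjoin_simple_self k _) (_root_.algebraMap_mem _ _)
    ((_root_.map_ne_zero _).2 (sub_ne_zero.2 hc.symm))
  convert h2 using 1
  rw [map_sub]
  ring

omit [IsAlgClosed k] in
lemma isAlgebraic_adjoin_algebraMap_iff {A : Type*} [Field A] [Algebra k A] [Algebra F A]
    [IsScalarTower k F A] {t z : F} (ht : Transcendental k t) :
    IsAlgebraic k⟮algebraMap F A t⟯ (algebraMap F A z) ↔ IsAlgebraic k⟮t⟯ z := by
  have ht' : Transcendental k (algebraMap F A t) :=
    (transcendental_algebraMap_iff (algebraMap F A).injective).2 ht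
  have h := indep_algebraMap_iff (l := k) (A := A) (x := t) (y := z)
  rw [indep_iff, indep_iff] at h
  tauto

omit [IsAlgClosed k] in
lemma mem_adjoin_algebraMap_iff {A : Type*} [Field A] [Algebra k A] [Algebra F A]
    [IsScalarTower k F A] {t z : F} :
    algebraMap F A z ∈ k⟮algebraMap F A t⟯ ↔ z ∈ k⟮t⟯ := by
  simp only [mem_adjoin_iff_exists_poly, aeval_algebraMap_apply, ← map_mul, ne_eq,
    map_eq_zero_iff _ (algebraMap F A).injective, (algebraMap F A).injective.eq_iff]

/-- A Bertini theorem for pencils. -/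
lemma pGen_pencil
    (hfg : ∃ s : Finset F, ∀ z : F, ∃ n : ℕ, z ^ p ^ n ∈ adjoin k (s : Set F))
    {x y : F} (hxy : Indep k x y) :
    ∀ᶠ c : k in Filter.cofinite, PGen p k (x + algebraMap k F c * y) := by
  let A := AlgebraicClosure F
  have hexpA : ExpChar A p := expChar_of_injective_algebraMap (algebraMap F A).injective p
  set X := algebraMap F A x with hX
  set Y := algebraMap F A y with hY
  have hxyA : Indep k X Y := indep_algebraMap_iff.2 hxy
  have hZ : AlgebraicIndepOn k id ({X, Y} : Set A) := by
    refine AlgebraicIndependent.to_subtype_range' (indep_iff_algebraicIndependent.1 hxyA) ?_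
    simp [Set.pair_comm]
  obtain ⟨E, hE, hEi, hEa, -⟩ := exists_big_field hZ (by simp) (by simp) hxyA.ne
  obtain ⟨S, hS⟩ := hfg
  classical
  let Mi := perfectClosure (adjoin E {X, Y}) A
  have hexpM : ExpChar (adjoin E {X, Y}) p := (algebraMap (adjoin E {X, Y}) A).expChar
    (algebraMap (adjoin E {X, Y}) A).injective p
  have : Algebra.IsAlgebraic Mi A := Algebra.IsAlgebraic.tower_top (K := adjoin E {X, Y}) Mi
  have hF : ∀ z : F, algebraMap F A z ∈ adjoin Mi ((S.image (algebraMap F A) : Finset A) : Set A) := by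
    intro z
    obtain ⟨n, hn⟩ := hS z
    refine mem_adjoin_perfectField (p := p) (n := n) _ ?_
    have h1 : (adjoin k (S : Set F)).toSubfield ≤ (adjoin Mi ((S.image (algebraMap F A) :
        Finset A) : Set A)).toSubfield.comap (algebraMap F A) := by
      rw [adjoin_toSubfield, Subfield.closure_le, Set.union_subset_iff]
      constructor
      · rintro _ ⟨e, rfl⟩
        have h2 := (adjoin Mi ((S.image (algebraMap F A) : Finset A) : Set A)).algebraMap_mem
          (algebraMap (adjoin E {X, Y}) Mi (algebraMap E _ (algebraMap k E e)))
        have h3 : algebraMap F A (algebraMap k F e) = algebraMap E A (algebraMap k E e) := by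
          rw [← IsScalarTower.algebraMap_apply, ← IsScalarTower.algebraMap_apply]
        rw [SetLike.mem_coe, Subfield.mem_comap, h3]
        exact h2
      · intro w hw
        exact subset_adjoin Mi _ (Finset.mem_coe.2 (Finset.mem_image_of_mem _ hw))
    rw [← map_pow]
    exact h1 hn
  rw [Filter.eventually_cofinite]
  by_contra hinf
  have hch : ∀ c : k, ∃ z : F, ¬ PGen p k (x + algebraMap k F c * y) →
      IsAlgebraic k⟮x + algebraMap k F c * y⟯ z ∧
        ∀ n, z ^ p ^ n ∉ k⟮x + algebraMap k F c * y⟯ := by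
    intro c
    by_cases hc : PGen p k (x + algebraMap k F c * y)
    · exact ⟨0, fun h => (h hc).elim⟩
    · have : Transcendental k (x + algebraMap k F c * y) := (hxy.linear
        (show c ≠ c + 1 by simp)).left
      rw [PGen] at hc
      push Not at hc
      obtain ⟨z, h1, h2⟩ := hc this
      exact ⟨z, fun _ => ⟨h1, h2⟩⟩
  choose z hz using hch
  obtain ⟨c, hc, c', hc', hne, heq⟩ := Set.Infinite.exists_ne_map_eq_of_mapsTo hinf
    (f := fun c => Mi⟮algebraMap F A (z c)⟯) (t := (Set.image (fun z : A => Mi⟮z⟯)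
      (adjoin Mi ((S.image (algebraMap F A) : Finset A) : Set A))))
    (fun c _ => Set.mem_image_of_mem _ (hF _)) (finite_adjoin_simple _)
  have hind := hxyA.linear hne
  have hindE := hEi.linear (show algebraMap k E c ≠ algebraMap k E c' by simpa using hne)
  rw [← IsScalarTower.algebraMap_apply, ← IsScalarTower.algebraMap_apply] at hindE
  set u := X + algebraMap k A c * Y with hu
  set u' := X + algebraMap k A c' * Y with hu'
  have emb : ∀ c : k, algebraMap F A (x + algebraMap k F c * y) = X + algebraMap k A c * Y := by
    intro c
    rw [map_add, map_mul, ← IsScalarTower.algebraMap_apply]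
  have hcc : (algebraMap k A c - algebraMap k A c') ≠ 0 := by
    rw [← map_sub]; exact (_root_.map_ne_zero _).2 (sub_ne_zero.2 hne)
  have halg : ∀ c, ¬ PGen p k (x + algebraMap k F c * y) →
      IsAlgebraic k⟮X + algebraMap k A c * Y⟯ (algebraMap F A (z c)) := by
    intro c hc
    rw [← emb, isAlgebraic_adjoin_algebraMap_iff (hxy.linear (show c ≠ c + 1 by simp)).left]
    exact (hz c hc).1
  let B : IntermediateField k A := (algebraicClosure E⟮u⟯ A).toSubfield.toIntermediateField
    fun c => (algebraicClosure E⟮u⟯ A).algebraMap_mem (algebraMap E _ (algebraMap k E c))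
  have hEB : ∀ e ∈ E⟮u⟯, e ∈ B := fun e he => (algebraicClosure E⟮u⟯ A).algebraMap_mem ⟨e, he⟩
  have hB' : ∀ b ∈ B, b ∈ adjoin B {u'} := fun b hb => (adjoin B {u'}).algebraMap_mem ⟨b, hb⟩
  have hexpB : ExpChar (adjoin B {u'}) p := (algebraMap (adjoin B {u'}) A).expChar
    (algebraMap (adjoin B {u'}) A).injective p
  have hBu : Transcendental B u' := by
    intro h
    have h1 : IsAlgebraic (algebraicClosure E⟮u⟯ A) u' := h
    exact (indep_iff.1 hindE).2 (h1.restrictScalars E⟮u⟯)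
  have hle : (Mi⟮algebraMap F A (z c)⟯).toSubfield ≤
      (perfectClosure (adjoin B {u'}) A).toSubfield := by
    rw [adjoin_toSubfield, Subfield.closure_le, Set.union_subset_iff]
    constructor
    · rintro _ ⟨w, rfl⟩
      obtain ⟨n, w', hw'⟩ := (mem_perfectClosure_iff_pow_mem p).1 w.2
      refine (mem_perfectClosure_iff_pow_mem p).2 ⟨n, ?_⟩
      have h1 : (adjoin E {X, Y}).toSubfield ≤ (adjoin B {u'}).toSubfield := by
        rw [adjoin_toSubfield, Subfield.closure_le, Set.union_subset_iff]
        have hub : u ∈ adjoin B {u'} := hB' _ (hEB _ (mem_adjoin_simple_self E u))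
        have hub' : u' ∈ adjoin B {u'} := mem_adjoin_simple_self _ _
        have hcb : ∀ c, algebraMap k A c ∈ adjoin B {u'} := fun c => hB' _ (_root_.algebraMap_mem B c)
        have hY : Y = (u - u') / (algebraMap k A c - algebraMap k A c') := by
          rw [hu, hu', eq_div_iff hcc]; ring
        have hYB : Y ∈ adjoin B {u'} := by
          rw [hY]; exact div_mem (sub_mem hub hub') (sub_mem (hcb _) (hcb _))
        have hXB : X ∈ adjoin B {u'} := by
          have : X = u - algebraMap k A c * Y := by rw [hu]; ring
          rw [this]; exact sub_mem hub (mul_mem (hcb _) hYB)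
        constructor
        · rintro _ ⟨e, rfl⟩
          exact hB' _ (hEB _ (_root_.algebraMap_mem _ e))
        · rintro w (rfl | rfl)
          exacts [hXB, hYB]
      exact ⟨⟨w', h1 w'.2⟩, hw'⟩
    · rintro _ rfl
      refine (mem_perfectClosure_iff_pow_mem p).2 ⟨0, ⟨⟨_, hB' _ ?_⟩, (pow_one _).symm⟩⟩
      change _ ∈ algebraicClosure E⟮u⟯ A
      refine mem_algebraicClosure_iff.2 ?_
      refine isAlgebraic_of_subset (fun w hw => ?_) (halg c hc)
      obtain ⟨N, D, hD, h⟩ := mem_adjoin_iff_exists_poly.1 hw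
      refine mem_adjoin_iff_exists_poly.2 ⟨N.map (algebraMap k E), D.map (algebraMap k E), ?_, ?_⟩
      · rwa [aeval_map_algebraMap]
      · rwa [aeval_map_algebraMap, aeval_map_algebraMap]
  have hmem : algebraMap F A (z c') ∈ Mi⟮algebraMap F A (z c)⟯ := by
    have := mem_adjoin_simple_self Mi (algebraMap F A (z c'))
    exact heq ▸ this
  obtain ⟨n, w, hw⟩ := (mem_perfectClosure_iff_pow_mem p).1 (hle hmem)
  have h1 : algebraMap F A (z c') ^ p ^ n ∈ adjoin B {u'} := hw ▸ w.2
  have h2 := mem_adjoin_of_isAlgebraic hBu h1 ((halg c' hc').pow _)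
  refine (hz c' hc').2 n ?_
  rw [← mem_adjoin_algebraMap_iff (A := A), emb, map_pow]
  exact h2

end Pencil

section Bertini

variable {k F : Type*} [Field k] [Field F] [Algebra k F]

/-- The `k`-subspace of elements algebraically dependent on `t`. -/
def aclSubspace (k : Type*) {F : Type*} [Field k] [Field F] [Algebra k F] (t : F) :
    Subspace k F where
  carrier := {z | IsAlgebraic k⟮t⟯ z}
  add_mem' := fun ha hb => ha.add hb
  zero_mem' := isAlgebraic_zero
  smul_mem' := fun c z hz => by
    have h1 : IsAlgebraic k⟮t⟯ (algebraMap k F c) :=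
      isAlgebraic_algebraMap (algebraMap k k⟮t⟯ c)
    rw [Algebra.smul_def]
    exact h1.mul hz

lemma indep_iff_notMem {t z : F} (ht : Transcendental k t) :
    Indep k t z ↔ z ∉ aclSubspace k t := by
  rw [indep_iff]; exact ⟨fun h => h.2, fun h => ⟨ht, h⟩⟩

lemma isAlgebraic_trans' {x t z : F} (h1 : IsAlgebraic k⟮x⟯ t) (h2 : IsAlgebraic k⟮t⟯ z) :
    IsAlgebraic k⟮x⟯ z := by
  have hle : (k⟮t⟯).toSubfield ≤ (algebraicClosure k⟮x⟯ F).toSubfield := by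
    rw [adjoin_toSubfield, Subfield.closure_le, Set.union_subset_iff]
    constructor
    · rintro _ ⟨c, rfl⟩
      exact (algebraicClosure k⟮x⟯ F).algebraMap_mem (algebraMap k k⟮x⟯ c)
    · rintro _ rfl
      exact (mem_algebraicClosure_iff (F := k⟮x⟯) (E := F)).2 h1
  have : IsAlgebraic (algebraicClosure k⟮x⟯ F) z := isAlgebraic_of_subset hle h2
  exact this.restrictScalars k⟮x⟯

/-- The multiples by `z⁻¹` of a subspace. -/
def divSubspace (V : Subspace k F) (z : F) : Subspace k F :=
  V.comap (LinearMap.mulLeft k z)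

lemma mem_divSubspace {V : Subspace k F} {z w : F} : w ∈ divSubspace V z ↔ z * w ∈ V := Iff.rfl

lemma divSubspace_ne_top {V : Subspace k F} (hV : V ≠ ⊤) {z : F} (hz : z ≠ 0) :
    divSubspace V z ≠ ⊤ := by
  rintro h
  refine hV (eq_top_iff.2 fun w _ => ?_)
  have : z⁻¹ * w ∈ divSubspace V z := h ▸ Submodule.mem_top
  rwa [mem_divSubspace, mul_inv_cancel_left₀ hz] at this

variable {x₀ y₀ : F} (hxy : Indep k x₀ y₀)
include hxy

lemma aclSubspace_ne_top (t : F) : aclSubspace k t ≠ ⊤ := by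
  intro h
  have h1 : x₀ ∈ aclSubspace k t := h ▸ Submodule.mem_top
  have h2 : y₀ ∈ aclSubspace k t := h ▸ Submodule.mem_top
  have h3 : IsAlgebraic k⟮x₀⟯ t := by
    by_contra h3
    exact (indep_iff.1 (indep_iff.2 ⟨hxy.left, h3⟩ : Indep k x₀ t).symm).2 h1
  exact (indep_iff.1 hxy).2 (isAlgebraic_trans' h3 h2)

lemma one_ne_top : (1 : Submodule k F) ≠ ⊤ := by
  intro h
  have h1 : x₀ ∈ (1 : Submodule k F) := h ▸ Submodule.mem_top
  obtain ⟨c, rfl⟩ := Submodule.mem_one.1 h1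
  exact hxy.left (isAlgebraic_algebraMap c)

omit hxy in
lemma exists_notMem_subspaces [Infinite k] {ι : Type*} (I : Finset ι) (V : ι → Subspace k F)
    (hV : ∀ i ∈ I, V i ≠ ⊤) : ∃ w : F, ∀ i ∈ I, w ∉ V i := by
  classical
  have := Subspace.biUnion_ne_univ_of_top_notMem (s := I.image V) (by
    intro h
    obtain ⟨i, hi, e⟩ := Finset.mem_image.1 h
    exact hV i hi e)
  obtain ⟨w, hw⟩ := (Set.ne_univ_iff_exists_notMem _).1 this
  exact ⟨w, fun i hi h => hw (Set.mem_biUnion (Finset.mem_image_of_mem V hi) h)⟩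

omit hxy in
lemma finite_smul_mem {V : Subspace k F} {x w : F} (hx : x ∉ V) :
    {c : k | w + c • x ∈ V}.Finite := by
  refine Set.Subsingleton.finite fun c hc d hd => ?_
  by_contra hne
  have h := V.sub_mem hc hd
  have h2 : w + c • x - (w + d • x) = (c - d) • x := by rw [sub_smul]; abel
  rw [h2] at h
  exact hx ((V.smul_mem_iff (sub_ne_zero.2 hne)).1 h)

variable [IsAlgClosed k] {p : ℕ} [ExpChar F p]

/-- A general linear combination is a general element, simultaneously for finitely many
affine substitutions. -/
lemma exists_pGen_indep
    (hfg : ∃ s : Finset F, ∀ z : F, ∃ n : ℕ, z ^ p ^ n ∈ adjoin k (s : Set F))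
    (S : Finset (F × F)) (hS : ∀ q ∈ S, q.1 ≠ 0) (T : Finset (F × F))
    (hT : ∀ t ∈ T, Transcendental k t.1) :
    ∃ u : F, (∀ q ∈ S, PGen p k (q.1 * u + q.2)) ∧ ∀ t ∈ T, Indep k t.1 (u + t.2) := by
  classical
  obtain ⟨y, hy⟩ := exists_notMem_subspaces (S.disjSum T)
    (Sum.elim (fun q => divSubspace 1 q.1) (fun t => aclSubspace k t.1)) (by
      rintro (q | t) h
      · exact divSubspace_ne_top (one_ne_top hxy) (hS q (by simpa using h))
      · exact aclSubspace_ne_top hxy t.1)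
  have hyS : ∀ q ∈ S, Transcendental k (q.1 * y) := by
    intro q hq
    have := hy (Sum.inl q) (by simpa using hq)
    rw [transcendental_iff_notMem_range]
    rintro ⟨c, hc⟩
    exact this (Submodule.mem_one.2 ⟨c, hc⟩)
  have hyT : ∀ t ∈ T, y ∉ aclSubspace k t.1 := fun t ht => hy (Sum.inr t) (by simpa using ht)
  obtain ⟨x, hx⟩ := exists_notMem_subspaces S (fun q => divSubspace (aclSubspace k (q.1 * y)) q.1)
    fun q hq => divSubspace_ne_top (aclSubspace_ne_top hxy _) (hS q hq)
  have hc₀ : ∃ c₀ : k, ∀ q ∈ S, q.2 + c₀ • (q.1 * x) ∉ aclSubspace k (q.1 * y) := by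
    have : (⋃ q ∈ S, {c : k | q.2 + c • (q.1 * x) ∈ aclSubspace k (q.1 * y)}).Finite :=
      S.finite_toSet.biUnion fun q hq => finite_smul_mem (hx q hq)
    obtain ⟨c₀, hc₀⟩ := this.infinite_compl.nonempty
    exact ⟨c₀, fun q hq h => hc₀ (Set.mem_biUnion hq h)⟩
  obtain ⟨c₀, hc₀⟩ := hc₀
  have e1 : ∀ᶠ c : k in Filter.cofinite, ∀ q ∈ S,
      PGen p k ((q.1 * (c₀ • x) + q.2) + algebraMap k F c * (q.1 * y)) := by
    rw [Filter.eventually_all_finset]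
    intro q hq
    refine pGen_pencil hfg ((indep_iff_notMem (hyS q hq)).2 ?_).symm
    have := hc₀ q hq
    rwa [add_comm, mul_smul_comm]
  have e2 : ∀ᶠ c : k in Filter.cofinite, ∀ t ∈ T,
      c₀ • x + c • y + t.2 ∉ aclSubspace k t.1 := by
    rw [Filter.eventually_all_finset]
    intro t ht
    rw [Filter.eventually_cofinite]
    simp only [not_not]
    have := finite_smul_mem (w := c₀ • x + t.2) (hyT t ht)
    simpa only [add_right_comm] using this
  obtain ⟨c, h1, h2⟩ := (e1.and e2).exists
  refine ⟨c₀ • x + c • y, fun q hq => ?_, fun t ht => (indep_iff_notMem (hT t ht)).2 (h2 t ht)⟩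
  convert h1 q hq using 1
  rw [← Algebra.smul_def, mul_add, mul_smul_comm, mul_smul_comm]
  ring

lemma exists_pGen
    (hfg : ∃ s : Finset F, ∀ z : F, ∃ n : ℕ, z ^ p ^ n ∈ adjoin k (s : Set F))
    (S : Finset (F × F)) (hS : ∀ q ∈ S, q.1 ≠ 0) (T : Finset F)
    (hT : ∀ t ∈ T, Transcendental k t) :
    ∃ u : F, (∀ q ∈ S, PGen p k (q.1 * u + q.2)) ∧ ∀ t ∈ T, Indep k t u := by
  classical
  obtain ⟨u, h1, h2⟩ := exists_pGen_indep hxy hfg S hS (T.image fun t => (t, 0))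
    (by simpa using hT)
  exact ⟨u, h1, fun t ht => by simpa using h2 (t, 0) (by simpa using ht)⟩

end Bertini

lemma Gen.swap {k : Type*} [Field k] {P : k → k → Prop} (h : Gen P) :
    Gen fun α β => P β α := by
  obtain ⟨D, hD, h⟩ := h
  refine ⟨Bivariate.swap D, by simpa using hD, fun α β hne => h β α ?_⟩
  have e : ∀ (α β : k) (D : k[X][X]), evalEval α β D = aevalAeval α β D := by
    intro α β D
    have : (evalEvalRingHom α β : k[X][X] →+* k) = (aevalAeval (R := k) α β).toRingHom := by
      refine Polynomial.ringHom_ext' (Polynomial.ringHom_ext' ?_ ?_) ?_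
      · ext c; simp
      · simp
      · simp
    exact congrArg (fun f => f D) this
  rwa [e, Bivariate.aevalAeval_swap, ← e] at hne

section Core

variable {ℓ : ℕ} [Fact ℓ.Prime] {k F : Type*} [Field k] [IsAlgClosed k] [Field F]
  [Algebra k F] {p : ℕ} [ExpChar F p]

/-- `F` is, up to `p`-powers, finitely generated over `k`, and of transcendence degree at least
two. -/
structure Core (ℓ p : ℕ) (k F : Type*) [Field k] [Field F] [Algebra k F] : Prop where
  hp : (p : ZMod ℓ) ≠ 0
  fg : ∃ s : Finset F, ∀ z : F, ∃ n : ℕ, z ^ p ^ n ∈ adjoin k (s : Set F)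
  two : ∃ x y : F, Indep k x y

omit [IsAlgClosed k] [ExpChar F p] in
lemma Fl.exists_ordc (hp : (p : ZMod ℓ) ≠ 0) {x y s : F} (hx : PGen p k x) (hy : PGen p k y)
    (hs : PGen p k s) {α β γ : k} {j : ZMod ℓ} (h : Fl ℓ k x y s α β γ j) :
    ∃ v w : KChar ℓ F, IsSt v w ∧
      (∀ c ∈ RA ℓ k x, v c = 0 ∧ w c = ordc k x α c) ∧
      (∀ c ∈ RA ℓ k y, v c = ordc k y β c ∧ w c = 0) ∧
      (∀ c ∈ RA ℓ k s, v c = 0 ∧ w c = j * ordc k s γ c) := by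
  obtain ⟨v, w, hvw, h⟩ := h
  refine ⟨v, w, hvw, ?_, ?_, ?_⟩
  · intro c hc
    obtain ⟨P, hP, rfl⟩ := exists_poly_of_mem_RA hc
    rw [ordc_cls hp hx hP]
    exact (h P hP).1
  · intro c hc
    obtain ⟨P, hP, rfl⟩ := exists_poly_of_mem_RA hc
    rw [ordc_cls hp hy hP]
    exact (h P hP).2.1
  · intro c hc
    obtain ⟨P, hP, rfl⟩ := exists_poly_of_mem_RA hc
    rw [ordc_cls hp hs hP]
    exact (h P hP).2.2

lemma gen_exists_fl (hp : (p : ZMod ℓ) ≠ 0)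
    (hfg : ∃ s : Finset F, ∀ z : F, ∃ n : ℕ, z ^ p ^ n ∈ adjoin k (s : Set F))
    {x y s : F} (hxy : Indep k x y) (hys : Indep k y s) :
    Gen fun α β : k => ∃ γ j, Fl ℓ k x y s α β γ j := by
  rcases flag_dichotomy (ℓ := ℓ) hp hfg hxy hys ∅ with h | ⟨n, N, D, -, -, h⟩
  · exact h.mono fun α β ⟨γ₁, _, j₁, _, _, _, _, h, _⟩ => ⟨γ₁, j₁, h⟩
  · exact h.mono fun α β ⟨γ, j, h, _⟩ => ⟨γ, j, h⟩

omit [IsAlgClosed k] [ExpChar F p] in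
lemma cls_mem_RA_of_pow_mem (hp : (p : ZMod ℓ) ≠ 0) {t z : F} {n : ℕ}
    (h : z ^ p ^ n ∈ k⟮t⟯) : cls ℓ z ∈ RA ℓ k t := by
  by_cases hz : z = 0
  · rw [hz, cls_zero]; exact one_mem _
  obtain ⟨N, D, hD, hND⟩ := mem_adjoin_iff_exists_poly.1 h
  have h1 : cls ℓ z ^ p ^ n ∈ RA ℓ k t := by
    rw [← cls_pow hz, eq_div_of_mul_eq hD hND, cls_div ?_ hD]
    · exact div_mem cls_mem_RA cls_mem_RA
    · rw [← hND]; exact mul_ne_zero (pow_ne_zero _ hz) hD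
  let m : ℕ := ((p ^ n : ZMod ℓ)⁻¹).val
  have h2 : cls ℓ z = (cls ℓ z ^ p ^ n) ^ m := by
    rw [← pow_mul]
    conv_lhs => rw [← pow_one (cls ℓ z)]
    refine Cl_pow_congr (ℓ := ℓ) ?_ (cls ℓ z)
    simp [m, mul_inv_cancel₀ (pow_ne_zero n hp)]
  rw [h2]
  exact pow_mem h1 m

omit [IsAlgClosed k] [ExpChar F p] in
lemma RA_le_of_isAlgebraic (hp : (p : ZMod ℓ) ≠ 0) {x y : F} (hy : PGen p k y)
    (h : IsAlgebraic k⟮y⟯ x) : RA ℓ k x ≤ RA ℓ k y := by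
  intro c hc
  obtain ⟨P, hP, rfl⟩ := hc
  have h1 : IsAlgebraic k⟮y⟯ (aeval x P) := by
    rw [← mem_algebraicClosure_iff] at h ⊢
    rw [← aeval_map_algebraMap k⟮y⟯]
    have h2 := IntermediateField.aeval_coe (algebraicClosure k⟮y⟯ F) ⟨x, h⟩ (P.map (algebraMap k k⟮y⟯))
    exact h2 ▸ SetLike.coe_mem _
  obtain ⟨n, hn⟩ := hy.2 _ h1
  exact cls_mem_RA_of_pow_mem hp hn

omit [IsAlgClosed k] [ExpChar F p] in
lemma indep_of_RA_ne (hp : (p : ZMod ℓ) ≠ 0) {x y : F} (hx : PGen p k x) (hy : PGen p k y)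
    (h : RA ℓ k x ≠ RA ℓ k y) : Indep k x y := by
  by_contra hxy
  have h1 : IsAlgebraic k⟮x⟯ y := by
    by_contra h1
    exact hxy (indep_iff.2 ⟨hx.1, h1⟩)
  have h2 : IsAlgebraic k⟮y⟯ x := by
    by_contra h1
    exact hxy (indep_iff.2 ⟨hy.1, h1⟩ : Indep k y x).symm
  exact h (le_antisymm (RA_le_of_isAlgebraic hp hy h2) (RA_le_of_isAlgebraic hp hx h1))

lemma RA_ne_of_indep (hF : Core ℓ p k F) {x y : F}
    (h : Indep k x y) : RA ℓ k x ≠ RA ℓ k y := by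
  have hys : Indep k y (x + algebraMap k F 1 * y) := h.symm.add_smul
  obtain ⟨α, β, γ, j, v, w, -, hfl⟩ := (gen_exists_fl (ℓ := ℓ) hF.hp hF.fg h hys).exists
  intro heq
  have h1 : cls ℓ (aeval y (X - C β)) ∈ RA ℓ k x := heq ▸ cls_mem_RA
  obtain ⟨P, hP, e⟩ := exists_poly_of_mem_RA h1
  have h2 := ((hfl P hP).1).1
  rw [e, ((hfl _ (X_sub_C_ne_zero β)).2.1).1, rootMultiplicity_X_sub_C_self] at h2
  simp at h2

end Core

end MilnorRec

namespace MilnorRec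

open Polynomial IntermediateField Filter

section Compat

variable {ℓ : ℕ} [Fact ℓ.Prime] {k F : Type*} [Field k] [Field F] [Algebra k F]
  {l G : Type*} [Field l] [Field G] [Algebra l G] {p q : ℕ}

/-- An isomorphism of mod-`ℓ` multiplicative groups which respects Steinberg pairs of characters
and the rational subgroups. -/
structure Compat (p q : ℕ) (k l : Type*) {F G : Type*} [Field k] [Field F] [Algebra k F]
    [Field l] [Field G] [Algebra l G] (Φ : Cl ℓ F ≃* Cl ℓ G) : Prop where
  coreF : Core ℓ p k F
  coreG : Core ℓ q l G
  st : ∀ v w : KChar ℓ G, IsSt v w → IsSt (v.comap Φ) (w.comap Φ)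
  st' : ∀ v w : KChar ℓ F, IsSt v w → IsSt (v.comap Φ.symm) (w.comap Φ.symm)
  rat : ∀ x : F, PGen p k x → ∃ x' : G, PGen q l x' ∧ ∀ c, c ∈ RA ℓ k x ↔ Φ c ∈ RA ℓ l x'
  rat' : ∀ x' : G, PGen q l x' → ∃ x : F, PGen p k x ∧ ∀ c, c ∈ RA ℓ k x ↔ Φ c ∈ RA ℓ l x'

/-- `x` and `x'` are general elements whose rational subgroups correspond under `Φ`. -/
structure Cor (p q : ℕ) (k l : Type*) {F G : Type*} [Field k] [Field F] [Algebra k F]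
    [Field l] [Field G] [Algebra l G] (Φ : Cl ℓ F ≃* Cl ℓ G) (x : F) (x' : G) : Prop where
  pg : PGen p k x
  pg' : PGen q l x'
  mem_iff : ∀ c, c ∈ RA ℓ k x ↔ Φ c ∈ RA ℓ l x'

variable {Φ : Cl ℓ F ≃* Cl ℓ G}

lemma Compat.symm (H : Compat p q k l Φ) : Compat q p l k Φ.symm where
  coreF := H.coreG
  coreG := H.coreF
  st := H.st'
  st' := H.st
  rat x hx := by
    obtain ⟨y, hy, h⟩ := H.rat' x hx
    exact ⟨y, hy, fun c => by rw [h, MulEquiv.apply_symm_apply]⟩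
  rat' x hx := by
    obtain ⟨y, hy, h⟩ := H.rat x hx
    exact ⟨y, hy, fun c => by rw [h, MulEquiv.apply_symm_apply]⟩

lemma Cor.symm {x : F} {x' : G} (h : Cor p q k l Φ x x') : Cor q p l k Φ.symm x' x :=
  ⟨h.pg', h.pg, fun c => by rw [h.mem_iff, MulEquiv.apply_symm_apply]⟩

lemma Compat.exists_cor (H : Compat p q k l Φ) {x : F} (hx : PGen p k x) :
    ∃ x', Cor p q k l Φ x x' := by
  obtain ⟨x', h1, h2⟩ := H.rat x hx
  exact ⟨x', hx, h1, h2⟩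

lemma Cor.indep [IsAlgClosed k] [IsAlgClosed l] [ExpChar F p] [ExpChar G q]
    (H : Compat p q k l Φ) {x y : F} {x' y' : G} (hx : Cor p q k l Φ x x')
    (hy : Cor p q k l Φ y y') (h : Indep k x y) : Indep l x' y' := by
  refine indep_of_RA_ne H.coreG.hp hx.pg' hy.pg' fun heq => RA_ne_of_indep H.coreF h ?_
  ext c
  rw [hx.mem_iff, hy.mem_iff, heq]

/-- The point `α` for `x'` matches the point `a` for `x`. -/
def PM (k l : Type*) {F G : Type*} [Field k] [Field F] [Algebra k F]
    [Field l] [Field G] [Algebra l G] (Φ : Cl ℓ F ≃* Cl ℓ G) (x : F) (x' : G) (α : l) (a : k) :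
    Prop :=
  ∃ n : ZMod ℓ, n ≠ 0 ∧ ∀ c ∈ RA ℓ k x, ordc l x' α (Φ c) = n * ordc k x a c

lemma eq_mul_ordc [IsAlgClosed k] (hp : (p : ZMod ℓ) ≠ 0) {x : F} (hx : PGen p k x)
    (V : Cl ℓ F → ZMod ℓ)
    (hV : ∀ c ∈ RA ℓ k x, ∀ d ∈ RA ℓ k x, V (c * d) = V c + V d) {a : k}
    (h : ∀ b, b ≠ a → V (cls ℓ (x - algebraMap k F b)) = 0) (c : Cl ℓ F) (hc : c ∈ RA ℓ k x) :
    V c = V (cls ℓ (x - algebraMap k F a)) * ordc k x a c := by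
  classical
  have h1 : V 1 = 0 := by
    have := hV 1 (one_mem _) 1 (one_mem _)
    rw [mul_one] at this
    linear_combination -this
  obtain ⟨P, hP, rfl⟩ := exists_poly_of_mem_RA hc
  rw [ordc_cls hp hx hP, cls_aeval_eq_prod hx.1 hP, ← count_roots]
  induction P.roots using Multiset.induction_on with
  | empty => simp [h1]
  | cons b s ih =>
    rw [Multiset.map_cons, Multiset.prod_cons, hV _ (cls_sub_mem_RA b) _ ?_, ih]
    · rcases eq_or_ne b a with rfl | hb
      · rw [Multiset.count_cons_self]; push_cast; ring
      · rw [h b hb, Multiset.count_cons_of_ne hb.symm, zero_add]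
    · refine multiset_prod_mem _ fun d hd => ?_
      obtain ⟨r, -, rfl⟩ := Multiset.mem_map.1 hd
      exact cls_sub_mem_RA r

lemma Cor.ordc_mul {x : F} {x' : G} (hq : (q : ZMod ℓ) ≠ 0) (hx : Cor p q k l Φ x x') (α : l)
    {c d : Cl ℓ F} (hc : c ∈ RA ℓ k x) (hd : d ∈ RA ℓ k x) :
    ordc l x' α (Φ (c * d)) = ordc l x' α (Φ c) + ordc l x' α (Φ d) := by
  rw [map_mul, MilnorRec.ordc_mul hq hx.pg' ((hx.mem_iff c).1 hc) ((hx.mem_iff d).1 hd)]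

lemma Cor.not_eventually_shift [IsAlgClosed k] [IsAlgClosed l] {s : F} {s' : G}
    (hp : (p : ZMod ℓ) ≠ 0) (hq : (q : ZMod ℓ) ≠ 0) (hs : Cor p q k l Φ s s') {d : k} (hd : d ≠ 0)
    (h : ∀ᶠ σ in cofinite, ∀ c, ordc l s' σ (Φ (cls ℓ (s - algebraMap k F c))) =
      ordc l s' σ (Φ (cls ℓ (s - algebraMap k F (c + d))))) : False := by
  classical
  have hB : {σ | ¬ ∀ c, ordc l s' σ (Φ (cls ℓ (s - algebraMap k F c))) =
      ordc l s' σ (Φ (cls ℓ (s - algebraMap k F (c + d))))}.Finite := h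
  let B := hB.toFinset
  let u : k → Cl ℓ F := fun c =>
    cls ℓ (s - algebraMap k F c) / cls ℓ (s - algebraMap k F (c + d))
  have hu : ∀ c, u c ∈ RA ℓ k s := fun c => div_mem (cls_sub_mem_RA _) (cls_sub_mem_RA _)
  have hu' : ∀ c, Φ (u c) ∈ RA ℓ l s' := fun c => (hs.mem_iff _).1 (hu c)
  have : NeZero ℓ := ⟨(Fact.out : ℓ.Prime).ne_zero⟩
  have : Infinite k := IsAlgClosed.instInfinite
  obtain ⟨f, hf⟩ := Finite.exists_infinite_fiber
    (fun c : k => fun b : B => ordc l s' (b : l) (Φ (u c)))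
  have hf' := Set.infinite_coe_iff.1 hf
  obtain ⟨c₁, hc₁⟩ := hf'.nonempty
  obtain ⟨c₂, hc₂, hne⟩ := hf'.exists_notMem_finset {c₁, c₁ - d}
  have heq : u c₁ = u c₂ := by
    apply Φ.injective
    refine ordc_ext hq hs.pg' (hu' _) (hu' _) fun σ => ?_
    by_cases hσ : σ ∈ B
    · exact congrFun ((Set.mem_preimage.1 hc₁ : _ = f).trans
        (Set.mem_preimage.1 hc₂ : _ = f).symm) ⟨σ, hσ⟩
    · have hz : ∀ c, ordc l s' σ (Φ (u c)) = 0 := by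
        intro c
        have h1 : ∀ c, ordc l s' σ (Φ (cls ℓ (s - algebraMap k F c))) =
            ordc l s' σ (Φ (cls ℓ (s - algebraMap k F (c + d)))) := by
          by_contra hcon
          exact hσ (hB.mem_toFinset.2 hcon)
        rw [_root_.map_div, ordc_div hq hs.pg' ((hs.mem_iff _).1 (cls_sub_mem_RA _))
          ((hs.mem_iff _).1 (cls_sub_mem_RA _)), h1, sub_self]
      rw [hz, hz]
  have h1 := congrArg (ordc k s c₁) heq
  rw [ordc_div hp hs.pg (cls_sub_mem_RA _) (cls_sub_mem_RA _),
    ordc_div hp hs.pg (cls_sub_mem_RA _) (cls_sub_mem_RA _), ordc_sub hp hs.pg, ordc_sub hp hs.pg,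
    ordc_sub hp hs.pg, ordc_sub hp hs.pg] at h1
  simp only [Finset.mem_insert, Finset.mem_singleton, not_or] at hne
  rw [if_pos rfl, if_neg (by simpa using hd), if_neg (Ne.symm hne.1),
    if_neg (fun h => hne.2 (by rw [h]; ring))] at h1
  simp at h1

variable [IsAlgClosed k] [IsAlgClosed l] [ExpChar F p] [ExpChar G q]

lemma eventually_exists_pm (H : Compat p q k l Φ) {x : F} {x' : G} (hx : Cor p q k l Φ x x') :
    ∀ᶠ α in cofinite, ∃ a, PM k l Φ x x' α a := by
  classical
  obtain ⟨x₀, y₀, h₀⟩ := H.coreF.two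
  obtain ⟨y, hy1, hy2⟩ := exists_pGen h₀ H.coreF.fg {(1, 0), (1, x)} (by simp) {x}
    (by simpa using hx.pg.1)
  have hy : PGen p k y := by simpa using hy1 (1, 0) (by simp)
  have hs : PGen p k (y + x) := by simpa using hy1 (1, x) (by simp)
  have hxy : Indep k x y := hy2 x (by simp)
  set s := y + x with hsdef
  have hxs : Indep k x s := by simpa using hxy.add_smul (c := 1)
  have hys : Indep k y s := by
    have := hxy.symm.add_smul (c := 1)
    rwa [map_one, one_mul, add_comm] at this
  obtain ⟨y', hy'⟩ := H.exists_cor hy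
  obtain ⟨s', hs'⟩ := H.exists_cor hs
  have hq := H.coreG.hp
  have hgen := (gen_exists_fl (ℓ := ℓ) H.coreG.hp H.coreG.fg (Cor.indep H hx hs' hxs).symm
    (Cor.indep H hx hy' hxy)).swap.eventually
  refine hgen.mono fun α hα => ?_
  obtain ⟨a, ha⟩ : ∃ a, ordc l x' α (Φ (cls ℓ (x - algebraMap k F a))) ≠ 0 := by
    by_contra! hcon
    have h1 := eq_mul_ordc H.coreF.hp hx.pg (fun c => ordc l x' α (Φ c))
      (fun c hc d hd => hx.ordc_mul hq α hc hd) (a := 0) (fun b _ => hcon b)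
      (Φ.symm (cls ℓ (x' - algebraMap l G α)))
      (by rw [hx.mem_iff, Φ.apply_symm_apply]; exact cls_sub_mem_RA α)
    rw [hcon, zero_mul, Φ.apply_symm_apply, ordc_sub hq hx.pg', if_pos rfl] at h1
    exact one_ne_zero h1
  refine ⟨a, _, ha, eq_mul_ordc H.coreF.hp hx.pg (fun c => ordc l x' α (Φ c))
      (fun c hc d hd => hx.ordc_mul hq α hc hd) fun b hb => ?_⟩
  by_contra hb0
  refine hs'.not_eventually_shift H.coreF.hp hq (sub_ne_zero.2 hb) (hα.mono ?_)
  rintro σ ⟨β, j, hfl⟩ c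
  obtain ⟨v, w, hvw, hvs, hvx, hvy⟩ := hfl.exists_ordc hq hs'.pg' hx.pg' hy'.pg'
  have key : ∀ a b : k, ordc l x' α (Φ (cls ℓ (x - algebraMap k F a))) ≠ 0 →
      ordc l s' σ (Φ (cls ℓ (s - algebraMap k F (a + b)))) =
        j * ordc l y' β (Φ (cls ℓ (y - algebraMap k F b))) := by
    intro a b ha
    have h1 := H.st v w hvw ((x - algebraMap k F a) / (s - algebraMap k F (a + b)))
      ((y - algebraMap k F b) / (s - algebraMap k F (a + b)))
      (div_ne_zero (sub_algebraMap_ne_zero hx.pg.1 _) (sub_algebraMap_ne_zero hs.1 _))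
      (div_ne_zero (sub_algebraMap_ne_zero hy.1 _) (sub_algebraMap_ne_zero hs.1 _))
      (by
        rw [← add_div, div_eq_one_iff_eq (sub_algebraMap_ne_zero hs.1 _), hsdef, map_add]
        ring)
    rw [cls_div (sub_algebraMap_ne_zero hx.pg.1 _) (sub_algebraMap_ne_zero hs.1 _),
      cls_div (sub_algebraMap_ne_zero hy.1 _) (sub_algebraMap_ne_zero hs.1 _)] at h1
    simp only [KChar.comap_apply, _root_.map_div, KChar.map_div] at h1
    have ex := hvx _ ((hx.mem_iff _).1 (cls_sub_mem_RA a))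
    have ey := hvy _ ((hy'.mem_iff _).1 (cls_sub_mem_RA b))
    have es := hvs _ ((hs'.mem_iff _).1 (cls_sub_mem_RA (a + b)))
    rw [ex.1, ex.2, ey.1, ey.2, es.1, es.2, sub_zero, sub_zero, mul_zero] at h1
    have := (mul_eq_zero.1 h1).resolve_left ha
    linear_combination -this
  have h1 := key a (c - a) ha
  have h2 := key b (c - a) hb0
  rw [show a + (c - a) = c by ring] at h1
  rw [show b + (c - a) = c + (b - a) by ring] at h2
  rw [h1, h2]

end Compat

section Match

variable {ℓ : ℕ} [Fact ℓ.Prime] {k F : Type*} [Field k] [Field F] [Algebra k F]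
  {l G : Type*} [Field l] [Field G] [Algebra l G] {p q : ℕ} {Φ : Cl ℓ F ≃* Cl ℓ G}

lemma PM.ordc_ne_zero (hp : (p : ZMod ℓ) ≠ 0) {x : F} {x' : G} (hx : PGen p k x)
    {α : l} {a : k} (h : PM k l Φ x x' α a) :
    ordc l x' α (Φ (cls ℓ (x - algebraMap k F a))) ≠ 0 := by
  classical
  obtain ⟨n, hn, h⟩ := h
  rwa [h _ (cls_sub_mem_RA a), ordc_sub hp hx, if_pos rfl, mul_one]

lemma PM.eq_of_ordc_ne_zero (hp : (p : ZMod ℓ) ≠ 0) {x : F} {x' : G} (hx : PGen p k x)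
    {α : l} {a b : k} (h : PM k l Φ x x' α a)
    (h' : ordc l x' α (Φ (cls ℓ (x - algebraMap k F b))) ≠ 0) : a = b := by
  classical
  obtain ⟨n, hn, h⟩ := h
  by_contra hne
  rw [h _ (cls_sub_mem_RA b), ordc_sub hp hx, if_neg hne, mul_zero] at h'
  exact h' rfl

lemma PM.left_unique (hp : (p : ZMod ℓ) ≠ 0) {x : F} {x' : G} (hx : PGen p k x)
    {α : l} {a b : k} (h : PM k l Φ x x' α a) (h' : PM k l Φ x x' α b) : a = b :=
  h.eq_of_ordc_ne_zero hp hx (h'.ordc_ne_zero hp hx)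

lemma PM.symm {x : F} {x' : G} (hx : Cor p q k l Φ x x') {α : l} {a : k}
    (h : PM k l Φ x x' α a) : PM l k Φ.symm x' x a α := by
  obtain ⟨n, hn, h⟩ := h
  refine ⟨n⁻¹, inv_ne_zero hn, fun c hc => ?_⟩
  have := h (Φ.symm c) (by rw [hx.mem_iff, Φ.apply_symm_apply]; exact hc)
  rw [Φ.apply_symm_apply] at this
  rw [this, inv_mul_cancel_left₀ hn]

lemma PM.right_unique (hq : (q : ZMod ℓ) ≠ 0) {x : F} {x' : G} (hx : Cor p q k l Φ x x')
    {α β : l} {a : k} (h : PM k l Φ x x' α a) (h' : PM k l Φ x x' β a) : α = β :=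
  (h.symm hx).left_unique hq hx.pg' (h'.symm hx)

/-- The general elements `x`, `x'` correspond, and `τ` matches almost all of their points. -/
structure Match (p q : ℕ) (Φ : Cl ℓ F ≃* Cl ℓ G) (τ : k → l) (x : F) (x' : G) : Prop where
  cor : Cor p q k l Φ x x'
  pm : ∀ᶠ a in cofinite, PM k l Φ x x' (τ a) a

lemma Match.congr {τ τ' : k → l} {x : F} {x' : G} (h : Match p q Φ τ x x')
    (hτ : τ =ᶠ[cofinite] τ') : Match p q Φ τ' x x' :=
  ⟨h.cor, h.pm.mp (hτ.mono fun _ ha h => ha ▸ h)⟩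

variable [IsAlgClosed k] [IsAlgClosed l] [ExpChar F p] [ExpChar G q]

lemma Compat.exists_match (H : Compat p q k l Φ) {x : F} {x' : G} (hx : Cor p q k l Φ x x') :
    ∃ τ : k → l, Match p q Φ τ x x' := by
  classical
  have h := eventually_exists_pm H.symm hx.symm
  refine ⟨fun a => if h : ∃ α, PM l k Φ.symm x' x a α then h.choose else 0, hx,
    h.mono fun a ha => ?_⟩
  rw [dif_pos ha]
  exact ha.choose_spec.symm hx.symm

omit [IsAlgClosed k] [IsAlgClosed l] [ExpChar F p] [ExpChar G q] in
lemma Match.injOn (H : Compat p q k l Φ) {τ : k → l} {x : F} {x' : G} (h : Match p q Φ τ x x') :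
    Set.InjOn τ {a | PM k l Φ x x' (τ a) a} := fun a ha b hb hab => by
  have ha' : PM k l Φ x x' (τ a) a := ha
  have hb' : PM k l Φ x x' (τ b) b := hb
  rw [hab] at ha'
  exact ha'.left_unique H.coreF.hp h.cor.pg hb'

omit [IsAlgClosed k] [IsAlgClosed l] [ExpChar F p] [ExpChar G q] in
lemma Match.exists_injOn (H : Compat p q k l Φ) {τ : k → l} {x : F} {x' : G}
    (h : Match p q Φ τ x x') : ∃ S : Set k, S ∈ cofinite ∧ Set.InjOn τ S :=
  ⟨_, h.pm, h.injOn H⟩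

lemma tendsto_cofinite_of_injOn {X Y : Type*} {f : X → Y} {S : Set X} (hS : S ∈ cofinite)
    (hf : Set.InjOn f S) : Tendsto f cofinite cofinite := by
  refine Tendsto.cofinite_of_finite_preimage_singleton fun y => ?_
  have h1 : (f ⁻¹' {y} ∩ S).Subsingleton := fun a ha b hb =>
    hf ha.2 hb.2 (ha.1.trans hb.1.symm)
  refine (h1.finite.union (mem_cofinite.1 hS)).subset fun a ha => ?_
  by_cases has : a ∈ S
  · exact Or.inl ⟨ha, has⟩
  · exact Or.inr has

omit [IsAlgClosed k] [IsAlgClosed l] [ExpChar F p] [ExpChar G q] in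
lemma Match.tendsto (H : Compat p q k l Φ) {τ : k → l} {x : F} {x' : G}
    (h : Match p q Φ τ x x') : Tendsto τ cofinite cofinite :=
  tendsto_cofinite_of_injOn h.pm (h.injOn H)

lemma Match.eventually_of (H : Compat p q k l Φ) {τ : k → l} {x : F} {x' : G}
    (h : Match p q Φ τ x x') {P : l → Prop} (hP : ∀ᶠ a in cofinite, P (τ a)) :
    ∀ᶠ α in cofinite, P α := by
  have h1 := (h.pm.and hP)
  have hfin : {a | ¬ (PM k l Φ x x' (τ a) a ∧ P (τ a))}.Finite := h1
  have h2 : ∀ᶠ α : l in cofinite, ∀ a ∈ {a | ¬ (PM k l Φ x x' (τ a) a ∧ P (τ a))},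
      ¬ PM k l Φ x x' α a := by
    rw [eventually_all_finite hfin]
    intro a _
    refine (Set.Subsingleton.finite (s := {α | PM k l Φ x x' α a}) fun α hα β hβ =>
      PM.right_unique H.coreG.hp h.cor hα hβ).eventually_cofinite_notMem
  filter_upwards [h2, eventually_exists_pm H h.cor] with α h2 ⟨a, ha⟩
  by_cases h3 : PM k l Φ x x' (τ a) a ∧ P (τ a)
  · rw [ha.right_unique H.coreG.hp h.cor h3.1]
    exact h3.2
  · exact absurd ha (h2 a h3)

/-- A relation between `x`, `y` and `s` encoded by solutions of the unit equation, under which the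
points `a` of `x` and `b` of `y` determine the point `c a b` of `s`. -/
structure Tri (ℓ : ℕ) [Fact ℓ.Prime] (k : Type*) {F : Type*} [Field k] [Field F] [Algebra k F]
    (x y s : F) (c : k → k → k) : Prop where
  indep : Indep k x y
  indep' : Indep k y s
  inj : ∀ a, a ≠ 0 → Function.Injective (c a)
  inj' : ∀ b, b ≠ 0 → Function.Injective fun a => c a b
  eqn : ∀ a b, a ≠ 0 → b ≠ 0 → ∃ A B : F, A ≠ 0 ∧ B ≠ 0 ∧ A + B = 1 ∧ ∃ d ∈ RA ℓ k y,
    ordc k y b d = 0 ∧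
    cls ℓ A = cls ℓ (x - algebraMap k F a) * d / cls ℓ (s - algebraMap k F (c a b)) ∧
    cls ℓ B = cls ℓ (y - algebraMap k F b) / cls ℓ (s - algebraMap k F (c a b))

omit [IsAlgClosed k] [ExpChar F p] [IsAlgClosed l] [ExpChar G q] in
lemma Tri.pm_of_fl (H : Compat p q k l Φ) {x y s : F} {c : k → k → k} (hT : Tri ℓ k x y s c)
    {x' y' s' : G} (hx : Cor p q k l Φ x x') (hy : Cor p q k l Φ y y') (hs : Cor p q k l Φ s s')
    {α β γ : l} {j : ZMod ℓ} (hfl : Fl ℓ l x' y' s' α β γ j) {a b : k} (ha0 : a ≠ 0) (hb0 : b ≠ 0)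
    (ha : PM k l Φ x x' α a) (hb : PM k l Φ y y' β b) (hγ : ∃ e, PM k l Φ s s' γ e) :
    PM k l Φ s s' γ (c a b) := by
  have hp := H.coreF.hp
  have hq := H.coreG.hp
  obtain ⟨v, w, hvw, hvx, hvy, hvs⟩ := hfl.exists_ordc hq hx.pg' hy.pg' hs.pg'
  obtain ⟨A, B, hA, hB, hAB, d, hd, hd0, eA, eB⟩ := hT.eqn a b ha0 hb0
  have h1 := H.st v w hvw A B hA hB hAB
  rw [eA, eB] at h1
  simp only [KChar.comap_apply, _root_.map_div, KChar.map_div, _root_.map_mul, KChar.map_mul] at h1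
  have ex := hvx _ ((hx.mem_iff _).1 (cls_sub_mem_RA a))
  have ey := hvy _ ((hy.mem_iff _).1 (cls_sub_mem_RA b))
  have es := hvs _ ((hs.mem_iff _).1 (cls_sub_mem_RA (c a b)))
  have ed := hvy _ ((hy.mem_iff _).1 hd)
  have ed0 : ordc l y' β (Φ d) = 0 := by
    obtain ⟨n, -, h⟩ := hb
    rw [h _ hd, hd0, mul_zero]
  rw [ex.1, ex.2, ey.1, ey.2, es.1, es.2, ed.1, ed.2, ed0, add_zero, sub_zero, zero_mul, add_zero,
    sub_zero] at h1
  have h2 := (mul_eq_zero.1 h1.symm).resolve_right (hb.ordc_ne_zero hp hy.pg)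
  have h3 : ordc l s' γ (Φ (cls ℓ (s - algebraMap k F (c a b)))) ≠ 0 := by
    intro h0
    rw [h0, mul_zero, sub_zero] at h2
    exact ha.ordc_ne_zero hp hx.pg h2
  obtain ⟨e, he⟩ := hγ
  rwa [← he.eq_of_ordc_ne_zero hp hs.pg h3]

lemma Tri.exists_relation (H : Compat p q k l Φ) {x y s : F} {c : k → k → k}
    (hT : Tri ℓ k x y s c) {x' y' s' : G} {τx τy τs : k → l} (hx : Match p q Φ τx x x')
    (hy : Match p q Φ τy y y') (hs : Match p q Φ τs s s') :
    ∃ (n : ℕ) (N D : l[X][X]), D ≠ 0 ∧ s' ^ q ^ n * aevalAeval x' y' D = aevalAeval x' y' N ∧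
      (∀ᶠ a in cofinite, ∀ᶠ b in cofinite, evalEval (τx a) (τy b) D ≠ 0 ∧
        τs (c a b) ^ q ^ n * evalEval (τx a) (τy b) D = evalEval (τx a) (τy b) N) ∧
      ∀ᶠ b in cofinite, ∀ᶠ a in cofinite, evalEval (τx a) (τy b) D ≠ 0 ∧
        τs (c a b) ^ q ^ n * evalEval (τx a) (τy b) D = evalEval (τx a) (τy b) N := by
  classical
  have hq := H.coreG.hp
  have hxy := Cor.indep H hx.cor hy.cor hT.indep
  have hys := Cor.indep H hy.cor hs.cor hT.indep'
  have : Infinite k := IsAlgClosed.instInfinite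
  have hB : {γ | ¬ ∃ e, PM k l Φ s s' γ e}.Finite := eventually_exists_pm H hs.cor
  have hBmem : ∀ γ, γ ∉ hB.toFinset → ∃ e, PM k l Φ s s' γ e := by
    intro γ hγ
    rw [Set.Finite.mem_toFinset] at hγ
    by_contra hcon
    exact hγ hcon
  have ha : ∀ᶠ a in cofinite, a ≠ 0 ∧ PM k l Φ x x' (τx a) a :=
    ((Set.finite_singleton (0 : k)).eventually_cofinite_notMem).and hx.pm
  have hb : ∀ᶠ a in cofinite, a ≠ 0 ∧ PM k l Φ y y' (τy a) a :=
    ((Set.finite_singleton (0 : k)).eventually_cofinite_notMem).and hy.pm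
  have tr : ∀ {P : l → l → Prop}, Gen P → ∀ᶠ a in cofinite, ∀ᶠ b in cofinite, P (τx a) (τy b) :=
    fun hP => ((hx.tendsto H).eventually hP.eventually).mono fun a h => (hy.tendsto H).eventually h
  rcases flag_dichotomy (ℓ := ℓ) hq H.coreG.fg hxy hys hB.toFinset with h | ⟨n, N, D, hD, hND, h⟩
  · exfalso
    obtain ⟨a, ⟨ha0, ha⟩, h⟩ := (ha.and (tr h)).exists
    obtain ⟨b, ⟨hb0, hb⟩, γ₁, γ₂, j₁, j₂, hne, h1, h2, hf1, hf2⟩ := (hb.and h).exists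
    refine hne (PM.right_unique hq hs.cor
      (hT.pm_of_fl H hx.cor hy.cor hs.cor hf1 ha0 hb0 ha hb (hBmem _ h1))
      (hT.pm_of_fl H hx.cor hy.cor hs.cor hf2 ha0 hb0 ha hb (hBmem _ h2)))
  · refine ⟨n, N, D, hD, hND, ?_⟩
    have hNB : Gen fun α β : l => ∀ γ ∈ hB.toFinset,
        evalEval α β (N - C (C (γ ^ q ^ n)) * D) ≠ 0 := by
      refine Gen.finset _ fun γ _ => Gen.ne_zero fun h0 => ?_
      have h1 := congrArg (aevalAeval (R := l) x' y') h0
      rw [map_sub, _root_.map_mul, ← hND, map_zero, aevalAeval_C, aeval_C, ← sub_mul] at h1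
      have hD' : aevalAeval x' y' D ≠ 0 := fun h => hD (hxy D h)
      have h2 := sub_eq_zero.1 ((mul_eq_zero.1 h1).resolve_right hD')
      exact (hys.right.pow (pow_pos (expChar_pos G q) n)) (h2 ▸ isAlgebraic_algebraMap _)
    have main : ∀ a b, (a ≠ 0 ∧ PM k l Φ x x' (τx a) a) → (b ≠ 0 ∧ PM k l Φ y y' (τy b) b) →
        ((∃ γ j, Fl ℓ l x' y' s' (τx a) (τy b) γ j ∧ evalEval (τx a) (τy b) D ≠ 0 ∧
          γ ^ q ^ n * evalEval (τx a) (τy b) D = evalEval (τx a) (τy b) N) ∧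
          ∀ γ ∈ hB.toFinset, evalEval (τx a) (τy b) (N - C (C (γ ^ q ^ n)) * D) ≠ 0) →
        PM k l Φ s s' (τs (c a b)) (c a b) →
        evalEval (τx a) (τy b) D ≠ 0 ∧
          τs (c a b) ^ q ^ n * evalEval (τx a) (τy b) D = evalEval (τx a) (τy b) N := by
      rintro a b ⟨ha0, ha⟩ ⟨hb0, hb⟩ ⟨⟨γ, j, hfl, hDne, he⟩, hNB⟩ hsm
      refine ⟨hDne, ?_⟩
      have hγ : γ ∉ hB.toFinset := by
        intro hmem
        apply hNB γ hmem
        rw [evalEval_sub, evalEval_mul, evalEval_C, eval_C, he, sub_self]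
      rw [PM.right_unique hq hs.cor hsm
        (hT.pm_of_fl H hx.cor hy.cor hs.cor hfl ha0 hb0 ha hb (hBmem _ hγ))]
      exact he
    constructor
    · refine (ha.and (tr (h.and hNB))).mono ?_
      rintro a ⟨ha, h⟩
      have hsm := (hT.inj a ha.1).tendsto_cofinite.eventually hs.pm
      exact (hb.and (h.and hsm)).mono fun b ⟨hb, h, hsm⟩ => main a b ha hb h hsm
    · have h' : ∀ᶠ b in cofinite, ∀ᶠ a in cofinite, _ :=
        ((hy.tendsto H).eventually (h.and hNB).swap.eventually).mono fun b h =>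
          (hx.tendsto H).eventually h
      refine (hb.and h').mono ?_
      rintro b ⟨hb, h⟩
      have hsm := (hT.inj' b hb.1).tendsto_cofinite.eventually hs.pm
      exact (ha.and (h.and hsm)).mono fun a ⟨ha, h, hsm⟩ => main a b ha hb h hsm

omit [ExpChar F p] [IsAlgClosed k] in
lemma Tri.add (hp : (p : ZMod ℓ) ≠ 0) {x y : F} (hy : PGen p k y) (h : Indep k x y) :
    Tri ℓ k x y (x + y) (· + ·) where
  indep := h
  indep' := by simpa using h.symm.add_smul (c := 1)
  inj a _ := add_right_injective a
  inj' b _ := add_left_injective b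
  eqn a b _ _ := by
    have hs : Transcendental k (x + y) := by
      have := h.symm.add_smul (c := 1)
      rw [map_one, one_mul] at this
      exact this.right
    have hs0 := sub_algebraMap_ne_zero hs (a + b)
    have hx0 := sub_algebraMap_ne_zero h.left a
    have hy0 := sub_algebraMap_ne_zero h.right b
    refine ⟨_, _, div_ne_zero hx0 hs0, div_ne_zero hy0 hs0, ?_, 1, one_mem _,
      ordc_one hp hy b, ?_, cls_div hy0 hs0⟩
    · rw [← add_div, div_eq_one_iff_eq hs0, map_add]
      ring
    · rw [cls_div hx0 hs0, mul_one]

omit [ExpChar F p] in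
lemma Tri.mul (hp : (p : ZMod ℓ) ≠ 0) {x y : F} (hy : PGen p k y) (h : Indep k x y) :
    Tri ℓ k x y (x * y) (· * ·) where
  indep := h
  indep' := by
    have hy0 : y ≠ 0 := by simpa using sub_algebraMap_ne_zero h.right 0
    have := h.symm.add_mul (zero_mem _) (mem_adjoin_simple_self k y) hy0
    rwa [zero_add, mul_comm] at this
  inj a ha := mul_right_injective₀ ha
  inj' b hb := mul_left_injective₀ hb
  eqn a b ha hb := by
    classical
    have hy00 : y ≠ 0 := by simpa using sub_algebraMap_ne_zero h.right 0
    have hs : Transcendental k (x * y) := by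
      have := h.symm.add_mul (zero_mem _) (mem_adjoin_simple_self k y) hy00
      rw [zero_add, mul_comm] at this
      exact this.right
    have hs0 := sub_algebraMap_ne_zero hs (a * b)
    have hx0 := sub_algebraMap_ne_zero h.left a
    have hy0 := sub_algebraMap_ne_zero h.right b
    have ha0 : algebraMap k F a ≠ 0 := by simpa using ha
    refine ⟨_, _, div_ne_zero (mul_ne_zero hx0 hy00) hs0, div_ne_zero (mul_ne_zero ha0 hy0) hs0,
      ?_, cls ℓ y, by simpa using cls_sub_mem_RA (ℓ := ℓ) (t := y) (0 : k), ?_, ?_, ?_⟩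
    · rw [← add_div, div_eq_one_iff_eq hs0, _root_.map_mul]
      ring
    · have := ordc_sub (ℓ := ℓ) hp hy b 0
      rwa [map_zero, sub_zero, if_neg hb] at this
    · rw [cls_div (mul_ne_zero hx0 hy00) hs0, cls_mul hx0 hy00]
    · rw [cls_div (mul_ne_zero ha0 hy0) hs0, cls_mul ha0 hy0,
        cls_algebraMap (Fact.out : ℓ.Prime).ne_zero, one_mul]

end Match

section Mobius

variable {l : Type*} [Field l]

lemma eq_C_mul_X_sub_C_pow [IsAlgClosed l] {T : l[X]} (hT : T ≠ 0) {z : l}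
    (h : ∀ w, T.eval w = 0 → w = z) :
    T = C T.leadingCoeff * (X - C z) ^ T.natDegree := by
  have hs : T.Splits := IsAlgClosed.splits T
  have hr : T.roots = Multiset.replicate T.natDegree z := by
    rw [hs.natDegree_eq_card_roots]
    refine Multiset.eq_replicate_card.2 fun w hw => h w ?_
    exact (mem_roots hT).1 hw
  conv_lhs => rw [hs.eq_prod_roots, hr]
  simp

lemma exists_expChar_pow_mul (q : ℕ) [ExpChar l q] {d : ℕ} (hd : d ≠ 0) :
    ∃ m d' : ℕ, d = q ^ m * d' ∧ (d' : l) ≠ 0 := by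
  rcases ‹ExpChar l q› with _ | hq
  · exact ⟨0, d, by simp, by exact_mod_cast hd⟩
  · obtain ⟨m, d', h, e⟩ := Nat.exists_eq_pow_mul_and_not_dvd hd q hq.ne_one
    exact ⟨m, d', e, fun h0 => h ((CharP.cast_eq_zero_iff l q d').1 h0)⟩

lemma X_sub_C_pow_expChar_mul (q : ℕ) [ExpChar l q] (m d' : ℕ) (z : l) :
    (X - C z) ^ (q ^ m * d') = expand l (q ^ m) ((X - C (z ^ q ^ m)) ^ d') := by
  rw [pow_mul, sub_pow_expChar_pow, map_pow]
  simp

lemma det_eq_zero_of_pencil {α β α₁ β₁ α₂ β₂ n m n' m' n'' m'' : l} (h : 1 = α * n'' + β * m'')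
    (h₁ : 1 = α₁ * n'' + β₁ * m'') (h₂ : 1 = α₂ * n'' + β₂ * m'') :
    (α * n + β * m - (α₁ * n + β₁ * m)) * (α₂ * n' + β₂ * m' - (α₁ * n' + β₁ * m')) -
      (α₂ * n + β₂ * m - (α₁ * n + β₁ * m)) * (α * n' + β * m' - (α₁ * n' + β₁ * m')) = 0 := by
  linear_combination
    -((α₁ * n + β₁ * m) * (α₂ * n' + β₂ * m') - (α₁ * n' + β₁ * m') * (α₂ * n + β₂ * m)) * h
    + ((α * n + β * m) * (α₂ * n' + β₂ * m') - (α * n' + β * m') * (α₂ * n + β₂ * m)) * h₁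
    - ((α * n + β * m) * (α₁ * n' + β₁ * m') - (α * n' + β * m') * (α₁ * n + β₁ * m)) * h₂

lemma exists_eq_pow_of_pencil [Infinite l] (q : ℕ) [ExpChar l q] {N D : l[X]} {d : ℕ}
    (hd : d ≠ 0) {Z : Set l} (hZ : Z.Infinite)
    (h : ∀ z ∈ Z, ∃ α β : l, (X - C z) ^ d = C α * N + C β * D) : ∃ m, d = q ^ m := by
  obtain ⟨m, d', e, hd'⟩ := exists_expChar_pow_mul (l := l) q hd
  refine ⟨m, ?_⟩
  by_contra hne
  have hQ : 0 < q ^ m := expChar_pow_pos l q m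
  have hd0 : d' ≠ 0 := by rintro rfl; simp at hd'
  have hd1 : d' ≠ 1 := by rintro rfl; simp at e; exact hne e
  have coeff_pow : ∀ (z : l) (n j : ℕ), ((X - C z) ^ n).coeff j = (-z) ^ (n - j) * n.choose j := by
    intro z n j
    rw [← coeff_X_add_C_pow, map_neg, sub_eq_add_neg]
  have c0 : ∀ z : l, ((X - C z) ^ d).coeff 0 = (-z) ^ d := fun z => by
    rw [coeff_pow]; simp
  have cd : ∀ z : l, ((X - C z) ^ d).coeff d = 1 := fun z => by
    rw [coeff_pow]; simp
  have cQ : ∀ z : l, ((X - C z) ^ d).coeff (q ^ m) = (-z ^ q ^ m) ^ (d' - 1) * d' := fun z => by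
    rw [e, X_sub_C_pow_expChar_mul]
    have := coeff_expand_mul' hQ ((X - C (z ^ q ^ m)) ^ d') 1
    rw [mul_one] at this
    rw [this, coeff_pow, Nat.choose_one_right]
  obtain ⟨z₁, hz₁⟩ := hZ.nonempty
  have hfin : {z : l | (-z) ^ d = (-z₁) ^ d}.Finite := by
    have hne : (X ^ d - C ((-z₁) ^ d) : l[X]) ≠ 0 := X_pow_sub_C_ne_zero (Nat.pos_of_ne_zero hd) _
    refine ((Polynomial.finite_setOfPred_isRoot hne).preimage neg_injective.injOn).subset
      fun z hz => ?_
    have hz' : (-z) ^ d = (-z₁) ^ d := hz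
    simp [hz']
  obtain ⟨z₂, hz₂, hz₂'⟩ := hZ.exists_notMem_finite hfin
  have hz12 : (-z₂) ^ d ≠ (-z₁) ^ d := hz₂'
  obtain ⟨α₁, β₁, e₁⟩ := h z₁ hz₁
  obtain ⟨α₂, β₂, e₂⟩ := h z₂ hz₂
  have hcoef : ∀ {z α β : l}, (X - C z) ^ d = C α * N + C β * D →
      (-z) ^ d = α * N.coeff 0 + β * D.coeff 0 ∧ 1 = α * N.coeff d + β * D.coeff d ∧
      (-z ^ q ^ m) ^ (d' - 1) * d' = α * N.coeff (q ^ m) + β * D.coeff (q ^ m) := by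
    intro z α β e
    refine ⟨?_, ?_, ?_⟩
    · rw [← c0, e, coeff_add, coeff_C_mul, coeff_C_mul]
    · rw [← cd z, e, coeff_add, coeff_C_mul, coeff_C_mul]
    · rw [← cQ, e, coeff_add, coeff_C_mul, coeff_C_mul]
  obtain ⟨B0, Bd, BQ⟩ := hcoef e₁
  obtain ⟨C0, Cd, CQ⟩ := hcoef e₂
  set P : l[X] := ((-X) ^ d - C ((-z₁) ^ d)) *
      C ((-z₂ ^ q ^ m) ^ (d' - 1) * d' - (-z₁ ^ q ^ m) ^ (d' - 1) * d') -
      C ((-z₂) ^ d - (-z₁) ^ d) *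
        ((-X ^ q ^ m) ^ (d' - 1) * C (d' : l) - C ((-z₁ ^ q ^ m) ^ (d' - 1) * d')) with hP
  have hP0 : P = 0 := by
    refine Polynomial.eq_zero_of_infinite_isRoot P (hZ.mono fun z hz => ?_)
    obtain ⟨α, β, e⟩ := h z hz
    obtain ⟨A0, Ad, AQ⟩ := hcoef e
    have : P.eval z = ((-z) ^ d - (-z₁) ^ d) *
        ((-z₂ ^ q ^ m) ^ (d' - 1) * d' - (-z₁ ^ q ^ m) ^ (d' - 1) * d') -
        ((-z₂) ^ d - (-z₁) ^ d) *
        ((-z ^ q ^ m) ^ (d' - 1) * d' - (-z₁ ^ q ^ m) ^ (d' - 1) * d') := by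
      simp [hP]
    rw [Set.mem_ofPred_eq, IsRoot.def, this, A0, B0, C0, AQ, BQ, CQ]
    exact det_eq_zero_of_pencil Ad Bd Cd
  have hj : P.coeff (q ^ m * (d' - 1)) = 0 := by rw [hP0, coeff_zero]
  have h1 : (q ^ m * (d' - 1)) ≠ 0 := mul_ne_zero hQ.ne' (by omega)
  have h2 : (q ^ m * (d' - 1)) ≠ d := by
    rw [e]
    intro h
    have := Nat.eq_of_mul_eq_mul_left hQ h
    omega
  rw [hP, neg_pow (X : l[X]), neg_pow (X ^ q ^ m : l[X]), ← pow_mul] at hj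
  have e1 : ∀ n : ℕ, (-1 : l[X]) ^ n = C ((-1) ^ n) := fun n => by simp
  rw [e1, e1, coeff_sub, coeff_mul_C, coeff_C_mul, coeff_sub, coeff_sub, coeff_mul_C, coeff_C_mul,
    coeff_C_mul, coeff_X_pow_self, coeff_C_of_ne_zero h1, coeff_C_of_ne_zero h1, coeff_X_pow,
    if_neg h2] at hj
  have : ((-z₂) ^ d - (-z₁) ^ d) * ((-1) ^ (d' - 1) * d') = 0 := by linear_combination -hj
  exact mul_ne_zero (sub_ne_zero.2 hz12) (mul_ne_zero (pow_ne_zero _ (by simp)) hd') this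

lemma exists_isCoprime_mul (N : l[X]) {D : l[X]} (hD : D ≠ 0) : ∃ N₁ D₁ g : l[X],
    IsCoprime N₁ D₁ ∧ N = g * N₁ ∧ D = g * D₁ := by
  classical
  let _ := EuclideanDomain.gcdMonoid l[X]
  exact ⟨_, _, gcd N D, isCoprime_div_gcd_div_gcd hD,
    (EuclideanDomain.mul_div_cancel' (gcd_ne_zero_of_right hD) (gcd_dvd_left N D)).symm,
    (EuclideanDomain.mul_div_cancel' (gcd_ne_zero_of_right hD) (gcd_dvd_right N D)).symm⟩

/-- A rational function that is injective away from finitely many points is a Möbius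
transformation composed with a power of Frobenius. -/
theorem mobius_of_injective [IsAlgClosed l] (q : ℕ) [ExpChar l q] (N D : l[X])
    (hN : ∃ S ∈ (cofinite : Filter l), (∀ z ∈ S, D.eval z ≠ 0) ∧
      ∀ z ∈ S, ∀ w ∈ S, N.eval z * D.eval w = N.eval w * D.eval z → z = w) :
    ∃ (m : ℕ) (A B C E : l), q ^ m ≤ max N.natDegree D.natDegree ∧ A * E - B * C ≠ 0 ∧
      ∀ᶠ z in cofinite, N.eval z * (C * z ^ q ^ m + E) = D.eval z * (A * z ^ q ^ m + B) := by
  have hinf : Infinite l := IsAlgClosed.instInfinite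
  wlog hco : IsCoprime N D generalizing N D with H
  · obtain ⟨S, hS, hD, hinj⟩ := hN
    have hD0 : D ≠ 0 := by
      rintro rfl
      obtain ⟨z, hz⟩ := (Filter.nonempty_of_mem hS : S.Nonempty)
      exact hD z hz eval_zero
    obtain ⟨N₁, D₁, g, hco₁, rfl, rfl⟩ : ∃ N₁ D₁ g : l[X],
        IsCoprime N₁ D₁ ∧ N = g * N₁ ∧ D = g * D₁ :=
      exists_isCoprime_mul N hD0
    have hg0 : g ≠ 0 := left_ne_zero_of_mul hD0
    obtain ⟨m, A, B, C', E, hm, hdet, h⟩ := H N₁ D₁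
      ⟨S, hS, fun z hz => right_ne_zero_of_mul (eval_mul (R := l) ▸ hD z hz), fun z hz w hw h =>
        hinj z hz w hw (by
          simp only [eval_mul]; linear_combination (g.eval z * g.eval w) * h)⟩ hco₁
    refine ⟨m, A, B, C', E, hm.trans (max_le_max ?_ ?_), hdet, h.mono fun z hz => ?_⟩
    · by_cases h0 : N₁ = 0
      · simp [h0]
      · rw [natDegree_mul hg0 h0]; omega
    · rw [natDegree_mul hg0 (right_ne_zero_of_mul hD0)]; omega
    · simp only [eval_mul]; linear_combination (g.eval z) * hz
  obtain ⟨S, hS, hD, hinj⟩ := hN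
  set T : l → l[X] := fun z => C (D.eval z) * N - C (N.eval z) * D with hT
  have hTeval : ∀ z w, (T z).eval w = D.eval z * N.eval w - N.eval z * D.eval w := fun z w => by
    simp [hT]
  have hSinf : S.Infinite := fun h => by
    have := (mem_cofinite.1 hS).union h
    rw [Set.compl_union_self] at this
    exact Set.infinite_univ this
  have hT0 : ∀ z ∈ S, T z ≠ 0 := by
    intro z hz h0
    obtain ⟨w, hw, hwz⟩ := hSinf.exists_notMem_finite (Set.finite_singleton z)
    have := hTeval z w
    rw [h0, eval_zero] at this
    exact hwz (hinj z hz w hw (by linear_combination this)).symm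
  have hroot : ∀ᶠ z in cofinite, ∀ w, (T z).eval w = 0 → w = z := by
    have h1 : ∀ᶠ z in cofinite, ∀ w ∈ Sᶜ, ¬ (z ∈ S ∧ (T z).eval w = 0) := by
      rw [eventually_all_finite (mem_cofinite.1 hS)]
      intro w _
      refine (Set.Subsingleton.finite (s := {z | z ∈ S ∧ (T z).eval w = 0}) ?_).eventually_cofinite_notMem
      rintro z ⟨hz, e⟩ z' ⟨hz', e'⟩
      rw [hTeval] at e e'
      refine hinj z hz z' hz' ?_
      obtain ⟨u, v, huv⟩ := hco
      have huv' := congrArg (eval w) huv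
      simp only [eval_add, eval_mul, eval_one] at huv'
      linear_combination (-(N.eval z * D.eval z' - N.eval z' * D.eval z)) * huv'
        + (- u.eval w * N.eval z' - v.eval w * D.eval z') * e
        + (u.eval w * N.eval z + v.eval w * D.eval z) * e'
    filter_upwards [h1, hS] with z h1 hz w hw
    by_cases hwS : w ∈ S
    · rw [hTeval] at hw
      exact (hinj z hz w hwS (by linear_combination -hw)).symm
    · exact absurd ⟨hz, hw⟩ (h1 w hwS)
  have hTdeg : ∀ z, (T z).natDegree ≤ max N.natDegree D.natDegree := fun z =>
    (natDegree_sub_le _ _).trans (max_le_max (natDegree_C_mul_le _ _) (natDegree_C_mul_le _ _))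
  have hev : ∀ᶠ z in cofinite, ∃ d ∈ Finset.range (max N.natDegree D.natDegree + 1),
      z ∈ S ∧ ∃ c, c ≠ 0 ∧ T z = C c * (X - C z) ^ d := by
    filter_upwards [hroot, hS] with z hz hzS
    exact ⟨_, Finset.mem_range.2 (Nat.lt_succ_of_le (hTdeg z)), hzS, _,
      leadingCoeff_ne_zero.2 (hT0 z hzS), eq_C_mul_X_sub_C_pow (hT0 z hzS) hz⟩
  obtain ⟨d, hdle, hdinf⟩ : ∃ d ∈ Finset.range (max N.natDegree D.natDegree + 1),
      {z | z ∈ S ∧ ∃ c, c ≠ 0 ∧ T z = C c * (X - C z) ^ d}.Infinite := by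
    by_contra hcon
    push Not at hcon
    have h2 : ∀ᶠ z in cofinite, ∀ d ∈ Finset.range (max N.natDegree D.natDegree + 1),
        ¬ (z ∈ S ∧ ∃ c, c ≠ 0 ∧ T z = C c * (X - C z) ^ d) := by
      rw [eventually_all_finset]
      exact fun d hd => (hcon d hd).eventually_cofinite_notMem
    obtain ⟨z, ⟨d, hd, h⟩, h2⟩ := (hev.and h2).exists
    exact h2 d hd h
  have hdle' : d ≤ max N.natDegree D.natDegree := Nat.lt_succ_iff.1 (Finset.mem_range.1 hdle)
  obtain ⟨z₁, hz₁, c₁, hc₁, e₁⟩ := hdinf.nonempty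
  obtain ⟨z₂, ⟨hz₂, c₂, hc₂, e₂⟩, hz12⟩ := hdinf.exists_notMem_finite (Set.finite_singleton z₁)
  have hz12' : z₂ ≠ z₁ := hz12
  have hd0 : d ≠ 0 := by
    rintro rfl
    have := hTeval z₁ z₁
    rw [e₁] at this
    simp [mul_comm] at this
    exact hc₁ this
  obtain ⟨m, rfl⟩ := exists_eq_pow_of_pencil q (N := N) (D := D) hd0 hdinf (by
    rintro z ⟨hz, c, hc, e⟩
    refine ⟨c⁻¹ * D.eval z, -(c⁻¹ * N.eval z), ?_⟩
    have : C c⁻¹ * T z = (X - C z) ^ d := by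
      rw [e, ← mul_assoc, ← C_mul, inv_mul_cancel₀ hc, C_1, one_mul]
    rw [← this, hT]
    simp only [C_mul, C_neg]
    ring)
  have hT' : ∀ {z c : l}, T z = C c * (X - C z) ^ q ^ m → ∀ w,
      D.eval z * N.eval w - N.eval z * D.eval w = c * (w ^ q ^ m - z ^ q ^ m) := by
    intro z c e w
    rw [← hTeval, e]
    simp [sub_pow_expChar_pow]
  have E₁ := hT' e₁
  have E₂ := hT' e₂
  set Δ := N.eval z₁ * D.eval z₂ - N.eval z₂ * D.eval z₁ with hΔ
  have hΔ0 : Δ ≠ 0 := fun h => hz12' (hinj z₁ hz₁ z₂ hz₂ (sub_eq_zero.1 h)).symm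
  refine ⟨m, N.eval z₁ * c₂ - N.eval z₂ * c₁, -(N.eval z₁ * c₂ * z₂ ^ q ^ m) + N.eval z₂ * c₁ * z₁ ^ q ^ m,
    D.eval z₁ * c₂ - D.eval z₂ * c₁, -(D.eval z₁ * c₂ * z₂ ^ q ^ m) + D.eval z₂ * c₁ * z₁ ^ q ^ m,
    hdle', ?_, Filter.Eventually.of_forall fun z => ?_⟩
  · have : (N.eval z₁ * c₂ - N.eval z₂ * c₁) * (-(D.eval z₁ * c₂ * z₂ ^ q ^ m) + D.eval z₂ * c₁ * z₁ ^ q ^ m)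
        - (-(N.eval z₁ * c₂ * z₂ ^ q ^ m) + N.eval z₂ * c₁ * z₁ ^ q ^ m) * (D.eval z₁ * c₂ - D.eval z₂ * c₁)
        = -(c₁ * c₂ * Δ * (z₂ - z₁) ^ q ^ m) := by
      rw [sub_pow_expChar_pow, hΔ]; ring
    rw [this]
    exact neg_ne_zero.2 (mul_ne_zero (mul_ne_zero (mul_ne_zero hc₁ hc₂) hΔ0)
      (pow_ne_zero _ (sub_ne_zero.2 hz12')))
  · linear_combination (-(N.eval z * D.eval z₁) + D.eval z * N.eval z₁) * E₂ z + (N.eval z * D.eval z₂ - D.eval z * N.eval z₂) * E₁ z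

end Mobius

section Mob

variable {k l : Type*} [Field l]

/-- The functions `u` and `v` differ by a Möbius transformation, up to finitely many points. -/
def Mob (u v : k → l) : Prop := ∃ A B C E : l, A * E - B * C ≠ 0 ∧
  ∀ᶠ b in cofinite, v b * (C * u b + E) = A * u b + B

lemma Mob.congr {u v u' v' : k → l} (h : Mob u v) (hu : u =ᶠ[cofinite] u')
    (hv : v =ᶠ[cofinite] v') : Mob u' v' := by
  obtain ⟨A, B, C, E, hd, h⟩ := h
  refine ⟨A, B, C, E, hd, ?_⟩
  filter_upwards [h, hu, hv] with b h hu hv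
  rwa [← hu, ← hv]

lemma Mob.of_affine {u v : k → l} {A B : l} (hA : A ≠ 0)
    (h : ∀ᶠ b in cofinite, v b = A * u b + B) : Mob u v :=
  ⟨A, B, 0, 1, by simpa using hA, h.mono fun b h => by rw [h]; ring⟩

lemma Mob.refl (u : k → l) : Mob u u := .of_affine one_ne_zero (B := 0) (.of_forall fun b => by ring)

lemma Mob.symm {u v : k → l} (h : Mob u v) : Mob v u := by
  obtain ⟨A, B, C, E, hd, h⟩ := h
  exact ⟨E, -B, -C, A, by convert! hd using 1; ring, h.mono fun b h => by linear_combination -h⟩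

lemma Mob.trans {u v w : k → l} (h : Mob u v) (h' : Mob v w) : Mob u w := by
  obtain ⟨A, B, C, E, hd, h⟩ := h
  obtain ⟨A', B', C', E', hd', h'⟩ := h'
  refine ⟨A' * A + B' * C, A' * B + B' * E, C' * A + E' * C, C' * B + E' * E, ?_, ?_⟩
  · convert! mul_ne_zero hd hd' using 1
    ring
  · filter_upwards [h, h'] with b h h'
    linear_combination (C * u b + E) * h' + (A' - w b * C') * h

lemma Mob.comp {u v : k → l} (h : Mob u v) {σ : k → k} (hσ : Function.Injective σ) :
    Mob (u ∘ σ) (v ∘ σ) := by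
  obtain ⟨A, B, C, E, hd, h⟩ := h
  exact ⟨A, B, C, E, hd, hσ.tendsto_cofinite.eventually h⟩

variable {q : ℕ} [ExpChar l q]

lemma Mob.of_pow [PerfectRing l q] {u v : k → l} {m : ℕ}
    (h : Mob (fun b => u b ^ q ^ m) (fun b => v b ^ q ^ m)) : Mob u v := by
  obtain ⟨A, B, C, E, hd, h⟩ := h
  have hinj := iterateFrobenius_inj l q m
  have hsurj : ∀ a : l, ∃ a', a' ^ q ^ m = a := (bijective_iterateFrobenius l q m).2
  obtain ⟨A, rfl⟩ := hsurj A
  obtain ⟨B, rfl⟩ := hsurj B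
  obtain ⟨C, rfl⟩ := hsurj C
  obtain ⟨E, rfl⟩ := hsurj E
  refine ⟨A, B, C, E, ?_, h.mono fun b h => hinj ?_⟩
  · simp only [← mul_pow, ← sub_pow_expChar_pow] at hd
    exact pow_ne_zero_iff (expChar_pow_pos l q m).ne' |>.1 hd
  · simpa only [iterateFrobenius_def, ← mul_pow, ← add_pow_expChar_pow] using h

lemma quad_eq_zero [Infinite k] {f : k → l} (hf : Tendsto f cofinite cofinite) {r s t : l}
    (h : ∀ᶠ b in cofinite, r * f b ^ 2 + s * f b + t = 0) : r = 0 ∧ s = 0 ∧ t = 0 := by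
  set P : l[X] := C r * X ^ 2 + C s * X + C t with hP
  have hP0 : P = 0 := by
    by_contra hne
    have h1 : ∀ᶠ z in (cofinite : Filter l), ¬ P.IsRoot z :=
      (Polynomial.finite_setOfPred_isRoot hne).eventually_cofinite_notMem
    obtain ⟨b, hb, hb'⟩ := (h.and (hf.eventually h1)).exists
    exact hb' (by simpa [hP, IsRoot.def] using hb)
  refine ⟨?_, ?_, ?_⟩
  · simpa [hP] using congrArg (coeff · 2) hP0
  · simpa [hP] using congrArg (coeff · 1) hP0
  · simpa [hP] using congrArg (coeff · 0) hP0

lemma finiteIndex_of_coloring {A : Type*} [Group A] (H : Subgroup A) {S : Set A} (hS : Sᶜ.Finite)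
    (P : A → ℕ → Prop) (W : ℕ) (h : ∀ a ∈ S, ∃ m ≤ W, P a m)
    (hP : ∀ a a' m, P a m → P a' m → a⁻¹ * a' ∈ H) : H.FiniteIndex := by
  have hfin : (Set.univ : Set (A ⧸ H)).Finite := by
    refine ((hS.image (QuotientGroup.mk : A → A ⧸ H)).union
      ((Set.finite_Iic W).biUnion (t := fun m => QuotientGroup.mk '' {a | P a m}) fun m _ => ?_)).subset ?_
    · refine Set.Subsingleton.finite ?_
      rintro _ ⟨a, ha, rfl⟩ _ ⟨a', ha', rfl⟩
      exact QuotientGroup.eq.2 (hP a a' m ha ha')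
    · rintro x -
      obtain ⟨a, rfl⟩ := QuotientGroup.mk_surjective x
      by_cases ha : a ∈ S
      · obtain ⟨m, hm, hm'⟩ := h a ha
        exact Or.inr (Set.mem_biUnion (Set.mem_Iic.2 hm) ⟨a, hm', rfl⟩)
      · exact Or.inl ⟨a, ha, rfl⟩
  have : Finite (A ⧸ H) := Set.finite_univ_iff.1 hfin
  exact Subgroup.finiteIndex_of_finite_quotient

end Mob

section TriMob

variable {ℓ : ℕ} [Fact ℓ.Prime] {k F : Type*} [Field k] [Field F] [Algebra k F]
  {l G : Type*} [Field l] [Field G] [Algebra l G] {p q : ℕ} {Φ : Cl ℓ F ≃* Cl ℓ G}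
  [IsAlgClosed k] [IsAlgClosed l] [ExpChar F p] [ExpChar G q]

lemma Tri.exists_mob (H : Compat p q k l Φ) {x y s : F} {c : k → k → k}
    (hT : Tri ℓ k x y s c) {x' y' s' : G} {τx τy τs : k → l} (hx : Match p q Φ τx x x')
    (hy : Match p q Φ τy y y') (hs : Match p q Φ τs s s') :
    ∃ n W : ℕ, ∀ᶠ a in cofinite, ∃ Q ≤ W, (∃ m, Q = q ^ m) ∧
      Mob (fun b => τy b ^ Q) (fun b => τs (c a b) ^ q ^ n) := by
  have : Infinite k := IsAlgClosed.instInfinite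
  have hlq : ExpChar l q := (algebraMap l G).expChar (algebraMap l G).injective q
  obtain ⟨n, N, D, -, -, h, -⟩ := hT.exists_relation H hx hy hs
  obtain ⟨S, hS, hinj⟩ := hs.exists_injOn H
  refine ⟨n, max N.natDegree D.natDegree, ?_⟩
  filter_upwards [h, (Set.finite_singleton (0 : k)).eventually_cofinite_notMem] with a h ha0
  have hinj' := hT.inj a ha0
  have hgood := h.and (hinj'.tendsto_cofinite.eventually hS)
  set N₁ := N.map (evalRingHom (τx a)) with hN₁
  set D₁ := D.map (evalRingHom (τx a)) with hD₁
  have eN : ∀ z, N₁.eval z = evalEval (τx a) z N := fun z => map_evalRingHom_eval _ _ _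
  have eD : ∀ z, D₁.eval z = evalEval (τx a) z D := fun z => map_evalRingHom_eval _ _ _
  obtain ⟨m, A, B, C, E, hm, hdet, hM⟩ := mobius_of_injective q N₁ D₁ (by
    refine ⟨_, hy.eventually_of H (P := fun β => ∃ b, τy b = β ∧
      (evalEval (τx a) (τy b) D ≠ 0 ∧
        τs (c a b) ^ q ^ n * evalEval (τx a) (τy b) D = evalEval (τx a) (τy b) N) ∧ c a b ∈ S)
      (hgood.mono fun b hb => ⟨b, rfl, hb⟩), ?_, ?_⟩
    · rintro _ ⟨b, rfl, ⟨hb, -⟩, -⟩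
      rwa [eD]
    · rintro _ ⟨b, rfl, ⟨hb, e⟩, hbS⟩ _ ⟨b', rfl, ⟨hb', e'⟩, hbS'⟩ h
      rw [eN, eN, eD, eD, ← e, ← e'] at h
      have h1 : τs (c a b) ^ q ^ n = τs (c a b') ^ q ^ n := by
        refine mul_right_cancel₀ (mul_ne_zero hb hb') ?_
        linear_combination h
      rw [hinj' (hinj hbS hbS' (iterateFrobenius_inj l q n h1))])
  refine ⟨q ^ m, hm.trans (max_le_max (natDegree_map_le) (natDegree_map_le)), ⟨m, rfl⟩,
    A, B, C, E, hdet, ?_⟩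
  filter_upwards [h, (hy.tendsto H).eventually hM] with b ⟨hb, e⟩ hM
  rw [eN, eD, ← e] at hM
  refine mul_right_cancel₀ hb ?_
  linear_combination hM

end TriMob

section Reconstruction

variable {k l : Type*} [Field k] [Field l]

/-- The permutations of `k` that `f` transports to Möbius transformations. -/
def mobGroup (f : k → l) : Subgroup (Equiv.Perm k) where
  carrier := {σ | Mob f (f ∘ σ)}
  mul_mem' {σ ρ} hσ hρ := hρ.trans (Mob.comp hσ ρ.injective)
  one_mem' := Mob.refl f
  inv_mem' {σ} hσ := by
    have := (Mob.comp hσ (σ⁻¹ : Equiv.Perm k).injective).symm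
    simpa [Function.comp_assoc] using this

omit [Field k] in
lemma mem_mobGroup {f : k → l} {σ : Equiv.Perm k} : σ ∈ mobGroup f ↔ Mob f (f ∘ σ) := Iff.rfl

omit [Field k] in
lemma mem_mobGroup_of_coset {q : ℕ} [ExpChar l q] [PerfectRing l q] {f g : k → l} {m : ℕ}
    {σ ρ : Equiv.Perm k} (hσ : Mob (fun b => f b ^ q ^ m) (g ∘ σ))
    (hρ : Mob (fun b => f b ^ q ^ m) (g ∘ ρ)) : σ⁻¹ * ρ ∈ mobGroup f := by
  have h := Mob.comp hσ (σ⁻¹ * ρ).injective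
  have e : (g ∘ σ) ∘ ⇑(σ⁻¹ * ρ) = g ∘ ρ := by ext b; simp
  rw [e] at h
  exact Mob.of_pow (q := q) (m := m) (hρ.trans h.symm)

omit [Field k] in
lemma Mob.exists_injOn {u v : k → l} (h : Mob u v) (hu : ∃ S ∈ (cofinite : Filter k), Set.InjOn u S) :
    ∃ S ∈ (cofinite : Filter k), Set.InjOn v S := by
  obtain ⟨S, hS, hinj⟩ := hu
  obtain ⟨A, B, C, E, hd, h⟩ := h
  refine ⟨_, inter_mem hS h, fun b hb b' hb' e => hinj hb.1 hb'.1 ?_⟩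
  have h1 : v b * (C * u b + E) = A * u b + B := hb.2
  have h2 : v b' * (C * u b' + E) = A * u b' + B := hb'.2
  rw [← e] at h2
  by_contra hne
  have hne' := sub_ne_zero.2 hne
  have e1 : A = v b * C := mul_right_cancel₀ hne' (by linear_combination h2 - h1)
  refine hd ?_
  rw [e1] at h1 ⊢
  linear_combination C * h1

lemma mobGroup_mulLeft_mem [IsAlgClosed k] {q : ℕ} [ExpChar l q] [PerfectRing l q] {f g : k → l}
    {W : ℕ} (h : ∀ᶠ a in cofinite, ∃ Q ≤ W, (∃ m, Q = q ^ m) ∧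
      Mob (fun b => f b ^ Q) (fun b => g (a * b))) (c : kˣ) :
    MulAction.toPermHom kˣ k c ∈ mobGroup f := by
  have hfi : ((mobGroup f).comap (MulAction.toPermHom kˣ k)).FiniteIndex := by
    refine finiteIndex_of_coloring _ (mem_cofinite.1 (Units.val_injective.tendsto_cofinite.eventually h))
      (fun a Q => (∃ m, Q = q ^ m) ∧ Mob (fun b => f b ^ Q) (fun b => g ((a : k) * b))) W
      (fun a ha => ha) ?_
    rintro a a' _ ⟨⟨m, rfl⟩, h1⟩ ⟨-, h2⟩
    rw [Subgroup.mem_comap, _root_.map_mul, map_inv]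
    exact mem_mobGroup_of_coset (σ := MulAction.toPermHom kˣ k a) (ρ := MulAction.toPermHom kˣ k a')
      h1 h2
  obtain ⟨d, hd⟩ := IsAlgClosed.exists_pow_nat_eq (c : k) (Nat.pos_of_ne_zero hfi.index_ne_zero)
  have hd0 : d ≠ 0 := by
    rintro rfl
    rw [zero_pow hfi.index_ne_zero] at hd
    exact c.ne_zero hd.symm
  have : c = Units.mk0 d hd0 ^ _ := Units.ext (by simpa using hd.symm)
  rw [this]
  exact Subgroup.pow_index_mem ((mobGroup f).comap (MulAction.toPermHom kˣ k)) (Units.mk0 d hd0)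

lemma mobGroup_addLeft_mem [Infinite k] {q : ℕ} [ExpChar l q] [PerfectRing l q] {f g : k → l}
    {W : ℕ} (h : ∀ᶠ a in cofinite, ∃ Q ≤ W, (∃ m, Q = q ^ m) ∧
      Mob (fun b => f b ^ Q) (fun b => g (a + b)))
    (hmul : ∀ c : kˣ, MulAction.toPermHom kˣ k c ∈ mobGroup f) (a : k) :
    Equiv.addLeft a ∈ mobGroup f := by
  obtain ⟨Q, -, hQ⟩ : ∃ Q ∈ Finset.range (W + 1), {a | (∃ m, Q = q ^ m) ∧
      Mob (fun b => f b ^ Q) (fun b => g (a + b))}.Infinite := by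
    by_contra hcon
    push Not at hcon
    have h2 : ∀ᶠ a in cofinite, ∀ Q ∈ Finset.range (W + 1), ¬ ((∃ m, Q = q ^ m) ∧
      Mob (fun b => f b ^ Q) (fun b => g (a + b))) := by
      rw [eventually_all_finset]
      exact fun d hd => (hcon d hd).eventually_cofinite_notMem
    obtain ⟨a, ⟨Q, hQ, h⟩, h2⟩ := (h.and h2).exists
    exact h2 Q (Finset.mem_range.2 (Nat.lt_succ_of_le hQ)) h
  obtain ⟨a₁, ⟨m, rfl⟩, h₁⟩ := hQ.nonempty
  obtain ⟨a₂, ⟨-, h₂⟩, hne⟩ := hQ.exists_notMem_finite (Set.finite_singleton a₁)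
  have hne' : a₂ - a₁ ≠ 0 := sub_ne_zero.2 hne
  have hd : Equiv.addLeft (a₂ - a₁) ∈ mobGroup f := by
    have := mem_mobGroup_of_coset (σ := Equiv.addLeft a₁) (ρ := Equiv.addLeft a₂) h₁ h₂
    convert! this using 1
    ext b
    simp [sub_eq_add_neg]
    ring
  by_cases ha : a = 0
  · subst ha
    convert! (mobGroup f).one_mem using 1
    ext b
    simp
  · let c : kˣ := Units.mk0 (a / (a₂ - a₁)) (div_ne_zero ha hne')
    have := mul_mem (mul_mem (hmul c) hd) (inv_mem (hmul c))
    convert! this using 1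
    ext b
    rw [← map_inv]
    simp only [Equiv.coe_addLeft, Equiv.Perm.coe_mul, Function.comp_apply,
      MulAction.toPermHom_apply, MulAction.toPerm_apply, smul_add, smul_inv_smul]
    congr 1
    simp only [c, Units.smul_def, Units.val_mk0, smul_eq_mul]
    field_simp

end Reconstruction

section Reconstruction

variable {k l : Type*} [Field k] [Field l]

/-- Both the translations and the dilations of `k` act through `f` by Möbius transformations. -/
structure AffMob (f : k → l) : Prop where
  inj : ∃ S ∈ (cofinite : Filter k), Set.InjOn f S
  add : ∀ a, Mob f fun b => f (b + a)
  mul : ∀ c, c ≠ 0 → Mob f fun b => f (c * b)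

lemma AffMob.of_mob {f g : k → l} (hf : AffMob f) (h : Mob f g) : AffMob g where
  inj := h.exists_injOn hf.inj
  add a := (h.symm.trans (hf.add a)).trans (h.comp (add_left_injective a))
  mul c hc := (h.symm.trans (hf.mul c hc)).trans (h.comp (mul_right_injective₀ hc))

lemma AffMob.tendsto {f : k → l} (hf : AffMob f) : Tendsto f cofinite cofinite := by
  obtain ⟨S, hS, h⟩ := hf.inj
  exact tendsto_cofinite_of_injOn hS h

lemma AffMob.eventually_ne {f : k → l} (hf : AffMob f) (w : l) : ∀ᶠ b in cofinite, f b ≠ w :=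
  hf.tendsto.eventually (Set.finite_singleton w).eventually_cofinite_notMem

lemma eventually_add {P : k → Prop} (h : ∀ᶠ b in cofinite, P b) (a : k) :
    ∀ᶠ b in cofinite, P (b + a) :=
  (add_left_injective a).tendsto_cofinite.eventually h

lemma eventually_mul {P : k → Prop} (h : ∀ᶠ b in cofinite, P b) {c : k} (hc : c ≠ 0) :
    ∀ᶠ b in cofinite, P (c * b) :=
  (mul_right_injective₀ hc).tendsto_cofinite.eventually h

variable [Infinite k]

lemma AffMob.eq_of_eventually_eq {f : k → l} (hf : AffMob f) {a c : k}
    (h : ∀ᶠ b in cofinite, f (b + a) = f (b + c)) : a = c := by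
  obtain ⟨S, hS, hinj⟩ := hf.inj
  obtain ⟨b, ⟨h1, h2⟩, h3⟩ := ((eventually_add hS a |>.and (eventually_add hS c)).and h).exists
  exact add_left_cancel (hinj h1 h2 h3)

lemma AffMob.diag_or_anti {f : k → l} (hf : AffMob f) {u : l} (hu0 : u ≠ 0) (hu : u ≠ 1)
    (h1 : ∀ᶠ b in cofinite, f (b + 1) = u * f b) (a : k) :
    (∃ r, ∀ᶠ b in cofinite, f (b + a) = r * f b) ∨
      ∃ r, ∀ᶠ b in cofinite, f (b + a) * f b = r := by
  obtain ⟨A, B, C, E, hd, h⟩ := hf.add a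
  obtain ⟨hr, -, ht⟩ := quad_eq_zero hf.tendsto (r := u * (u - 1) * (A * C))
    (s := (u ^ 2 - 1) * (B * C)) (t := (u - 1) * (B * E)) (by
      filter_upwards [h, eventually_add h 1, h1, eventually_add h1 a] with b h h' h1 h1'
      rw [add_right_comm, h1', h1] at h'
      linear_combination (C * f b + E) * h' - u * (C * u * f b + E) * h)
  have hu' := sub_ne_zero.2 hu
  have hAC : A * C = 0 := by simpa [hu0, hu'] using hr
  have hBE : B * E = 0 := by simpa [hu'] using ht
  rcases mul_eq_zero.1 hAC with rfl | rfl
  · have hB : B ≠ 0 := by rintro rfl; simp at hd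
    have hC : C ≠ 0 := by rintro rfl; simp at hd
    obtain rfl : E = 0 := by simpa [hB] using hBE
    refine Or.inr ⟨B / C, h.mono fun b h => ?_⟩
    rw [eq_div_iff hC]
    linear_combination h
  · have hE : E ≠ 0 := by rintro rfl; simp at hd
    obtain rfl : B = 0 := by simpa [hE] using hBE
    refine Or.inl ⟨A / E, h.mono fun b h => ?_⟩
    field_simp
    linear_combination h

lemma AffMob.eq_or_eq_of_diag {f : k → l} (hf : AffMob f) {u : l} (hu0 : u ≠ 0)
    (h1 : ∀ᶠ b in cofinite, f (b + 1) = u * f b) {c : k} (hc : c ≠ 0) {r : l}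
    (hr : ∀ᶠ b in cofinite, f (b + c) = r * f b) : c = 1 ∨ c = -1 := by
  obtain ⟨A, B, C, E, hd, h⟩ := hf.mul c hc
  have hr1 : r ≠ 1 := by
    rintro rfl
    refine hc (hf.eq_of_eventually_eq (a := c) (c := 0) (hr.mono fun b h => ?_))
    rw [h, one_mul, add_zero]
  obtain ⟨e2, e1, e0⟩ := quad_eq_zero hf.tendsto (r := u * (r - 1) * (A * C))
    (s := r * (A * E + u * (B * C)) - (u * (A * E) + B * C)) (t := (r - 1) * (B * E)) (by
      filter_upwards [h, eventually_add h 1, h1, eventually_mul hr hc] with b h h' h1 hr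
      rw [mul_add c b 1, mul_one, hr, h1] at h'
      linear_combination (C * f b + E) * h' - r * (C * u * f b + E) * h)
  have hr1' := sub_ne_zero.2 hr1
  have hAC : A * C = 0 := by simpa [hu0, hr1'] using e2
  have hBE : B * E = 0 := by simpa [hr1'] using e0
  rcases mul_eq_zero.1 hAC with rfl | rfl
  · have hB : B ≠ 0 := by rintro rfl; simp at hd
    have hC : C ≠ 0 := by rintro rfl; simp at hd
    obtain rfl : E = 0 := by simpa [hB] using hBE
    have hru : r * u = 1 := by
      refine mul_right_cancel₀ (mul_ne_zero hB hC) ?_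
      linear_combination e1
    right
    have : 1 + c = 0 := hf.eq_of_eventually_eq (a := 1 + c) (c := 0) (by
      filter_upwards [h1, eventually_add hr 1] with b h1 hr
      rw [← add_assoc, hr, h1, ← mul_assoc, hru, one_mul, add_zero])
    linear_combination this
  · have hA : A ≠ 0 := by rintro rfl; simp at hd
    have hE : E ≠ 0 := by rintro rfl; simp at hd
    have hru : r = u := by
      refine mul_right_cancel₀ (mul_ne_zero hA hE) ?_
      linear_combination e1
    left
    exact hf.eq_of_eventually_eq (by
      filter_upwards [h1, hr] with b h1 hr
      rw [h1, hr, hru])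

lemma AffMob.not_diag {f : k → l} (hf : AffMob f) {u : l} (hu0 : u ≠ 0) (hu : u ≠ 1)
    (h1 : ∀ᶠ b in cofinite, f (b + 1) = u * f b) : False := by
  have hD : ∀ c r, (∀ᶠ b in cofinite, f (b + c) = r * f b) → c ∈ ({0, 1, -1} : Set k) := by
    intro c r hr
    by_cases hc : c = 0
    · simp [hc]
    · rcases hf.eq_or_eq_of_diag hu0 h1 hc hr with rfl | rfl <;> simp
  have hfin : ({0, 1, -1} : Set k).Finite := by simp
  by_cases hanti : ∃ a r, ∀ᶠ b in cofinite, f (b + a) * f b = r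
  · obtain ⟨a, r, h⟩ := hanti
    refine Set.infinite_univ ((hfin.union (hfin.image (· + a))).subset fun c _ => ?_)
    rcases hf.diag_or_anti hu0 hu h1 c with ⟨r', h'⟩ | ⟨r', h'⟩
    · exact Or.inl (hD c r' h')
    · refine Or.inr ⟨c - a, hD (c - a) (r' / r) ?_, sub_add_cancel _ _⟩
      filter_upwards [eventually_add h (-a), eventually_add h' (-a), hf.eventually_ne 0,
        eventually_add (hf.eventually_ne 0) (-a)] with b h h' hb hb'
      rw [neg_add_cancel_right] at h
      have e : b + -a + c = b + (c - a) := by ring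
      rw [e] at h'
      rw [← h, ← h']
      field_simp
  · refine Set.infinite_univ (hfin.subset fun c _ => ?_)
    rcases hf.diag_or_anti hu0 hu h1 c with ⟨r', h'⟩ | h'
    · exact hD c r' h'
    · exact absurd ⟨c, h'⟩ hanti

lemma AffMob.exists_add {f : k → l} (hf : AffMob f)
    (h1 : ∀ᶠ b in cofinite, f (b + 1) = f b + 1) (a : k) :
    ∃ t, ∀ᶠ b in cofinite, f (b + a) = f b + t := by
  obtain ⟨A, B, C, E, hd, h⟩ := hf.add a
  obtain ⟨e2, e1, -⟩ := quad_eq_zero hf.tendsto (r := -C ^ 2)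
    (s := -C ^ 2 - 2 * (C * E)) (t := A * E - B * C - C * E - E ^ 2) (by
      filter_upwards [h, eventually_add h 1, h1, eventually_add h1 a] with b h h' h1 h1'
      rw [add_right_comm, h1', h1] at h'
      linear_combination (C * (f b + 1) + E) * h - (C * f b + E) * h')
  obtain rfl : C = 0 := by simpa using e2
  obtain ⟨-, -, e0⟩ := quad_eq_zero hf.tendsto (r := 0) (s := 0) (t := A * E - E ^ 2) (by
      filter_upwards [h, eventually_add h 1, h1, eventually_add h1 a] with b h h' h1 h1'
      rw [add_right_comm, h1', h1] at h'
      linear_combination E * h - E * h')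
  have hE : E ≠ 0 := by rintro rfl; simp at hd
  obtain rfl : A = E := mul_right_cancel₀ hE (by linear_combination e0)
  refine ⟨B / A, h.mono fun b h => ?_⟩
  field_simp
  linear_combination h

lemma AffMob.exists_mul {f : k → l} (hf : AffMob f)
    (h1 : ∀ᶠ b in cofinite, f (b + 1) = f b + 1) {c : k} (hc : c ≠ 0) {t : l} (ht0 : t ≠ 0)
    (ht : ∀ᶠ b in cofinite, f (b + c) = f b + t) :
    ∃ s, ∀ᶠ b in cofinite, f (c * b) = t * f b + s := by
  obtain ⟨A, B, C, E, hd, h⟩ := hf.mul c hc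
  obtain ⟨e2, -, -⟩ := quad_eq_zero hf.tendsto (r := -t * C ^ 2)
    (s := -t * (C ^ 2 + 2 * (C * E))) (t := A * E - B * C - t * (C * E) - t * E ^ 2) (by
      filter_upwards [h, eventually_add h 1, h1, eventually_mul ht hc] with b h h' h1 h1'
      rw [mul_add c b 1, mul_one, h1', h1] at h'
      linear_combination (C * (f b + 1) + E) * h - (C * f b + E) * h')
  obtain rfl : C = 0 := by simpa [ht0] using e2
  obtain ⟨-, -, e0⟩ := quad_eq_zero hf.tendsto (r := 0) (s := 0) (t := A * E - t * E ^ 2) (by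
      filter_upwards [h, eventually_add h 1, h1, eventually_mul ht hc] with b h h' h1 h1'
      rw [mul_add c b 1, mul_one, h1', h1] at h'
      linear_combination E * h - E * h')
  have hE : E ≠ 0 := by rintro rfl; simp at hd
  obtain rfl : A = t * E := mul_right_cancel₀ hE (by linear_combination e0)
  refine ⟨B / E, h.mono fun b h => ?_⟩
  field_simp
  linear_combination h

lemma AffMob.exists_ringHom_of_add_one {f : k → l} (hf : AffMob f)
    (h1 : ∀ᶠ b in cofinite, f (b + 1) = f b + 1) :
    ∃ τ : k →+* l, ∀ a, ∀ᶠ b in cofinite, f (b + a) = f b + τ a := by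
  choose τ hτ using hf.exists_add h1
  have huniq : ∀ a t, (∀ᶠ b in cofinite, f (b + a) = f b + t) → τ a = t := by
    intro a t h
    obtain ⟨b, h, h'⟩ := (h.and (hτ a)).exists
    exact add_left_cancel (h'.symm.trans h)
  have h0 : τ 0 = 0 := huniq 0 0 (.of_forall fun b => by simp)
  have hinj : ∀ a, a ≠ 0 → τ a ≠ 0 := fun a ha h => ha (hf.eq_of_eventually_eq (c := 0) (by
    filter_upwards [hτ a] with b hb
    rw [hb, h, add_zero, add_zero]))
  have hadd : ∀ a c, τ (a + c) = τ a + τ c := ?_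
  have hmul : ∀ a c, τ (a * c) = τ a * τ c := ?_
  · exact ⟨⟨⟨⟨τ, huniq 1 1 h1⟩, hmul⟩, h0, hadd⟩, hτ⟩
  · intro a c
    by_cases ha : a = 0
    · simp [ha, h0]
    obtain ⟨s, hs⟩ := hf.exists_mul h1 ha (hinj a ha) (hτ a)
    refine huniq _ _ ?_
    have := (mul_right_injective₀ (inv_ne_zero ha)).tendsto_cofinite.eventually
      (hs.and (eventually_add hs c |>.and (hτ c)))
    filter_upwards [this] with b ⟨e1, e2, e3⟩
    rw [mul_inv_cancel_left₀ ha] at e1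
    rw [mul_add, mul_inv_cancel_left₀ ha, e3] at e2
    rw [e1, e2]
    ring
  · intro a c
    refine huniq _ _ ?_
    filter_upwards [hτ a, eventually_add (hτ c) a] with b h h'
    rw [add_assoc] at h'
    rw [h', h]
    ring

/-- If translations and dilations of `k` act through `f` by Möbius transformations, then up to a
Möbius transformation `f` is equivariant along a ring homomorphism. -/
theorem AffMob.exists_ringHom [IsAlgClosed l] {f : k → l} (hf : AffMob f) :
    ∃ (τ : k →+* l) (g : k → l), Mob f g ∧ AffMob g ∧
      ∀ a, ∀ᶠ b in cofinite, g (b + a) = g b + τ a := by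
  obtain ⟨u, v, g, hg, hfg, h⟩ : ∃ (u v : l) (g : k → l), AffMob g ∧ Mob f g ∧
      ∀ᶠ b in cofinite, g (b + 1) = u * g b + v := by
    obtain ⟨A, B, C, E, hd, h⟩ := hf.add 1
    by_cases hC : C = 0
    · subst hC
      have hE : E ≠ 0 := by rintro rfl; simp at hd
      refine ⟨A / E, B / E, f, hf, .refl f, h.mono fun b h => ?_⟩
      field_simp
      linear_combination h
    · obtain ⟨w, hw⟩ := IsAlgClosed.exists_root (Polynomial.C C * X ^ 2 +
        Polynomial.C (E - A) * X + Polynomial.C (-B)) (by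
          rw [degree_quadratic hC]; decide)
      have hw' : C * w ^ 2 + (E - A) * w - B = 0 := by
        have := hw.eq_zero
        simp at this
        linear_combination this
      have hM : Mob f fun b => (f b - w)⁻¹ := by
        refine ⟨0, 1, 1, -w, by simp, (hf.eventually_ne w).mono fun b hb => ?_⟩
        have := sub_ne_zero.2 hb
        field_simp
        ring
      have hAC : A - w * C ≠ 0 := fun h0 => hd (by linear_combination E * h0 + C * hw' + w * C * h0)
      refine ⟨(C * w + E) / (A - w * C), C / (A - w * C), _, hf.of_mob hM, hM, ?_⟩
      filter_upwards [h, hf.eventually_ne w, eventually_add (hf.eventually_ne w) 1] with b h h1 h2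
      have h1' := sub_ne_zero.2 h1
      have h2' := sub_ne_zero.2 h2
      field_simp
      linear_combination hw' - h
  have hu : u ≠ 0 := by
    rintro rfl
    obtain ⟨b, h1, h2⟩ := (h.and (eventually_add (hg.eventually_ne v) 1)).exists
    exact h2 (by rw [h1]; ring)
  by_cases hu1 : u = 1
  · subst hu1
    have hv : v ≠ 0 := by
      rintro rfl
      exact one_ne_zero (hg.eq_of_eventually_eq (a := 1) (c := 0) (h.mono fun b h => by
        rw [h]; simp))
    have hM : Mob g fun b => v⁻¹ * g b := .of_affine (inv_ne_zero hv) (B := 0)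
      (.of_forall fun b => by ring)
    obtain ⟨τ, hτ⟩ := (hg.of_mob hM).exists_ringHom_of_add_one (h.mono fun b h => by
      rw [h]; field_simp)
    exact ⟨τ, _, hfg.trans hM, hg.of_mob hM, hτ⟩
  · have hu1' := sub_ne_zero.2 hu1
    have hM : Mob g fun b => g b + v / (u - 1) := .of_affine one_ne_zero
      (B := v / (u - 1)) (.of_forall fun b => by ring)
    exact ((hg.of_mob hM).not_diag hu hu1 (h.mono fun b h => by
      rw [h]; field_simp; ring)).elim

end Reconstruction

section Renorm

variable {ℓ : ℕ} [Fact ℓ.Prime] {k F : Type*} [Field k] [Field F] [Algebra k F]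
  {l G : Type*} [Field l] [Field G] [Algebra l G] {p q : ℕ} {Φ : Cl ℓ F ≃* Cl ℓ G}

lemma Match.trans_refl {τ : k → l} {y : F} {t t' : G} {ρ : l → l} (h : Match p q Φ τ y t)
    (hτ : Tendsto τ cofinite cofinite)
    (h' : Match q q (MulEquiv.refl (Cl ℓ G)) ρ t t') : Match p q Φ (ρ ∘ τ) y t' := by
  refine ⟨⟨h.cor.pg, h'.cor.pg', fun c => ?_⟩, ?_⟩
  · rw [h.cor.mem_iff, h'.cor.mem_iff, MulEquiv.refl_apply]
  · filter_upwards [h.pm, hτ.eventually h'.pm] with a ⟨n, hn, h1⟩ ⟨m, hm, h2⟩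
    refine ⟨m * n, mul_ne_zero hm hn, fun c hc => ?_⟩
    have := h2 (Φ c) ((h.cor.mem_iff c).1 hc)
    rw [MulEquiv.refl_apply] at this
    rw [Function.comp_apply, this, h1 c hc, mul_assoc]

variable [IsAlgClosed l] [ExpChar G q]

omit [IsAlgClosed l] in
lemma pow_mem_adjoin_of_pow_mem {t t' z : G} {m : ℕ} (h : t ^ q ^ m ∈ l⟮t'⟯) (hz : z ∈ l⟮t⟯) :
    z ^ q ^ m ∈ l⟮t'⟯ := by
  have hle : (l⟮t⟯).toSubfield ≤ (l⟮t'⟯).toSubfield.comap (iterateFrobenius G q m) := by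
    rw [adjoin_toSubfield, Subfield.closure_le, Set.union_subset_iff]
    constructor
    · rintro _ ⟨c, rfl⟩
      exact pow_mem ((l⟮t'⟯).algebraMap_mem c) _
    · rintro _ rfl
      exact h
  exact hle hz

omit [IsAlgClosed l] in
lemma isAlgebraic_of_pow_mem {t t' : G} {m : ℕ} (h : t ^ q ^ m ∈ l⟮t'⟯) :
    IsAlgebraic l⟮t'⟯ t :=
  IsAlgebraic.of_pow (expChar_pow_pos G q m)
    (isAlgebraic_algebraMap (⟨_, h⟩ : l⟮t'⟯))

omit [IsAlgClosed l] in
lemma PGen.of_pow_mem {t t' : G} {m : ℕ} (ht : PGen q l t) (h : t ^ q ^ m ∈ l⟮t'⟯)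
    (h' : IsAlgebraic l⟮t⟯ t') : PGen q l t' := by
  refine ⟨fun halg => ht.1 ?_, fun y hy => ?_⟩
  · have : Algebra.IsAlgebraic l l⟮t'⟯ := isAlgebraic_adjoin_simple halg.isIntegral
    exact (isAlgebraic_of_pow_mem h).restrictScalars l
  · obtain ⟨n, hn⟩ := ht.2 y (isAlgebraic_trans' h' hy)
    refine ⟨n + m, ?_⟩
    rw [pow_add, pow_mul]
    exact pow_mem_adjoin_of_pow_mem h hn

lemma Match.refl_of (hq : (q : ZMod ℓ) ≠ 0) {t t' : G} {m : ℕ} {ρ : l → l} (ht : PGen q l t)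
    (h : t ^ q ^ m ∈ l⟮t'⟯) (h' : IsAlgebraic l⟮t⟯ t')
    (hρ : ∀ᶠ β in cofinite, (∀ b, b ≠ β → ordc l t' (ρ β) (cls ℓ (t - algebraMap l G b)) = 0) ∧
      ordc l t' (ρ β) (cls ℓ (t - algebraMap l G β)) ≠ 0) :
    Match q q (MulEquiv.refl (Cl ℓ G)) ρ t t' := by
  have ht' := ht.of_pow_mem h h'
  have hRA : RA ℓ l t = RA ℓ l t' := le_antisymm
    (RA_le_of_isAlgebraic hq ht' (isAlgebraic_of_pow_mem h)) (RA_le_of_isAlgebraic hq ht h')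
  refine ⟨⟨ht, ht', fun c => by rw [hRA, MulEquiv.refl_apply]⟩, hρ.mono fun β hβ => ?_⟩
  refine ⟨_, hβ.2, fun c hc => ?_⟩
  exact eq_mul_ordc hq ht (fun c => ordc l t' (ρ β) c) (fun c hc d hd =>
    ordc_mul hq ht' (hRA ▸ hc) (hRA ▸ hd) _) hβ.1 c hc

omit [IsAlgClosed l] [ExpChar G q] in
lemma mem_isAlgebraic {t t' : G} (h : t' ∈ l⟮t⟯) : IsAlgebraic l⟮t⟯ t' :=
  isAlgebraic_algebraMap (⟨_, h⟩ : l⟮t⟯)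

lemma Match.refl_affine (hq : (q : ZMod ℓ) ≠ 0) {t : G} (ht : PGen q l t) {A : l} (hA : A ≠ 0)
    (B : l) : Match q q (MulEquiv.refl (Cl ℓ G)) (fun β => A * β + B) t
      (algebraMap l G A * t + algebraMap l G B) := by
  classical
  have hA' : algebraMap l G A ≠ 0 := (_root_.map_ne_zero _).2 hA
  have hmem : algebraMap l G A * t + algebraMap l G B ∈ l⟮t⟯ :=
    add_mem (mul_mem (_root_.algebraMap_mem _ _) (mem_adjoin_simple_self l t))
      (_root_.algebraMap_mem _ _)
  have hmem' : t ^ q ^ 0 ∈ l⟮algebraMap l G A * t + algebraMap l G B⟯ := by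
    have : t ^ q ^ 0 = (algebraMap l G A)⁻¹ * ((algebraMap l G A * t + algebraMap l G B)
        - algebraMap l G B) := by
      rw [pow_zero, pow_one]; field_simp; ring
    rw [this]
    exact mul_mem (inv_mem (_root_.algebraMap_mem _ _)) (sub_mem (mem_adjoin_simple_self l _)
      (_root_.algebraMap_mem _ _))
  have ht' := ht.of_pow_mem hmem' (mem_isAlgebraic hmem)
  have key : ∀ b, cls ℓ (t - algebraMap l G b) =
      cls ℓ (algebraMap l G A * t + algebraMap l G B - algebraMap l G (A * b + B)) := by
    intro b
    have : algebraMap l G A * t + algebraMap l G B - algebraMap l G (A * b + B) =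
        algebraMap l G A * (t - algebraMap l G b) := by
      simp only [_root_.map_add, _root_.map_mul]; ring
    rw [this, cls_mul hA' (sub_algebraMap_ne_zero ht.1 b),
      cls_algebraMap (Fact.out : ℓ.Prime).ne_zero, one_mul]
  refine Match.refl_of hq ht hmem' (mem_isAlgebraic hmem) (.of_forall fun β => ⟨fun b hb => ?_, ?_⟩)
  · rw [key, ordc_sub hq ht', if_neg]
    exact fun h => hb (mul_left_cancel₀ hA (add_right_cancel h)).symm
  · rw [key, ordc_sub hq ht', if_pos rfl]
    exact one_ne_zero

lemma Match.refl_inv (hq : (q : ZMod ℓ) ≠ 0) {t : G} (ht : PGen q l t) :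
    Match q q (MulEquiv.refl (Cl ℓ G)) (fun β : l => β⁻¹) t t⁻¹ := by
  classical
  have ht0 : t ≠ 0 := by simpa using sub_algebraMap_ne_zero ht.1 0
  have hmem : t⁻¹ ∈ l⟮t⟯ := inv_mem (mem_adjoin_simple_self l t)
  have hmem' : t ^ q ^ 0 ∈ l⟮t⁻¹⟯ := by
    have : t ^ q ^ 0 = (t⁻¹)⁻¹ := by simp
    rw [this]
    exact inv_mem (mem_adjoin_simple_self l _)
  have ht' := ht.of_pow_mem hmem' (mem_isAlgebraic hmem)
  have key : ∀ b, b ≠ 0 → cls ℓ (t - algebraMap l G b) =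
      cls ℓ (t⁻¹ - algebraMap l G b⁻¹) / cls ℓ (t⁻¹ - algebraMap l G 0) := by
    intro b hb
    have hb' : algebraMap l G b ≠ 0 := (_root_.map_ne_zero _).2 hb
    have h1 : t - algebraMap l G b =
        algebraMap l G (-b) * ((t⁻¹ - algebraMap l G b⁻¹) / (t⁻¹ - algebraMap l G 0)) := by
      simp only [map_inv₀, map_zero, sub_zero, map_neg]
      field_simp
      ring
    rw [h1, cls_mul ((_root_.map_ne_zero _).2 (neg_ne_zero.2 hb))
      (div_ne_zero (sub_algebraMap_ne_zero ht'.1 _) (sub_algebraMap_ne_zero ht'.1 _)),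
      cls_algebraMap (Fact.out : ℓ.Prime).ne_zero, one_mul,
      cls_div (sub_algebraMap_ne_zero ht'.1 _) (sub_algebraMap_ne_zero ht'.1 _)]
  have key0 : cls ℓ (t - algebraMap l G 0) = (cls ℓ (t⁻¹ - algebraMap l G 0))⁻¹ := by
    rw [map_zero, sub_zero, sub_zero, cls_inv, inv_inv]
  refine Match.refl_of hq ht hmem' (mem_isAlgebraic hmem) ?_
  filter_upwards [(Set.finite_singleton (0 : l)).eventually_cofinite_notMem] with β hβ
  have hβ' : (0 : l) ≠ β⁻¹ := fun h => hβ (by simpa using h.symm)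
  constructor
  · intro b hb
    rcases eq_or_ne b 0 with rfl | hb0
    · rw [key0, ordc_inv hq ht' (cls_sub_mem_RA _), ordc_sub hq ht', if_neg hβ'.symm, neg_zero]
    · rw [key b hb0, ordc_div hq ht' (cls_sub_mem_RA _) (cls_sub_mem_RA _), ordc_sub hq ht',
        ordc_sub hq ht', if_neg hβ'.symm, if_neg, sub_zero]
      exact fun h => hb (inv_injective h).symm
  · rw [key β (fun h => hβ (by simpa using h)),
      ordc_div hq ht' (cls_sub_mem_RA _) (cls_sub_mem_RA _), ordc_sub hq ht',
        ordc_sub hq ht', if_neg hβ'.symm, if_pos rfl, sub_zero]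
    exact one_ne_zero

omit [IsAlgClosed l] in
lemma PGen.pow {t : G} (ht : PGen q l t) (m : ℕ) : PGen q l (t ^ q ^ m) :=
  ht.of_pow_mem (mem_adjoin_simple_self l _)
    (mem_isAlgebraic (pow_mem (mem_adjoin_simple_self l t) _))

omit [ExpChar G q] [IsAlgClosed l] in
lemma ordc_pow (hq : (q : ZMod ℓ) ≠ 0) {t : G} (ht : PGen q l t) {c : Cl ℓ G}
    (hc : c ∈ RA ℓ l t) (a : l) (n : ℕ) : ordc l t a (c ^ n) = n * ordc l t a c := by
  induction n with
  | zero => simp [ordc_one hq ht]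
  | succ n ih => rw [pow_succ, MilnorRec.ordc_mul hq ht (pow_mem hc n) hc, ih]; push_cast; ring

lemma Match.refl_pow (hq : (q : ZMod ℓ) ≠ 0) {t : G} (ht : PGen q l t) (m : ℕ) :
    Match q q (MulEquiv.refl (Cl ℓ G)) (fun β : l => β ^ q ^ m) t (t ^ q ^ m) := by
  classical
  have : ExpChar l q := (algebraMap l G).expChar (algebraMap l G).injective q
  have hmem : t ^ q ^ m ∈ l⟮t⟯ := pow_mem (mem_adjoin_simple_self l t) _
  have hmem' : t ^ q ^ m ∈ l⟮t ^ q ^ m⟯ := mem_adjoin_simple_self l _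
  have ht' := ht.pow m
  have hRA : RA ℓ l t ≤ RA ℓ l (t ^ q ^ m) :=
    RA_le_of_isAlgebraic hq ht' (isAlgebraic_of_pow_mem hmem')
  have key : ∀ β b, (q : ZMod ℓ) ^ m * ordc l (t ^ q ^ m) (β ^ q ^ m)
      (cls ℓ (t - algebraMap l G b)) = if β = b then 1 else 0 := by
    intro β b
    rw [← Nat.cast_pow, ← ordc_pow hq ht' (hRA (cls_sub_mem_RA b)),
      ← cls_pow (sub_algebraMap_ne_zero ht.1 b), sub_pow_expChar_pow, ← _root_.map_pow,
      ordc_sub hq ht']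
    congr 1
    exact propext ⟨fun h => iterateFrobenius_inj l q m h, fun h => h ▸ rfl⟩
  refine Match.refl_of hq ht hmem' (mem_isAlgebraic hmem) (.of_forall fun β => ⟨fun b hb => ?_, ?_⟩)
  · have := key β b
    rw [if_neg hb.symm] at this
    exact (mul_eq_zero.1 this).resolve_left (pow_ne_zero _ hq)
  · intro h
    have := key β β
    rw [if_pos rfl, h, mul_zero] at this
    exact zero_ne_one this

lemma Match.refl_root (hq : (q : ZMod ℓ) ≠ 0) {t t' : G} {m : ℕ} {ρ : l → l}
    (hρ : ∀ β, ρ β ^ q ^ m = β) (htt : t' ^ q ^ m = t) (ht : PGen q l t) :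
    Match q q (MulEquiv.refl (Cl ℓ G)) ρ t t' := by
  classical
  have hmem : t ^ q ^ 0 ∈ l⟮t'⟯ := by
    rw [pow_zero, pow_one, ← htt]
    exact pow_mem (mem_adjoin_simple_self l t') _
  have halg : IsAlgebraic l⟮t⟯ t' := isAlgebraic_of_pow_mem (m := m) (by
    rw [htt]; exact mem_adjoin_simple_self l t)
  have ht' := ht.of_pow_mem hmem halg
  have key : ∀ β b, ordc l t' (ρ β) (cls ℓ (t - algebraMap l G b)) =
      (q : ZMod ℓ) ^ m * if β = b then 1 else 0 := by
    intro β b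
    have h1 : t - algebraMap l G b = (t' - algebraMap l G (ρ b)) ^ q ^ m := by
      rw [sub_pow_expChar_pow, ← _root_.map_pow, htt, hρ]
    rw [h1, cls_pow (sub_algebraMap_ne_zero ht'.1 _), ordc_pow hq ht' (cls_sub_mem_RA _),
      ordc_sub hq ht', Nat.cast_pow]
    congr 2
    exact propext ⟨fun h => by rw [← hρ β, h, hρ], fun h => h ▸ rfl⟩
  refine Match.refl_of hq ht hmem halg (.of_forall fun β => ⟨fun b hb => ?_, ?_⟩)
  · rw [key, if_neg hb.symm, mul_zero]
  · rw [key, if_pos rfl, mul_one]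
    exact pow_ne_zero _ hq

variable [IsAlgClosed k] [ExpChar F p]

omit [IsAlgClosed k] [ExpChar F p] in
lemma Match.affine (H : Compat p q k l Φ) {τ : k → l} {y : F} {t : G} (h : Match p q Φ τ y t)
    {A : l} (hA : A ≠ 0) (B : l) : Match p q Φ (fun b => A * τ b + B) y
      (algebraMap l G A * t + algebraMap l G B) :=
  h.trans_refl (h.tendsto H) (.refl_affine H.coreG.hp h.cor.pg' hA B)

omit [IsAlgClosed k] [ExpChar F p] in
lemma Match.exists_mob (H : Compat p q k l Φ) {τ v : k → l} {y : F} {t : G}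
    (h : Match p q Φ τ y t) (hv : Mob τ v) : ∃ t', Match p q Φ v y t' := by
  obtain ⟨A, B, C, E, hd, hv⟩ := hv
  rcases eq_or_ne C 0 with rfl | hC
  · have hA : A ≠ 0 := fun h => hd (by rw [h]; ring)
    have hE : E ≠ 0 := fun h => hd (by rw [h]; ring)
    refine ⟨_, (h.affine H (div_ne_zero hA hE) (B / E)).congr (hv.mono fun b hb => ?_)⟩
    field_simp
    linear_combination -hb
  · have h1 := h.affine H hC E
    have h2 := h1.trans_refl (h1.tendsto H) (.refl_inv H.coreG.hp h1.cor.pg')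
    have h3 := h2.affine H (A := -((A * E - B * C) / C))
      (neg_ne_zero.2 (div_ne_zero hd hC)) (A / C)
    refine ⟨_, h3.congr ?_⟩
    have hne : ∀ᶠ b in cofinite, C * τ b + E ≠ 0 := by
      refine ((h1.tendsto H).eventually
        (Set.finite_singleton (0 : l)).eventually_cofinite_notMem).mono fun b hb => ?_
      simpa using hb
    filter_upwards [hne, hv] with b hne hb
    simp only [Function.comp_apply]
    rw [← eq_div_iff hne] at hb
    rw [hb]
    field_simp
    ring

omit [IsAlgClosed k] [ExpChar F p] in
lemma Match.renorm [PerfectRing G q] (H : Compat p q k l Φ) {τ τ' : k → l} {y : F} {t : G}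
    {m n : ℕ} (h : Match p q Φ τ y t)
    (hv : Mob (fun b => τ b ^ q ^ m) (fun b => τ' b ^ q ^ n)) : ∃ t', Match p q Φ τ' y t' := by
  have : ExpChar l q := (algebraMap l G).expChar (algebraMap l G).injective q
  have h1 := h.trans_refl (h.tendsto H) (.refl_pow H.coreG.hp h.cor.pg' m)
  obtain ⟨t1, h2⟩ := h1.exists_mob H hv
  obtain ⟨t2, ht2⟩ := (bijective_iterateFrobenius G q n).2 t1
  rw [iterateFrobenius_def] at ht2
  have hs := (bijective_iterateFrobenius l q n).2
  choose ρ hρ using hs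
  simp only [iterateFrobenius_def] at hρ
  refine ⟨t2, (h2.trans_refl (h2.tendsto H)
    (.refl_root H.coreG.hp hρ ht2 h2.cor.pg')).congr (.of_forall fun b => ?_)⟩
  exact iterateFrobenius_inj l q n (hρ _)

end Renorm

section Constants

variable {ℓ : ℕ} [Fact ℓ.Prime] {k F : Type*} [Field k] [Field F] [Algebra k F]
  {l G : Type*} [Field l] [Field G] [Algebra l G] {p q : ℕ} {Φ : Cl ℓ F ≃* Cl ℓ G}

lemma mob_shift [ExpChar l q] {f : k → l} {a : k} {t : l}
    (h : ∀ᶠ b in cofinite, f (b + a) = f b + t) (m : ℕ) :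
    Mob (fun b => f b ^ q ^ m) (fun b => f (b + a) ^ q ^ m) :=
  .of_affine one_ne_zero (B := t ^ q ^ m) (h.mono fun b hb => by
    rw [hb, add_pow_expChar_pow, one_mul])

variable [IsAlgClosed k] [IsAlgClosed l] [ExpChar F p] [ExpChar G q] [PerfectRing G q]

lemma Match.exists_add (H : Compat p q k l Φ) {x y : F} {x' y' : G} {τ f : k → l}
    (hx : Match p q Φ τ x x') (hy : Match p q Φ f y y') (hxy : Indep k x y)
    (hs : PGen p k (x + y)) (hf : ∀ a, ∃ t, ∀ᶠ b in cofinite, f (b + a) = f b + t) :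
    ∃ s', Match p q Φ f (x + y) s' := by
  have : Infinite k := IsAlgClosed.instInfinite
  have : ExpChar l q := (algebraMap l G).expChar (algebraMap l G).injective q
  obtain ⟨s', hs'⟩ := H.exists_cor hs
  obtain ⟨τs, hs'⟩ := H.exists_match hs'
  obtain ⟨n, W, h⟩ := (Tri.add H.coreF.hp hy.cor.pg hxy).exists_mob H hx hy hs'
  obtain ⟨a, _, -, ⟨m, rfl⟩, h⟩ := h.exists
  obtain ⟨t, ht⟩ := hf (-a)
  have h1 := h.comp (σ := fun b => b + -a) (add_left_injective _)
  have h2 : Mob (fun b => f b ^ q ^ m) (fun b => τs b ^ q ^ n) :=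
    (mob_shift ht m).trans (h1.congr (.of_forall fun b => rfl)
      (.of_forall fun b => by simp))
  exact hs'.renorm H h2.symm

lemma Match.exists_of_add (H : Compat p q k l Φ) {x y : F} {x' s' : G} {τ f : k → l}
    (hx : Match p q Φ τ x x') (hs : Match p q Φ f (x + y) s') (hxy : Indep k x y)
    (hy : PGen p k y) (hf : ∀ a, ∃ t, ∀ᶠ b in cofinite, f (b + a) = f b + t) :
    ∃ y', Match p q Φ f y y' := by
  have : Infinite k := IsAlgClosed.instInfinite
  have : ExpChar l q := (algebraMap l G).expChar (algebraMap l G).injective q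
  obtain ⟨y', hy'⟩ := H.exists_cor hy
  obtain ⟨τy, hy'⟩ := H.exists_match hy'
  obtain ⟨n, W, h⟩ := (Tri.add H.coreF.hp hy hxy).exists_mob H hx hy' hs
  obtain ⟨a, _, -, ⟨m, rfl⟩, h⟩ := h.exists
  obtain ⟨t, ht⟩ := hf a
  have h2 : Mob (fun b => τy b ^ q ^ m) (fun b => f b ^ q ^ n) :=
    h.trans ((mob_shift ht n).symm.congr (.of_forall fun b => by simp [add_comm])
      (.of_forall fun b => rfl))
  exact hy'.renorm H h2

omit [PerfectRing G q] in
/-- The relation between the points of `x`, `y` and `x + y` forces `f` to be additive up to a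
constant. -/
lemma Match.eventually_eq_add (H : Compat p q k l Φ) {x y : F} {x' y' s' : G} {σ τ f : k → l}
    (hx : Match p q Φ σ x x') (hy : Match p q Φ f y y') (hs : Match p q Φ f (x + y) s')
    (hxy : Indep k x y) (hf : ∀ a, ∀ᶠ b in cofinite, f (b + a) = f b + τ a) :
    ∃ b : k, ∀ᶠ a in cofinite, f (a + b) = τ a + f b := by
  have : Infinite k := IsAlgClosed.instInfinite
  have : ExpChar l q := (algebraMap l G).expChar (algebraMap l G).injective q
  obtain ⟨n, N, D, -, -, h1, h2⟩ :=
    (Tri.add H.coreF.hp hy.cor.pg hxy).exists_relation H hx hy hs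
  have hev : ∀ (α β : l) (P : l[X][X]), evalEval α β P = eval β (P.map (evalRingHom α)) :=
    fun α β P => by rw [map_evalRingHom_eval]
  have key : ∀ᶠ a in cofinite, ∀ β, (β + τ a) ^ q ^ n * evalEval (σ a) β D =
      evalEval (σ a) β N := by
    filter_upwards [h1] with a ha
    have h3 : ∀ᶠ b in cofinite, eval (f b) ((X + C (τ a)) ^ q ^ n * D.map (evalRingHom (σ a)) -
        N.map (evalRingHom (σ a))) = 0 := by
      filter_upwards [ha, hf a] with b hb hb'
      rw [add_comm a b, hb', hev, hev] at hb
      rw [eval_sub, eval_mul, eval_pow, eval_add, eval_X, eval_C, hb.2, sub_self]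
    have h4 : (X + C (τ a)) ^ q ^ n * D.map (evalRingHom (σ a)) -
        N.map (evalRingHom (σ a)) = 0 := by
      by_contra hne
      have := (hy.tendsto H).eventually
        (Polynomial.finite_setOfPred_isRoot hne).eventually_cofinite_notMem
      obtain ⟨b, hb, hb'⟩ := (h3.and this).exists
      exact hb' hb
    intro β
    have h5 := congrArg (eval β) h4
    rw [eval_sub, eval_mul, eval_pow, eval_add, eval_X, eval_C, eval_zero] at h5
    rw [hev, hev]
    exact sub_eq_zero.1 h5
  obtain ⟨b, hb⟩ := h2.exists
  refine ⟨b, ?_⟩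
  filter_upwards [key, hb] with a ha hb
  rw [← ha (f b)] at hb
  rw [add_comm (τ a)]
  exact iterateFrobenius_inj l q n (mul_right_cancel₀ hb.1 hb.2)

omit [PerfectRing G q] in
lemma Compat.exists_affMob (H : Compat p q k l Φ) :
    ∃ (x y : F) (x' y' : G) (σ f : k → l), Match p q Φ σ x x' ∧ Match p q Φ f y y' ∧
      Indep k x y ∧ PGen p k (x + y) ∧ AffMob f := by
  classical
  have : Infinite k := IsAlgClosed.instInfinite
  have : ExpChar l q := (algebraMap l G).expChar (algebraMap l G).injective q
  have : PerfectRing l q := inferInstance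
  obtain ⟨x₀, y₀, h₀⟩ := H.coreF.two
  obtain ⟨x, hx, -⟩ := exists_pGen h₀ H.coreF.fg {(1, 0)} (by simp) ∅ (by simp)
  have hx : PGen p k x := by simpa using hx (1, 0) (by simp)
  have hx0 : x ≠ 0 := by simpa using sub_algebraMap_ne_zero hx.1 0
  obtain ⟨y, hy, hxy⟩ := exists_pGen h₀ H.coreF.fg {(1, 0), (1, x), (x, 0)}
    (by simp [hx0]) {x} (by simpa using hx.1)
  have hxy : Indep k x y := hxy x (by simp)
  have hy1 : PGen p k y := by simpa using hy (1, 0) (by simp)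
  have hy2 : PGen p k (x + y) := by simpa [add_comm] using hy (1, x) (by simp)
  have hy3 : PGen p k (x * y) := by simpa using hy (x, 0) (by simp)
  obtain ⟨x', hx'⟩ := H.exists_cor hx
  obtain ⟨σ, hx'⟩ := H.exists_match hx'
  obtain ⟨y', hy'⟩ := H.exists_cor hy1
  obtain ⟨f, hy'⟩ := H.exists_match hy'
  obtain ⟨s', hs'⟩ := H.exists_cor hy2
  obtain ⟨τs, hs'⟩ := H.exists_match hs'
  obtain ⟨t', ht'⟩ := H.exists_cor hy3
  obtain ⟨τt, ht'⟩ := H.exists_match ht'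
  obtain ⟨n, W, h⟩ := (Tri.mul H.coreF.hp hy1 hxy).exists_mob H hx' hy' ht'
  have hmul := fun c => mobGroup_mulLeft_mem (f := f) (g := fun b => τt b ^ q ^ n) h c
  obtain ⟨n', W', h'⟩ := (Tri.add H.coreF.hp hy1 hxy).exists_mob H hx' hy' hs'
  have hadd := fun a => mobGroup_addLeft_mem (f := f) (g := fun b => τs b ^ q ^ n') h' hmul a
  refine ⟨x, y, x', y', σ, f, hx', hy', hxy, hy2, hy'.exists_injOn H, fun a => ?_, fun c hc => ?_⟩
  · exact (mem_mobGroup.1 (hadd a)).congr (.of_forall fun b => rfl)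
      (.of_forall fun b => by simp [add_comm])
  · exact (mem_mobGroup.1 (hmul (Units.mk0 c hc))).congr (.of_forall fun b => rfl)
      (.of_forall fun b => by simp [Units.smul_def])

lemma Compat.exists_ringHom (H : Compat p q k l Φ) :
    ∃ (τ : k →+* l) (y : F) (y' : G), Match p q Φ τ y y' := by
  have : Infinite k := IsAlgClosed.instInfinite
  obtain ⟨x, y, x', y', σ, f₀, hx, hy, hxy, hs, hf₀⟩ := H.exists_affMob
  obtain ⟨τ, f, hmob, -, hf⟩ := AffMob.exists_ringHom hf₀
  obtain ⟨y₁, hy₁⟩ := hy.exists_mob H hmob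
  obtain ⟨s', hs'⟩ := hx.exists_add H hy₁ hxy hs fun a => ⟨_, hf a⟩
  obtain ⟨b, hb⟩ := hx.eventually_eq_add H hy₁ hs' hxy hf
  have hf' : ∀ᶠ a in cofinite, f a + (τ b - f b) = τ a := by
    refine ((sub_left_injective (b := b)).tendsto_cofinite.eventually hb).mono fun a ha => ?_
    rw [sub_add_cancel, _root_.map_sub] at ha
    linear_combination ha
  refine ⟨τ, y, _, (hy₁.affine H one_ne_zero (τ b - f b)).congr (hf'.mono fun a ha => ?_)⟩
  simpa using ha

omit [PerfectRing G q] in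
lemma Match.surjective (H : Compat p q k l Φ) {τ : k →+* l} {y : F} {y' : G}
    (h : Match p q Φ τ y y') : Function.Surjective τ := by
  have : Infinite l := IsAlgClosed.instInfinite
  intro β
  have h1 : ∀ᶠ α in cofinite, α ∈ Set.range τ := h.eventually_of H (.of_forall fun a => ⟨a, rfl⟩)
  obtain ⟨α, ⟨a, ha⟩, ⟨b, hb⟩⟩ :=
    (h1.and ((add_right_injective β).tendsto_cofinite.eventually h1)).exists
  exact ⟨b - a, by rw [_root_.map_sub, ha, hb, add_sub_cancel_right]⟩

lemma Match.exists_of_ringHom (H : Compat p q k l Φ) {τ : k →+* l} {x z : F} {x' : G}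
    (h : Match p q Φ τ x x') (hz : PGen p k z) : ∃ z', Match p q Φ τ z z' := by
  classical
  have : Infinite k := IsAlgClosed.instInfinite
  have hτ : ∀ a, ∃ t, ∀ᶠ b in cofinite, τ (b + a) = τ b + t :=
    fun a => ⟨τ a, .of_forall fun b => _root_.map_add τ b a⟩
  have main : ∀ {x y : F} {x' : G}, Match p q Φ τ x x' → PGen p k y → Indep k x y →
      PGen p k (x + y) → ∃ y', Match p q Φ τ y y' := by
    intro x y x' h hy hxy hs
    obtain ⟨y', hy'⟩ := H.exists_cor hy
    obtain ⟨τy, hy'⟩ := H.exists_match hy'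
    obtain ⟨s', hs'⟩ := hy'.exists_add H h hxy.symm (by rwa [add_comm]) hτ
    rw [add_comm] at hs'
    exact h.exists_of_add H hs' hxy hy hτ
  obtain ⟨x₀, y₀, h₀⟩ := H.coreF.two
  obtain ⟨u, hu, hind⟩ := exists_pGen h₀ H.coreF.fg {(1, 0), (1, x), (1, z)} (by simp) {x, z}
    (by simp [h.cor.pg.1, hz.1])
  have hu1 : PGen p k u := by simpa using hu (1, 0) (by simp)
  have hu2 : PGen p k (x + u) := by simpa [add_comm] using hu (1, x) (by simp)
  have hu3 : PGen p k (u + z) := by simpa using hu (1, z) (by simp)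
  obtain ⟨u', hu'⟩ := main h hu1 (hind x (by simp)) hu2
  exact main hu' hz (hind z (by simp)).symm hu3

end Constants

lemma eq_zero_of_eventually_evalEval {l : Type*} [Field l] [Infinite l] {P : l[X][X]}
    (h : ∀ᶠ α in cofinite, ∀ᶠ β in cofinite, evalEval α β P = 0) : P = 0 := by
  have key : ∀ (Q : l[X]), (∀ᶠ β in cofinite, eval β Q = 0) → Q = 0 := by
    intro Q hQ
    by_contra hne
    obtain ⟨b, hb, hb'⟩ :=
      (hQ.and (Polynomial.finite_setOfPred_isRoot hne).eventually_cofinite_notMem).exists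
    exact hb' hb
  ext1 n
  rw [coeff_zero]
  refine key _ (h.mono fun α hα => ?_)
  have := key (P.map (evalRingHom α)) (hα.mono fun β hβ => by rwa [map_evalRingHom_eval])
  simpa using congrArg (fun R => R.coeff n) this

section FieldIso

variable {ℓ : ℕ} [Fact ℓ.Prime] {k F : Type*} [Field k] [Field F] [Algebra k F]
  {l G : Type*} [Field l] [Field G] [Algebra l G] {p q : ℕ} {Φ : Cl ℓ F ≃* Cl ℓ G}

lemma Match.refl_trans {τ : k → l} {y t : F} {t' : G} {ρ : k → k}
    (h : Match p p (MulEquiv.refl (Cl ℓ F)) ρ y t) (hρ : Tendsto ρ cofinite cofinite)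
    (h' : Match p q Φ τ t t') : Match p q Φ (τ ∘ ρ) y t' := by
  refine ⟨⟨h.cor.pg, h'.cor.pg', fun c => ?_⟩, ?_⟩
  · rw [h.cor.mem_iff, MulEquiv.refl_apply, h'.cor.mem_iff]
  · filter_upwards [h.pm, hρ.eventually h'.pm] with a ⟨n, hn, h1⟩ ⟨m, hm, h2⟩
    refine ⟨m * n, mul_ne_zero hm hn, fun c hc => ?_⟩
    have h3 := (h.cor.mem_iff c).1 hc
    have h4 := h1 c hc
    rw [MulEquiv.refl_apply] at h3 h4
    rw [Function.comp_apply, h2 c h3, h4, mul_assoc]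

variable [IsAlgClosed k] [IsAlgClosed l] [ExpChar F p] [ExpChar G q]

lemma Match.add_const (H : Compat p q k l Φ) {τ : k →+* l} {y : F} {y' : G}
    (h : Match p q Φ τ y y') (c : k) :
    Match p q Φ τ (y + algebraMap k F c) (y' + algebraMap l G (τ c)) := by
  have h1 := Match.refl_affine H.coreF.hp h.cor.pg one_ne_zero c
  rw [map_one, one_mul] at h1
  have h2 := Match.refl_affine H.coreF.hp h1.cor.pg' one_ne_zero (-c)
  rw [map_one, one_mul, map_neg, add_neg_cancel_right] at h2
  have h3 := h2.refl_trans
    ((add_left_injective (-c)).comp (mul_right_injective₀ one_ne_zero)).tendsto_cofinite h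
  have h4 := h3.affine H one_ne_zero (τ c)
  rw [map_one, one_mul] at h4
  exact h4.congr (.of_forall fun a => by simp)

lemma Match.eq_aevalAeval (H : Compat p q k l Φ) {τ : k →+* l} {x y s : F} {x' y' s' : G}
    {c : k → k → k} (hT : Tri ℓ k x y s c) (hx : Match p q Φ τ x x') (hy : Match p q Φ τ y y')
    (hs : Match p q Φ τ s s') (E : l[X][X])
    (hE : ∀ a b, evalEval (τ a) (τ b) E = τ (c a b)) : s' = aevalAeval x' y' E := by
  have : Infinite l := IsAlgClosed.instInfinite
  have hsurj := hx.surjective H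
  obtain ⟨n, N, D, hD, h1, h2, -⟩ := hT.exists_relation H hx hy hs
  have h3 : E ^ q ^ n * D - N = 0 := by
    refine eq_zero_of_eventually_evalEval ?_
    refine (eventually_map.2 ?_).filter_mono hsurj.le_map_cofinite
    refine h2.mono fun a ha => ?_
    refine (eventually_map.2 ?_).filter_mono hsurj.le_map_cofinite
    refine ha.mono fun b hb => ?_
    rw [← coe_evalEvalRingHom, _root_.map_sub, _root_.map_mul, _root_.map_pow,
      coe_evalEvalRingHom, hE, hb.2, sub_self]
  have h4 : aevalAeval x' y' D ≠ 0 := fun h => hD ((hx.cor.indep H hy.cor hT.indep) D h)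
  rw [← sub_eq_zero.1 h3, _root_.map_mul, _root_.map_pow] at h1
  exact iterateFrobenius_inj G q n (mul_right_cancel₀ h4 h1)

lemma Match.eq_add (H : Compat p q k l Φ) {τ : k →+* l} {x y : F} {x' y' s' : G}
    (hx : Match p q Φ τ x x') (hy : Match p q Φ τ y y') (hs : Match p q Φ τ (x + y) s')
    (hxy : Indep k x y) : s' = x' + y' := by
  rw [hx.eq_aevalAeval H (Tri.add H.coreF.hp hy.cor.pg hxy) hy hs (C X + X)
    fun a b => by simp [evalEval]]
  simp

lemma Match.eq_mul (H : Compat p q k l Φ) {τ : k →+* l} {x y : F} {x' y' s' : G}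
    (hx : Match p q Φ τ x x') (hy : Match p q Φ τ y y') (hs : Match p q Φ τ (x * y) s')
    (hxy : Indep k x y) : s' = x' * y' := by
  rw [hx.eq_aevalAeval H (Tri.mul H.coreF.hp hy.cor.pg hxy) hy hs (X * C X)
    fun a b => by simp [evalEval]; ring]
  rw [_root_.map_mul, mul_comm]
  simp

variable [PerfectRing G q]

lemma Match.eq_right (H : Compat p q k l Φ) {τ : k →+* l} {x : F} {x' x'' : G}
    (hx : Match p q Φ τ x x') (hx' : Match p q Φ τ x x'') : x' = x'' := by
  classical
  obtain ⟨x₀, y₀, h₀⟩ := H.coreF.two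
  obtain ⟨u, hu, hind⟩ := exists_pGen h₀ H.coreF.fg {(1, 0), (1, x)} (by simp) {x}
    (by simpa using hx.cor.pg.1)
  obtain ⟨u', hu'⟩ := hx.exists_of_ringHom H (by simpa using hu (1, 0) (by simp))
  obtain ⟨s', hs'⟩ := hx.exists_of_ringHom H (z := x + u)
    (by simpa [add_comm] using hu (1, x) (by simp))
  have hxu := hind x (by simp)
  exact add_right_cancel ((hx.eq_add H hu' hs' hxu).symm.trans (hx'.eq_add H hu' hs' hxu))

variable (H : Compat p q k l Φ) {τ : k →+* l} {x₁ : F} {x₁' : G} (hτ : Match p q Φ τ x₁ x₁')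
include H hτ

/-- General elements give rise to a ring homomorphism. -/
theorem Compat.exists_ringHom_field : ∃ f : F →+* G, (∀ a, f (algebraMap k F a) =
    algebraMap l G (τ a)) ∧ ∀ x, PGen p k x → Match p q Φ τ x (f x) := by
  classical
  obtain ⟨x₀, y₀, h₀⟩ := H.coreF.two
  have hσ : ∀ x, ∃ x', PGen p k x → Match p q Φ τ x x' := fun x => by
    by_cases hx : PGen p k x
    · obtain ⟨x', h⟩ := hτ.exists_of_ringHom H hx
      exact ⟨x', fun _ => h⟩
    · exact ⟨0, fun h => absurd h hx⟩
  choose σ hσ using hσ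
  have σadd : ∀ {x y}, PGen p k x → PGen p k y → PGen p k (x + y) → Indep k x y →
      σ (x + y) = σ x + σ y := fun hx hy hs h => (hσ _ hx).eq_add H (hσ _ hy) (hσ _ hs) h
  have σmul : ∀ {x y}, PGen p k x → PGen p k y → PGen p k (x * y) → Indep k x y →
      σ (x * y) = σ x * σ y := fun hx hy hs h => (hσ _ hx).eq_mul H (hσ _ hy) (hσ _ hs) h
  have hex : ∀ z, ∃ u, PGen p k u ∧ PGen p k (z + u) := fun z => by
    obtain ⟨u, hu, -⟩ := exists_pGen h₀ H.coreF.fg {(1, 0), (1, z)} (by simp) ∅ (by simp)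
    exact ⟨u, by simpa using hu (1, 0) (by simp),
      by simpa [add_comm] using hu (1, z) (by simp)⟩
  choose u hu hzu using hex
  let f : F → G := fun z => σ (z + u z) - σ (u z)
  have hf : ∀ z w, PGen p k w → PGen p k (z + w) → f z = σ (z + w) - σ w := by
    intro z w hw hzw
    obtain ⟨v, hv, hT⟩ := exists_pGen_indep h₀ H.coreF.fg
      {(1, 0), (1, z), (1, z + u z), (1, z + w)} (by simp)
      {(z + u z, 0), (u z, z), (z + w, 0), (w, z)}
      (by simp [(hu z).1, (hzu z).1, hw.1, hzw.1])
    have hv1 : PGen p k v := by simpa using hv (1, 0) (by simp)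
    have hv2 : PGen p k (v + z) := by simpa using hv (1, z) (by simp)
    have hv3 : PGen p k (v + (z + u z)) := by simpa using hv (1, z + u z) (by simp)
    have hv4 : PGen p k (v + (z + w)) := by simpa using hv (1, z + w) (by simp)
    have hT1 : Indep k (z + u z) v := by simpa using hT (z + u z, 0) (by simp)
    have hT2 : Indep k (u z) (v + z) := hT (u z, z) (by simp)
    have hT3 : Indep k (z + w) v := by simpa using hT (z + w, 0) (by simp)
    have hT4 : Indep k w (v + z) := hT (w, z) (by simp)
    have e1 := σadd hv1 (hzu z) hv3 hT1.symm
    have e2 := σadd hv2 (hu z) (by convert! hv3 using 1; ring) hT2.symm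
    have e3 := σadd hv1 hzw hv4 hT3.symm
    have e4 := σadd hv2 hw (by convert! hv4 using 1; ring) hT4.symm
    rw [add_assoc] at e2 e4
    change σ (z + u z) - σ (u z) = _
    linear_combination e2 - e1 + e3 - e4
  have f_add : ∀ z w, f (z + w) = f z + f w := by
    intro z w
    obtain ⟨v, hv, -⟩ := exists_pGen h₀ H.coreF.fg {(1, 0), (1, w), (1, z + w)} (by simp) ∅
      (by simp)
    have hv1 : PGen p k v := by simpa using hv (1, 0) (by simp)
    have hv2 : PGen p k (w + v) := by simpa [add_comm] using hv (1, w) (by simp)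
    have hv3 : PGen p k (z + w + v) := by simpa [add_comm] using hv (1, z + w) (by simp)
    rw [hf (z + w) v hv1 hv3, hf w v hv1 hv2,
      hf z (w + v) hv2 (by rwa [← add_assoc]), add_assoc]
    ring
  have f_eq : ∀ x, PGen p k x → f x = σ x := by
    intro x hx
    obtain ⟨v, hv, hT⟩ := exists_pGen h₀ H.coreF.fg {(1, 0), (1, x)} (by simp) {x}
      (by simpa using hx.1)
    have hv1 : PGen p k v := by simpa using hv (1, 0) (by simp)
    have hv2 : PGen p k (x + v) := by simpa [add_comm] using hv (1, x) (by simp)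
    rw [hf x v hv1 hv2, σadd hx hv1 hv2 (hT x (by simp)), add_sub_cancel_right]
  have f_zero : f 0 = 0 := by simpa using f_add 0 0
  have f_mul : ∀ z w, f (z * w) = f z * f w := by
    intro z w
    obtain ⟨a, ha, -⟩ := exists_pGen h₀ H.coreF.fg {(1, 0), (1, z)} (by simp) ∅ (by simp)
    have ha1 : PGen p k a := by simpa using ha (1, 0) (by simp)
    have ha2 : PGen p k (a + z) := by simpa using ha (1, z) (by simp)
    have ha10 : a ≠ 0 := by simpa using sub_algebraMap_ne_zero ha1.1 0
    have ha20 : a + z ≠ 0 := by simpa using sub_algebraMap_ne_zero ha2.1 0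
    obtain ⟨b, hb, hT⟩ := exists_pGen_indep h₀ H.coreF.fg
      {(1, 0), (1, w), (a, 0), (a, a * w), (a + z, 0), (a + z, (a + z) * w)}
      (by simp [ha10, ha20]) {(a, 0), (a, w), (a + z, 0), (a + z, w)} (by simp [ha1.1, ha2.1])
    have hb1 : PGen p k b := by simpa using hb (1, 0) (by simp)
    have hb2 : PGen p k (b + w) := by simpa using hb (1, w) (by simp)
    have m1 : PGen p k (a * b) := by simpa using hb (a, 0) (by simp)
    have m2 : PGen p k (a * (b + w)) := by simpa [mul_add] using hb (a, a * w) (by simp)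
    have m3 : PGen p k ((a + z) * b) := by simpa using hb (a + z, 0) (by simp)
    have m4 : PGen p k ((a + z) * (b + w)) := by
      rw [mul_add]; exact hb (a + z, (a + z) * w) (by simp)
    have e1 := σmul ha1 hb1 m1 (by simpa using hT (a, 0) (by simp))
    have e2 := σmul ha1 hb2 m2 (hT (a, w) (by simp))
    have e3 := σmul ha2 hb1 m3 (by simpa using hT (a + z, 0) (by simp))
    have e4 := σmul ha2 hb2 m4 (hT (a + z, w) (by simp))
    rw [← f_eq _ ha1, ← f_eq _ hb1, ← f_eq _ m1] at e1
    rw [← f_eq _ ha1, ← f_eq _ hb2, ← f_eq _ m2] at e2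
    rw [← f_eq _ ha2, ← f_eq _ hb1, ← f_eq _ m3] at e3
    rw [← f_eq _ ha2, ← f_eq _ hb2, ← f_eq _ m4] at e4
    have e5 : (a + z) * (b + w) + a * b = a * (b + w) + (a + z) * b + z * w := by ring
    have e6 := congrArg f e5
    rw [f_add, f_add, f_add, e1, e2, e3, e4, f_add a z, f_add b w] at e6
    linear_combination -e6
  have f_one : f 1 = 1 := by
    have h1 : f x₁ ≠ 0 := by
      rw [f_eq _ hτ.cor.pg]
      simpa using sub_algebraMap_ne_zero (hσ x₁ hτ.cor.pg).cor.pg'.1 0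
    have h2 := f_mul 1 x₁
    rw [one_mul] at h2
    exact mul_right_cancel₀ h1 (by rw [one_mul, ← h2])
  refine ⟨⟨⟨⟨f, f_one⟩, f_mul⟩, f_zero, f_add⟩, fun a => ?_, fun x hx => ?_⟩
  · have h1 := (hσ _ hτ.cor.pg).add_const H a
    have h2 := h1.cor.pg
    rw [add_comm] at h2
    change f _ = _
    rw [hf _ x₁ hτ.cor.pg h2, add_comm _ x₁, (hσ _ h1.cor.pg).eq_right H h1, add_sub_cancel_left]
  · change Match p q Φ τ x (f x)
    rw [f_eq x hx]
    exact hσ x hx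

omit hτ in
/-- Reconstruction of perfect fields from their mod-`ℓ` multiplicative groups. -/
theorem Compat.nonempty_ringEquiv [PerfectRing F p] : Nonempty (F ≃+* G) := by
  classical
  obtain ⟨τ, y, y', hτ⟩ := H.exists_ringHom
  obtain ⟨f, hfτ, hf⟩ := H.exists_ringHom_field hτ
  have hpq : ExpChar G p := expChar_of_injective_ringHom f.injective p
  obtain rfl : p = q := ExpChar.eq hpq ‹_›
  have hgen : ∀ x', PGen p l x' → x' ∈ f.fieldRange := by
    intro x' hx'
    obtain ⟨x, hx⟩ := H.symm.exists_cor hx'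
    have hx := hx.symm
    have hfx := hf x hx.pg
    have hRA : RA ℓ l (f x) = RA ℓ l x' := by
      ext c
      obtain ⟨c, rfl⟩ := Φ.surjective c
      rw [← hfx.cor.mem_iff, ← show c ∈ RA ℓ k x ↔ Φ c ∈ RA ℓ l x' from hx.mem_iff c]
    have halg : IsAlgebraic l⟮f x⟯ x' := by
      by_contra h
      exact RA_ne_of_indep H.coreG (indep_iff.2 ⟨hfx.cor.pg'.1, h⟩) hRA
    obtain ⟨n, hn⟩ := hfx.cor.pg'.2 x' halg
    have hle : (l⟮f x⟯).toSubfield ≤ f.fieldRange := by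
      rw [adjoin_toSubfield, Subfield.closure_le, Set.union_subset_iff]
      constructor
      · rintro _ ⟨c, rfl⟩
        obtain ⟨a, rfl⟩ := hτ.surjective H c
        exact ⟨_, hfτ a⟩
      · rintro _ rfl
        exact ⟨x, rfl⟩
    obtain ⟨z, hz⟩ := hle hn
    obtain ⟨w, rfl⟩ := (bijective_iterateFrobenius F p n).2 z
    refine ⟨w, iterateFrobenius_inj G p n ?_⟩
    rw [iterateFrobenius_def, iterateFrobenius_def, ← hz, iterateFrobenius_def, _root_.map_pow]
  obtain ⟨x₀, y₀, h₀⟩ := H.coreG.two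
  refine ⟨RingEquiv.ofBijective f ⟨f.injective, fun z => ?_⟩⟩
  obtain ⟨u, hu, -⟩ := exists_pGen h₀ H.coreG.fg {(1, 0), (1, z)} (by simp) ∅ (by simp)
  have h1 := hgen u (by simpa using hu (1, 0) (by simp))
  have h2 := hgen (u + z) (by simpa using hu (1, z) (by simp))
  have h3 := sub_mem h2 h1
  rwa [add_sub_cancel_left] at h3

end FieldIso

section KTwo

variable {ℓ : ℕ} {K : Type*} [Field K]

/-- A map which is additive in each of two variables, as a multilinear map. -/
def biadditive {A M : Type*} [AddCommGroup A] [AddCommGroup M] (f : A → A → M)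
    (hl : ∀ a b c, f (a + b) c = f a c + f b c) (hr : ∀ a b c, f a (b + c) = f a b + f a c) :
    MultilinearMap ℤ (fun _ : Fin 2 => A) M where
  toFun m := f (m 0) (m 1)
  map_update_add' m i x y := by
    fin_cases i
    · simpa [Function.update] using hl x y (m 1)
    · simpa [Function.update] using hr (m 0) x y
  map_update_smul' m i c x := by
    fin_cases i
    · simpa [Function.update] using
        map_zsmul (AddMonoidHom.mk' (fun a => f a (m 1)) fun a b => hl a b (m 1)) c x
    · simpa [Function.update] using
        map_zsmul (AddMonoidHom.mk' (fun a => f (m 0) a) fun a b => hr (m 0) a b) c x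

lemma milnorKMod_torsion (x : MilnorKMod ℓ 2 K) : (ℓ : ℤ) • x = 0 := by
  obtain ⟨y, rfl⟩ := Submodule.Quotient.mk_surjective _ x
  rw [← Submodule.Quotient.mk_smul, Submodule.Quotient.mk_eq_zero]
  exact ⟨y, by simp⟩

lemma exists_milnorKMod_lift {M : Type*} [AddCommGroup M] (f : Kˣ → Kˣ → M)
    (hl : ∀ a b c, f (a * b) c = f a c + f b c) (hr : ∀ a b c, f a (b * c) = f a b + f a c)
    (hst : ∀ a b : Kˣ, (a : K) + b = 1 → f a b = 0) (htor : ∀ m : M, (ℓ : ℤ) • m = 0) :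
    ∃ D : MilnorKMod ℓ 2 K →+ M, ∀ a b, D (milnorSymbol ℓ ![a, b]) = f a b := by
  let B := PiTensorProduct.lift (biadditive
    (fun a b : Additive Kˣ => f a.toMul b.toMul) (fun a b c => hl _ _ _) (fun a b c => hr _ _ _))
  have hB : ∀ a : Fin 2 → Kˣ,
      B (PiTensorProduct.tprod ℤ (fun i => Additive.ofMul (a i))) = f (a 0) (a 1) := by
    intro a
    simp only [B, PiTensorProduct.lift.tprod]
    rfl
  have h1 : SteinbergRel 2 K ≤ LinearMap.ker B := by
    unfold SteinbergRel
    rw [Submodule.span_le]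
    rintro _ ⟨a, ⟨i, j, hij, h⟩, rfl⟩
    have hi : i = 0 := by omega
    have hj : j = 1 := by omega
    subst hi hj
    rw [SetLike.mem_coe, LinearMap.mem_ker, hB]
    exact hst _ _ h
  let C : MilnorK 2 K →ₗ[ℤ] M := (SteinbergRel 2 K).liftQ B h1
  have h2 : LinearMap.range ((ℓ : ℤ) • (LinearMap.id : MilnorK 2 K →ₗ[ℤ] MilnorK 2 K)) ≤
      LinearMap.ker C := by
    rintro _ ⟨y, rfl⟩
    rw [LinearMap.mem_ker, LinearMap.smul_apply, map_zsmul]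
    exact htor _
  refine ⟨(Submodule.liftQ _ C h2).toAddMonoidHom, fun a b => ?_⟩
  exact hB ![a, b]

lemma milnorKMod_hom_ext {M : Type*} [AddCommGroup M] {f g : MilnorKMod ℓ 2 K →+ M}
    (h : ∀ a b : Kˣ, f (milnorSymbol ℓ ![a, b]) = g (milnorSymbol ℓ ![a, b])) : f = g := by
  have key : (f.toIntLinearMap.comp (Submodule.mkQ _)).comp (Submodule.mkQ (SteinbergRel 2 K)) =
      (g.toIntLinearMap.comp (Submodule.mkQ _)).comp (Submodule.mkQ (SteinbergRel 2 K)) := by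
    refine PiTensorProduct.ext (MultilinearMap.ext fun m => ?_)
    have hm : m = fun i => Additive.ofMul ((![(m 0).toMul, (m 1).toMul] : Fin 2 → Kˣ) i) := by
      funext i
      fin_cases i <;> rfl
    rw [hm]
    exact h _ _
  ext x
  obtain ⟨y, rfl⟩ := Submodule.Quotient.mk_surjective _ x
  obtain ⟨z, rfl⟩ := Submodule.Quotient.mk_surjective _ y
  exact LinearMap.congr_fun key z

lemma milnorSymbol_mul_left (a b c : Kˣ) :
    milnorSymbol ℓ ![a * b, c] = milnorSymbol ℓ ![a, c] + milnorSymbol ℓ ![b, c] := by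
  unfold milnorSymbol
  rw [← Submodule.Quotient.mk_add, ← Submodule.Quotient.mk_add]
  congr 2
  have := (PiTensorProduct.tprod ℤ (s := fun _ : Fin 2 => Additive Kˣ)).map_update_add
    (fun i => Additive.ofMul ((![a, c] : Fin 2 → Kˣ) i)) 0 (Additive.ofMul a) (Additive.ofMul b)
  convert this using 2
  · funext i; fin_cases i <;> rfl
  · congr 1
    funext i; fin_cases i <;> rfl
  · congr 1
    funext i; fin_cases i <;> rfl

lemma milnorSymbol_mul_right (a b c : Kˣ) :
    milnorSymbol ℓ ![a, b * c] = milnorSymbol ℓ ![a, b] + milnorSymbol ℓ ![a, c] := by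
  unfold milnorSymbol
  rw [← Submodule.Quotient.mk_add, ← Submodule.Quotient.mk_add]
  congr 2
  have := (PiTensorProduct.tprod ℤ (s := fun _ : Fin 2 => Additive Kˣ)).map_update_add
    (fun i => Additive.ofMul ((![a, c] : Fin 2 → Kˣ) i)) 1 (Additive.ofMul b) (Additive.ofMul c)
  convert this using 2
  · funext i; fin_cases i <;> rfl
  · congr 1
    funext i; fin_cases i <;> rfl
  · congr 1
    funext i; fin_cases i <;> rfl

lemma milnorSymbol_eq_zero {a b : Kˣ} (h : (a : K) + b = 1) : milnorSymbol ℓ ![a, b] = 0 := by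
  unfold milnorSymbol
  rw [Submodule.Quotient.mk_eq_zero]
  convert Submodule.zero_mem _
  rw [Submodule.Quotient.mk_eq_zero]
  exact Submodule.subset_span ⟨_, ⟨0, 1, by decide, h⟩, rfl⟩

/-- The symbol as a homomorphism in its first argument. -/
def symbolLeft (ℓ : ℕ) (b : Kˣ) : Additive Kˣ →+ MilnorKMod ℓ 2 K :=
  AddMonoidHom.mk' (fun a => milnorSymbol ℓ ![a.toMul, b]) fun _ _ => milnorSymbol_mul_left _ _ _

/-- The symbol as a homomorphism in its second argument. -/
def symbolRight (ℓ : ℕ) (a : Kˣ) : Additive Kˣ →+ MilnorKMod ℓ 2 K :=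
  AddMonoidHom.mk' (fun b => milnorSymbol ℓ ![a, b.toMul]) fun _ _ => milnorSymbol_mul_right _ _ _

lemma milnorSymbol_pow_left (a b : Kˣ) (n : ℕ) :
    milnorSymbol ℓ ![a ^ n, b] = n • milnorSymbol ℓ ![a, b] :=
  map_nsmul (symbolLeft ℓ b) n (Additive.ofMul a)

lemma milnorSymbol_pow_right (a b : Kˣ) (n : ℕ) :
    milnorSymbol ℓ ![a, b ^ n] = n • milnorSymbol ℓ ![a, b] :=
  map_nsmul (symbolRight ℓ a) n (Additive.ofMul b)

lemma milnorKMod_nsmul (x : MilnorKMod ℓ 2 K) : ℓ • x = 0 := by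
  rw [← natCast_zsmul]
  exact milnorKMod_torsion x

lemma K1proj_eq_iff {a b : Kˣ} : K1proj ℓ K a = K1proj ℓ K b ↔ ∃ w : Kˣ, a = b * w ^ ℓ := by
  rw [eq_comm]
  unfold K1proj
  rw [QuotientGroup.mk'_apply, QuotientGroup.mk'_apply, QuotientGroup.eq]
  constructor
  · rintro ⟨w, hw⟩
    exact ⟨w, by rw [show w ^ ℓ = b⁻¹ * a from hw]; simp⟩
  · rintro ⟨w, rfl⟩
    exact ⟨w, by simp⟩

lemma milnorSymbol_congr {a b a' b' : Kˣ} (ha : K1proj ℓ K a = K1proj ℓ K a')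
    (hb : K1proj ℓ K b = K1proj ℓ K b') : milnorSymbol ℓ ![a, b] = milnorSymbol ℓ ![a', b'] := by
  obtain ⟨v, rfl⟩ := K1proj_eq_iff.1 ha
  obtain ⟨w, rfl⟩ := K1proj_eq_iff.1 hb
  simp only [milnorSymbol_mul_left, milnorSymbol_mul_right, milnorSymbol_pow_left,
    milnorSymbol_pow_right, milnorKMod_nsmul, add_zero]

lemma K1proj_surjective : Function.Surjective (K1proj ℓ K) := QuotientGroup.mk'_surjective _

end KTwo

section ClMap

variable {ℓ : ℕ}

/-- The identification of `K1` with `Cl`. -/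
def toCl (ℓ : ℕ) (K : Type*) [Field K] : K1 ℓ K ≃* Cl ℓ K := MulEquiv.refl _

lemma toCl_proj {K : Type*} [Field K] (u : Kˣ) : toCl ℓ K (K1proj ℓ K u) = cls ℓ (u : K) :=
  (cls_unit u).symm

/-- The map on classes induced by a field embedding. -/
def clMap {K P : Type*} [Field K] [Field P] (ℓ : ℕ) (f : K →+* P) : Cl ℓ K →* Cl ℓ P :=
  QuotientGroup.map _ _ (Units.map f.toMonoidHom) (by
    rintro _ ⟨w, rfl⟩
    exact ⟨Units.map f.toMonoidHom w, by simp⟩)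

lemma clMap_cls {K P : Type*} [Field K] [Field P] (f : K →+* P) (x : K) :
    clMap ℓ f (cls ℓ x) = cls ℓ (f x) := by
  rcases eq_or_ne x 0 with rfl | hx
  · simp
  · have : f x = ((Units.map f.toMonoidHom (Units.mk0 x hx) : Pˣ) : P) := rfl
    rw [this, cls_unit, cls_of_ne hx]
    rfl

lemma exists_pow_inv [Fact ℓ.Prime] {p : ℕ} (hp : (p : ZMod ℓ) ≠ 0) (n : ℕ) :
    ∃ m : ℕ, (((p ^ n * m : ℕ) : ZMod ℓ)) = ((1 : ℕ) : ZMod ℓ) :=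
  ⟨((p ^ n : ZMod ℓ)⁻¹).val, by
    push_cast
    rw [ZMod.natCast_val, ZMod.cast_id]
    exact mul_inv_cancel₀ (pow_ne_zero _ hp)⟩

lemma Cl_eq_of_pow_eq [Fact ℓ.Prime] {K : Type*} [Field K] {p : ℕ} (hp : (p : ZMod ℓ) ≠ 0)
    {n : ℕ} {c d : Cl ℓ K} (h : c ^ p ^ n = d ^ p ^ n) : c = d := by
  obtain ⟨m, hm⟩ := exists_pow_inv hp n
  calc c = c ^ (p ^ n * m) := by rw [Cl_pow_congr hm c, pow_one]
    _ = d ^ (p ^ n * m) := by rw [pow_mul, h, ← pow_mul]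
    _ = d := by rw [Cl_pow_congr hm d, pow_one]

variable {K P : Type*} [Field K] [Field P] [Algebra K P] [IsPurelyInseparable K P]

lemma clMap_bijective [Fact ℓ.Prime] {p : ℕ} [ExpChar K p] (hp : (p : ZMod ℓ) ≠ 0) :
    Function.Bijective (clMap ℓ (algebraMap K P)) := by
  constructor
  · rw [injective_iff_map_eq_one]
    intro c hc
    obtain ⟨x, hx, rfl⟩ := cls_surj c
    rw [clMap_cls, cls_eq_one_iff (by simpa using hx)] at hc
    obtain ⟨w, hw, h⟩ := hc
    obtain ⟨n, y, hy⟩ := IsPurelyInseparable.pow_mem K p w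
    refine Cl_eq_of_pow_eq hp (n := n) ?_
    rw [one_pow, ← cls_pow hx]
    have h' : x ^ p ^ n = y ^ ℓ := by
      apply (algebraMap K P).injective
      rw [_root_.map_pow, h, _root_.map_pow, hy, pow_right_comm]
    have hy0 : y ≠ 0 := by
      rintro rfl
      rw [_root_.map_zero] at hy
      exact pow_ne_zero _ hw hy.symm
    rw [h', cls_pow hy0, Cl_pow]
  · intro c
    obtain ⟨z, hz, rfl⟩ := cls_surj c
    obtain ⟨n, y, hy⟩ := IsPurelyInseparable.pow_mem K p z
    obtain ⟨m, hm⟩ := exists_pow_inv hp n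
    refine ⟨cls ℓ y ^ m, ?_⟩
    rw [_root_.map_pow, clMap_cls, hy, cls_pow hz, ← pow_mul, Cl_pow_congr hm, pow_one]

/-- The identification of `K1` of a field with the classes of a purely inseparable extension. -/
def clEquiv [Fact ℓ.Prime] (p : ℕ) [ExpChar K p] (P : Type*) [Field P] [Algebra K P]
    [IsPurelyInseparable K P] (hp : (p : ZMod ℓ) ≠ 0) : K1 ℓ K ≃* Cl ℓ P :=
  (toCl ℓ K).trans (MulEquiv.ofBijective _ (clMap_bijective (P := P) hp))

lemma clEquiv_proj [Fact ℓ.Prime] {p : ℕ} [ExpChar K p] (hp : (p : ZMod ℓ) ≠ 0) (u : Kˣ) :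
    clEquiv p P hp (K1proj ℓ K u) = cls ℓ (algebraMap K P u) := by
  rw [← clMap_cls, ← toCl_proj]
  rfl

lemma exists_pow_pair {p : ℕ} [ExpChar K p] (a b : P) :
    ∃ (n : ℕ) (x y : K), algebraMap K P x = a ^ p ^ n ∧ algebraMap K P y = b ^ p ^ n := by
  obtain ⟨n, x, hx⟩ := IsPurelyInseparable.pow_mem K p a
  obtain ⟨m, y, hy⟩ := IsPurelyInseparable.pow_mem K p b
  refine ⟨n + m, x ^ p ^ m, y ^ p ^ n, ?_, ?_⟩
  · rw [_root_.map_pow, hx, ← pow_mul, pow_add]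
  · rw [_root_.map_pow, hy, ← pow_mul, pow_add, mul_comm]

lemma isSt_comp_of_compatWithK2 [Fact ℓ.Prime] {p : ℕ} [ExpChar K p] [ExpChar P p]
    (hp : (p : ZMod ℓ) ≠ 0) {q : ℕ} {L Q : Type*} [Field L] [Field Q] [Algebra L Q]
    [IsPurelyInseparable L Q] [ExpChar L q] (hq : (q : ZMod ℓ) ≠ 0)
    {φ : K1 ℓ K ≃* K1 ℓ L} (h : CompatWithK2 ℓ φ) {Φ : Cl ℓ P ≃* Cl ℓ Q}
    (hΦ : ∀ c, Φ (clEquiv p P hp c) = clEquiv q Q hq (φ c)) {v w : KChar ℓ Q} (hvw : IsSt v w) :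
    IsSt (v.comap Φ) (w.comap Φ) := by
  obtain ⟨ψ, hψ⟩ := h
  obtain ⟨D, hD⟩ := exists_milnorKMod_lift (ℓ := ℓ) (K := L) (M := ZMod ℓ)
    (fun a b => v (cls ℓ (algebraMap L Q a)) * w (cls ℓ (algebraMap L Q b)) -
      w (cls ℓ (algebraMap L Q a)) * v (cls ℓ (algebraMap L Q b)))
    (fun a b c => by
      rw [Units.val_mul, _root_.map_mul, cls_mul (by simp) (by simp), v.map_mul, w.map_mul]; ring)
    (fun a b c => by
      rw [Units.val_mul, _root_.map_mul, cls_mul (by simp) (by simp), v.map_mul, w.map_mul]; ring)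
    (fun a b hab => sub_eq_zero.2 (hvw _ _ (by simp) (by simp) (by
      rw [← _root_.map_add, hab, _root_.map_one])))
    (fun m => by simp)
  intro a b ha hb hab
  obtain ⟨n, x, y, hx, hy⟩ := exists_pow_pair (K := K) (p := p) a b
  have hx0 : x ≠ 0 := by
    rintro rfl
    rw [_root_.map_zero] at hx
    exact pow_ne_zero _ ha hx.symm
  have hy0 : y ≠ 0 := by
    rintro rfl
    rw [_root_.map_zero] at hy
    exact pow_ne_zero _ hb hy.symm
  have hxy : x + y = 1 := by
    apply (algebraMap K P).injective
    rw [_root_.map_add, hx, hy, ← add_pow_expChar_pow, hab, one_pow, _root_.map_one]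
  obtain ⟨x', hx'⟩ := K1proj_surjective (φ (K1proj ℓ K (Units.mk0 x hx0)))
  obtain ⟨y', hy'⟩ := K1proj_surjective (φ (K1proj ℓ K (Units.mk0 y hy0)))
  have h0 := hψ _ _ _ _ hx'.symm hy'.symm
  rw [milnorSymbol_eq_zero (by simpa using hxy), _root_.map_zero] at h0
  have h1 := hD x' y'
  rw [← h0, _root_.map_zero] at h1
  have ex : cls ℓ (algebraMap L Q x') = Φ (cls ℓ a) ^ p ^ n := by
    rw [← clEquiv_proj hq, hx', ← hΦ, clEquiv_proj, Units.val_mk0, hx, cls_pow ha, _root_.map_pow]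
  have ey : cls ℓ (algebraMap L Q y') = Φ (cls ℓ b) ^ p ^ n := by
    rw [← clEquiv_proj hq, hy', ← hΦ, clEquiv_proj, Units.val_mk0, hy, cls_pow hb, _root_.map_pow]
  rw [ex, ey, v.map_pow, v.map_pow, w.map_pow, w.map_pow] at h1
  have hpn : ((p ^ n : ℕ) : ZMod ℓ) ≠ 0 := by
    push_cast
    exact pow_ne_zero _ hp
  simp only [KChar.comap_apply]
  refine mul_left_cancel₀ (mul_ne_zero hpn hpn) ?_
  linear_combination -h1

end ClMap

section Roots

variable {k K : Type*} [Field k] [Field K] [Algebra k K]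

lemma notMem_adjoin_of_pow_eq {u w : K} (hu : Transcendental k u) {r : ℕ} (hr : 2 ≤ r)
    (hw : w ^ r = u) : w ∉ k⟮u⟯ := by
  intro hmem
  obtain ⟨N, D, hD, hND⟩ := mem_adjoin_iff_exists_poly.1 hmem
  have hD0 : D ≠ 0 := by rintro rfl; simp at hD
  have h : X * D ^ r = N ^ r := by
    apply Transcendental.aeval_injective hu
    rw [_root_.map_mul, _root_.map_pow, _root_.map_pow, aeval_X, ← hND, mul_pow, hw]
  have h1 := congrArg natDegree h
  rw [natDegree_mul X_ne_zero (pow_ne_zero _ hD0), natDegree_X, natDegree_pow, natDegree_pow] at h1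
  have h2 : r ∣ 1 := (Nat.dvd_add_left (dvd_mul_right r D.natDegree)).1 (h1 ▸ dvd_mul_right r _)
  have := Nat.le_of_dvd one_pos h2
  omega

open scoped IntermediateField.algebraAdjoinAdjoin in
lemma exists_transcendental_isAlgebraic {s : K} (hs : Transcendental k s) :
    ∃ M : IntermediateField k K, Transcendental M s ∧ Algebra.IsAlgebraic M⟮s⟯ K := by
  have hs1 : AlgebraicIndepOn k id ({s} : Set K) := by
    have : AlgebraicIndependent k (fun i : ({s} : Set K) => (i : K)) := by
      rw [algebraicIndependent_unique_type_iff]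
      exact hs
    exact this
  obtain ⟨B, hB, hBt⟩ := exists_isTranscendenceBasis_superset hs1
  have hsB : s ∈ B := hB rfl
  refine ⟨adjoin k (B \ {s}), ?_, ⟨fun z => ?_⟩⟩
  · have h1 := hBt.1.transcendental_adjoin (s := {i : B | (i : K) ≠ s}) (i := ⟨s, hsB⟩) (by simp)
    have h2 : ((↑) : B → K) '' {i : B | (i : K) ≠ s} = B \ {s} := by
      ext z
      constructor
      · rintro ⟨i, hi, rfl⟩; exact ⟨i.2, hi⟩
      · rintro ⟨h, h'⟩; exact ⟨⟨z, h⟩, h', rfl⟩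
    rw [h2] at h1
    exact h1.extendScalars _
  · refine isAlgebraic_of_subset ?_ (hBt.isAlgebraic_field.isAlgebraic z)
    have : adjoin k (Set.range ((↑) : B → K)) ≤
        (adjoin (adjoin k (B \ {s})) {s}).restrictScalars k := by
      rw [adjoin_le_iff]
      rintro _ ⟨z, rfl⟩
      by_cases hz : (z : K) = s
      · rw [hz]
        exact mem_adjoin_simple_self _ s
      · exact (adjoin (adjoin k (B \ {s})) {s}).algebraMap_mem
          (⟨z, subset_adjoin _ _ ⟨z.2, hz⟩⟩ : adjoin k (B \ {s}))
    exact this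

/-- In a function field, no transcendental element has an infinite sequence of roots. -/
lemma not_exists_root_sequence (hK : IsFunctionField k K) {u : ℕ → K}
    (hu : Transcendental k (u 0)) {r : ℕ} (hr : 2 ≤ r) (h : ∀ n, u (n + 1) ^ r = u n) : False := by
  obtain ⟨M, hM, halg⟩ := exists_transcendental_isAlgebraic hu
  obtain ⟨S, hS⟩ := hK
  have hfin : FiniteDimensional M⟮u 0⟯ K := by
    have h1 : FiniteDimensional M⟮u 0⟯ (adjoin M⟮u 0⟯ (S : Set K)) :=
      finiteDimensional_adjoin fun x _ => (halg.isAlgebraic x).isIntegral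
    have h2 : adjoin M⟮u 0⟯ (S : Set K) = ⊤ := by
      rw [eq_top_iff]
      intro z _
      have h3 : adjoin k (S : Set K) ≤
          ((adjoin M⟮u 0⟯ (S : Set K)).restrictScalars M).restrictScalars k := by
        rw [adjoin_le_iff]
        exact fun z hz => subset_adjoin M⟮u 0⟯ (S : Set K) hz
      rw [hS] at h3
      exact h3 (mem_top (x := z))
    rw [h2] at h1
    exact Module.Finite.equiv (topEquiv (F := M⟮u 0⟯) (E := K)).toLinearEquiv
  have hr0 : r ≠ 0 := by omega
  have htr : ∀ n, Transcendental M (u n) := by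
    intro n
    induction n with
    | zero => exact hM
    | succ n ih => exact fun hc => ih (h n ▸ hc.pow r)
  have hmono : ∀ n, u n ∈ M⟮u (n + 1)⟯ := fun n => by
    rw [← h n]
    exact pow_mem (mem_adjoin_simple_self M _) r
  have hle : ∀ n, M⟮u n⟯ ≤ M⟮u (n + 1)⟯ := fun n => by
    rw [adjoin_simple_le_iff]
    exact hmono n
  have h0 : ∀ n, M⟮u 0⟯ ≤ M⟮u n⟯ := fun n => monotone_nat_of_le_succ hle (Nat.zero_le n)
  let f : ℕ →o Submodule M⟮u 0⟯ K :=
    ⟨fun n => (extendScalars (h0 n)).toSubalgebra.toSubmodule,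
      monotone_nat_of_le_succ fun n x hx => hle n hx⟩
  obtain ⟨n, hn⟩ := monotone_stabilizes_iff_noetherian.2 (inferInstance : IsNoetherian M⟮u 0⟯ K) f
  have h1 : u (n + 1) ∈ f (n + 1) := mem_adjoin_simple_self M _
  rw [← hn (n + 1) (Nat.le_succ n)] at h1
  exact notMem_adjoin_of_pow_eq (htr n) hr (h n) h1

lemma mem_or_mem_adjoin {p : ℕ} (hp' : p.Prime) {S r Z : K} (hS : Transcendental k S)
    (hr : r ^ p = S) (hZ : Z ∈ k⟮r⟯) : Z ∈ k⟮S⟯ ∨ r ∈ adjoin k⟮S⟯ {Z} := by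
  let S' : k⟮S⟯ := ⟨S, mem_adjoin_simple_self k S⟩
  have hirr : Irreducible (X ^ p - C S') :=
    X_pow_sub_C_irreducible_of_prime hp' fun b hb =>
      notMem_adjoin_of_pow_eq hS hp'.two_le (w := (b : K))
        (by simpa using congrArg Subtype.val hb) b.2
  have hmin : minpoly k⟮S⟯ r = X ^ p - C S' := by
    refine (minpoly.eq_of_irreducible_of_monic hirr ?_ (monic_X_pow_sub_C _ hp'.ne_zero)).symm
    rw [_root_.map_sub, _root_.map_pow, aeval_X, aeval_C, hr]
    exact sub_self S
  have h_integral : IsIntegral k⟮S⟯ r := by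
    by_contra h
    rw [minpoly.eq_zero h] at hmin
    exact hirr.ne_zero hmin.symm
  have hfr : Module.finrank k⟮S⟯ k⟮S⟯⟮r⟯ = p := by
    rw [adjoin.finrank h_integral, hmin, natDegree_X_pow_sub_C]
  have hsimple := isSimpleOrder_of_finrank_prime k⟮S⟯ k⟮S⟯⟮r⟯ (by rw [hfr]; exact hp')
  have hZr : Z ∈ k⟮S⟯⟮r⟯ := by
    have : k⟮r⟯ ≤ (k⟮S⟯⟮r⟯).restrictScalars k := by
      rw [adjoin_simple_le_iff]
      exact mem_adjoin_simple_self k⟮S⟯ r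
    exact this hZ
  let Z' : k⟮S⟯⟮r⟯ := ⟨Z, hZr⟩
  rcases eq_bot_or_eq_top (adjoin k⟮S⟯ {Z'}) with h | h
  · left
    rw [adjoin_simple_eq_bot_iff, IntermediateField.mem_bot] at h
    obtain ⟨w, hw⟩ := h
    rw [← show (w : K) = Z from congrArg Subtype.val hw]
    exact w.2
  · right
    have h1 : (⟨r, mem_adjoin_simple_self _ r⟩ : k⟮S⟯⟮r⟯) ∈ adjoin k⟮S⟯ {Z'} := h ▸ mem_top
    have h2 : r ∈ (adjoin k⟮S⟯ {Z'}).map (k⟮S⟯⟮r⟯).val := ⟨_, h1, rfl⟩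
    rw [adjoin_map, Set.image_singleton] at h2
    exact h2

end Roots

section Rational

variable {ℓ : ℕ} [Fact ℓ.Prime] {k K P : Type*} [Field k] [Field K] [Algebra k K] [Field P]
  [Algebra K P] [Algebra k P] [IsScalarTower k K P] [IsPurelyInseparable K P] [IsAlgClosed k]
  {p : ℕ} [ExpChar K p] [ExpChar P p]

omit [IsAlgClosed k] in
lemma isGeneralElement_transcendental [IsAlgClosed k] {t : K} (h : IsGeneralElement k t) :
    Transcendental k t := by
  rw [transcendental_iff_notMem_range]
  exact fun h' => h.1 (IntermediateField.mem_bot.2 h')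

omit [ExpChar P p] [Fact ℓ.Prime] in
lemma isGeneralElement_pGen {t : K} (h : IsGeneralElement k t) :
    PGen p k (algebraMap K P t) := by
  have ht := isGeneralElement_transcendental h
  refine ⟨(transcendental_algebraMap_iff (algebraMap K P).injective).2 ht, fun y hy => ?_⟩
  obtain ⟨n, x, hx⟩ := IsPurelyInseparable.pow_mem K p y
  refine ⟨n, ?_⟩
  have h1 := hy.pow (p ^ n)
  rw [← hx, isAlgebraic_adjoin_algebraMap_iff ht] at h1
  rw [← hx, mem_adjoin_algebraMap_iff]
  exact h.2 x h1

omit [IsAlgClosed k] [ExpChar P p] in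
lemma map_omega_eq (hp : (p : ZMod ℓ) ≠ 0) {t : K} :
    (Omega ℓ k⟮t⟯).map (clEquiv p P hp).toMonoidHom = RA ℓ k (algebraMap K P t) := by
  ext c
  constructor
  · rintro ⟨_, ⟨u, hu, rfl⟩, rfl⟩
    change clEquiv p P hp (K1proj ℓ K u) ∈ _
    rw [clEquiv_proj]
    refine cls_mem_RA_of_pow_mem (n := 0) hp ?_
    rw [pow_zero, pow_one, mem_adjoin_algebraMap_iff]
    exact hu
  · rintro ⟨f, hf, rfl⟩
    rw [aeval_algebraMap_apply] at hf ⊢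
    have hf' : aeval t f ≠ 0 := by rintro h; rw [h, _root_.map_zero] at hf; exact hf rfl
    refine ⟨_, ⟨Units.mk0 _ hf', ?_, rfl⟩, clEquiv_proj hp _⟩
    exact mem_adjoin_iff_exists_poly.2 ⟨f, 1, by simp, by simp⟩

omit [IsPurelyInseparable K P] in
lemma mem_adjoin_of_pow_mem [PerfectRing P p] (hp' : p.Prime) {s z : K}
    (hs : Transcendental k s) (hsp : ∀ u : K, u ^ p ≠ s) (hz : z ^ p ∈ k⟮s⟯) : z ∈ k⟮s⟯ := by
  set S := algebraMap K P s with hS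
  have hS' : Transcendental k S :=
    (transcendental_algebraMap_iff (algebraMap K P).injective).2 hs
  have : ExpChar k p :=
    (algebraMap k K).expChar (algebraMap k K).injective p
  obtain ⟨r, hr⟩ := (bijective_iterateFrobenius P p 1).2 S
  rw [iterateFrobenius_def, pow_one] at hr
  set Z := algebraMap K P z with hZ
  -- `z` is a rational function of the `p`-th root of `s`
  have hZr : Z ∈ k⟮r⟯ := by
    have h1 : Z ^ p ∈ k⟮S⟯ := by
      rw [hZ, ← _root_.map_pow, mem_adjoin_algebraMap_iff]
      exact hz
    have hle : (k⟮S⟯).toSubfield ≤ (k⟮r⟯).toSubfield.map (iterateFrobenius P p 1) := by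
      rw [adjoin_toSubfield, Subfield.closure_le, Set.union_subset_iff]
      constructor
      · rintro _ ⟨c, rfl⟩
        obtain ⟨d, rfl⟩ := IsAlgClosed.exists_pow_nat_eq c hp'.pos
        exact ⟨algebraMap k P d, (k⟮r⟯).algebraMap_mem d, by
          simp [frobenius_def]⟩
      · rintro _ rfl
        exact ⟨r, mem_adjoin_simple_self k r, by simp [frobenius_def, hr]⟩
    obtain ⟨w, hw, hwZ⟩ := hle h1
    have : w = Z := iterateFrobenius_inj P p 1 (by simpa [frobenius_def] using hwZ)
    exact this ▸ hw
  by_contra hcon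
  rw [← mem_adjoin_algebraMap_iff (A := P)] at hcon
  have h2 := (mem_or_mem_adjoin hp' hS' hr hZr).resolve_left hcon
  have h3 : (adjoin k⟮S⟯ {Z}).toSubfield ≤
      (algebraMap K P).fieldRange := by
    rw [adjoin_toSubfield, Subfield.closure_le, Set.union_subset_iff]
    constructor
    · rintro _ ⟨w, rfl⟩
      have h4 : (k⟮S⟯).toSubfield ≤ (algebraMap K P).fieldRange := by
        rw [adjoin_toSubfield, Subfield.closure_le, Set.union_subset_iff]
        constructor
        · rintro _ ⟨c, rfl⟩
          exact ⟨algebraMap k K c, (IsScalarTower.algebraMap_apply k K P c).symm⟩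
        · rintro _ rfl
          exact ⟨s, rfl⟩
      exact h4 w.2
    · rintro _ rfl
      exact ⟨z, rfl⟩
  obtain ⟨u, hu⟩ := h3 h2
  refine hsp u ((algebraMap K P).injective ?_)
  rw [_root_.map_pow, hu, hr]

omit [IsAlgClosed k] [ExpChar P p] in
lemma exists_not_pow (hK : IsFunctionField k K) {T : P} (hT : Transcendental k T) :
    ∃ (s : K) (m n : ℕ), algebraMap K P s ^ p ^ m = T ^ p ^ n ∧ (p ≠ 1 → ∀ u : K, u ^ p ≠ s) := by
  obtain ⟨n, s₀, hs₀⟩ := IsPurelyInseparable.pow_mem K p T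
  by_contra! hcon
  let R := {s : K // ∃ m n : ℕ, algebraMap K P s ^ p ^ m = T ^ p ^ n}
  have hp1 : p ≠ 1 := (hcon s₀ 0 n (by simpa using hs₀)).1
  have hnext : ∀ s : R, ∃ u : R, (u : K) ^ p = s := by
    rintro ⟨s, m, n, h⟩
    obtain ⟨u, hu⟩ := (hcon s m n h).2
    refine ⟨⟨u, m + 1, n, ?_⟩, hu⟩
    rw [← h, ← hu, _root_.map_pow, ← pow_mul, pow_succ']
  choose g hg using hnext
  let u : ℕ → R := fun j => g^[j] ⟨s₀, 0, n, by simpa using hs₀⟩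
  have hp2 : 2 ≤ p := by
    have := expChar_pos K p
    omega
  refine not_exists_root_sequence hK (u := fun j => (u j : K)) (r := p) ?_ hp2 fun j => ?_
  · change Transcendental k s₀
    rw [← transcendental_algebraMap_iff (algebraMap K P).injective, hs₀]
    exact hT.pow (expChar_pow_pos K p n)
  · simp only [u, Function.iterate_succ_apply']
    exact hg _

lemma exists_isRationalSubgroup [PerfectRing P p] (hp : (p : ZMod ℓ) ≠ 0)
    (hK : IsFunctionField k K) {T : P} (hT : PGen p k T) :
    ∃ A : Subgroup (K1 ℓ K), IsRationalSubgroup ℓ k A ∧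
      A.map (clEquiv p P hp).toMonoidHom = RA ℓ k T := by
  obtain ⟨s, m, n, hs, hsp⟩ := exists_not_pow (p := p) hK hT.1
  have h1 : algebraMap K P s ^ p ^ m ∈ k⟮T⟯ := by
    rw [hs]
    exact pow_mem (mem_adjoin_simple_self k T) _
  have h2 : T ^ p ^ n ∈ k⟮algebraMap K P s⟯ := by
    rw [← hs]
    exact pow_mem (mem_adjoin_simple_self k _) _
  have hS : PGen p k (algebraMap K P s) :=
    hT.of_pow_mem h2 (isAlgebraic_of_pow_mem h1)
  have hst : Transcendental k s :=
    (transcendental_algebraMap_iff (algebraMap K P).injective).1 hS.1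
  refine ⟨_, ⟨s, ⟨?_, fun y hy => ?_⟩, rfl⟩, ?_⟩
  · intro h
    rw [transcendental_iff_notMem_range] at hst
    exact hst (IntermediateField.mem_bot.1 h)
  · have hy' := (isAlgebraic_adjoin_algebraMap_iff (A := P) hst).2 hy
    obtain ⟨j, hj⟩ := hS.2 _ hy'
    rw [← _root_.map_pow, mem_adjoin_algebraMap_iff] at hj
    induction j with
    | zero => simpa using hj
    | succ j ih =>
      refine ih ?_
      rcases expChar_is_prime_or_one K p with h | h
      · refine mem_adjoin_of_pow_mem (P := P) h hst (hsp h.ne_one) ?_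
        rw [← pow_mul, ← pow_succ]
        exact hj
      · simpa [h] using hj
  · rw [map_omega_eq]
    exact le_antisymm (RA_le_of_isAlgebraic hp hT (isAlgebraic_of_pow_mem h1))
      (RA_le_of_isAlgebraic hp hS (isAlgebraic_of_pow_mem h2))

lemma isRationalSubgroup_iff [PerfectRing P p] (hp : (p : ZMod ℓ) ≠ 0)
    (hK : IsFunctionField k K) {A : Subgroup (K1 ℓ K)} :
    IsRationalSubgroup ℓ k A ↔
      ∃ T : P, PGen p k T ∧ A.map (clEquiv p P hp).toMonoidHom = RA ℓ k T := by
  constructor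
  · rintro ⟨t, ht, rfl⟩
    exact ⟨_, isGeneralElement_pGen ht, map_omega_eq hp⟩
  · rintro ⟨T, hT, hA⟩
    obtain ⟨B, hB, hBT⟩ := exists_isRationalSubgroup hp hK hT
    rwa [Subgroup.map_injective (clEquiv p P hp).injective (hA.trans hBT.symm)]

end Rational

section Reconstruction

lemma compatWithK2_symm {ℓ : ℕ} {K L : Type*} [Field K] [Field L] {φ : K1 ℓ K ≃* K1 ℓ L}
    (h : CompatWithK2 ℓ φ) : CompatWithK2 ℓ φ.symm := by
  obtain ⟨ψ, hψ⟩ := h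
  refine ⟨ψ.symm, fun a b a' b' ha hb => ?_⟩
  rw [AddEquiv.symm_apply_eq]
  exact (hψ _ _ _ _ (φ.symm_apply_eq.1 ha).symm (φ.symm_apply_eq.1 hb).symm).symm

lemma compatWithRat_symm {ℓ : ℕ} {k K l L : Type*} [Field k] [Field K] [Algebra k K] [Field l]
    [Field L] [Algebra l L] {φ : K1 ℓ K ≃* K1 ℓ L} (h : CompatWithRat ℓ k l φ) :
    CompatWithRat ℓ l k φ.symm := by
  refine ⟨fun B hB => ?_, fun A hA => ⟨_, h.1 A hA, ?_⟩⟩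
  · obtain ⟨A, hA, rfl⟩ := h.2 B hB
    convert hA
    ext c
    rw [Subgroup.mem_map_equiv]
    simp
  · ext c
    rw [Subgroup.mem_map_equiv]
    simp

lemma mem_map_mulEquiv {G H : Type*} [Group G] [Group H] (e : G ≃* H) {A : Subgroup G} {c : G} :
    e c ∈ A.map e.toMonoidHom ↔ c ∈ A := by
  rw [Subgroup.mem_map_equiv, MulEquiv.symm_apply_apply]

variable {ℓ : ℕ} [Fact ℓ.Prime] {k K P : Type*} [Field k] [Field K] [Algebra k K] [Field P]
  [Algebra K P] [Algebra k P] [IsScalarTower k K P] [IsPurelyInseparable K P] [IsAlgClosed k]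
  {p : ℕ} [ExpChar K p] [ExpChar P p] [PerfectRing P p]
  {l L Q : Type*} [Field l] [Field L] [Algebra l L] [Field Q]
  [Algebra L Q] [Algebra l Q] [IsScalarTower l L Q] [IsPurelyInseparable L Q] [IsAlgClosed l]
  {q : ℕ} [ExpChar L q] [ExpChar Q q] [PerfectRing Q q]

omit [IsAlgClosed k] [ExpChar P p] [PerfectRing P p] in
lemma exists_finset_pow_mem (hK : IsFunctionField k K) :
    ∃ s : Finset P, ∀ z, ∃ n, z ^ p ^ n ∈ adjoin k (s : Set P) := by
  classical
  obtain ⟨S, hS⟩ := hK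
  refine ⟨S.image (algebraMap K P), fun z => ?_⟩
  obtain ⟨n, x, hx⟩ := IsPurelyInseparable.pow_mem K p z
  refine ⟨n, ?_⟩
  have h1 : x ∈ adjoin k (S : Set K) := hS ▸ IntermediateField.mem_top
  have h2 : algebraMap K P x ∈ (adjoin k (S : Set K)).map (IsScalarTower.toAlgHom k K P) :=
    ⟨x, h1, rfl⟩
  rw [adjoin_map] at h2
  rw [← hx, Finset.coe_image]
  exact h2

omit [PerfectRing Q q] [ExpChar Q q] in
lemma exists_rat_correspondence (hp : (p : ZMod ℓ) ≠ 0) (hq : (q : ZMod ℓ) ≠ 0)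
    (hK : IsFunctionField k K) {φ : K1 ℓ K ≃* K1 ℓ L} (hφ : CompatWithRat ℓ k l φ)
    {Φ : Cl ℓ P ≃* Cl ℓ Q} (hΦ : ∀ c, Φ (clEquiv p P hp c) = clEquiv q Q hq (φ c))
    {x : P} (hx : PGen p k x) :
    ∃ x' : Q, PGen q l x' ∧ ∀ c, c ∈ RA ℓ k x ↔ Φ c ∈ RA ℓ l x' := by
  obtain ⟨A, hA, hAx⟩ := exists_isRationalSubgroup hp hK hx
  obtain ⟨t, ht, hAt⟩ := hφ.1 A hA
  refine ⟨algebraMap L Q t, isGeneralElement_pGen ht, fun c => ?_⟩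
  obtain ⟨c, rfl⟩ := (clEquiv (K := K) p P hp).surjective c
  rw [hΦ, ← hAx, ← map_omega_eq (K := L) (P := Q) hq, ← hAt, mem_map_mulEquiv, mem_map_mulEquiv, mem_map_mulEquiv]

theorem nonempty_ringEquiv_of_compat (hp : (p : ZMod ℓ) ≠ 0) (hq : (q : ZMod ℓ) ≠ 0)
    (hK : IsFunctionField k K) (hL : IsFunctionField l L) (htr : ∃ x y : K, Indep k x y)
    {φ : K1 ℓ K ≃* K1 ℓ L} (h2 : CompatWithK2 ℓ φ) (hrat : CompatWithRat ℓ k l φ) :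
    Nonempty (P ≃+* Q) := by
  let Φ : Cl ℓ P ≃* Cl ℓ Q := ((clEquiv p P hp).symm.trans φ).trans (clEquiv q Q hq)
  have hΦ : ∀ c, Φ (clEquiv p P hp c) = clEquiv q Q hq (φ c) := fun c => by simp [Φ]
  have hΦ' : ∀ c, Φ.symm (clEquiv q Q hq c) = clEquiv p P hp (φ.symm c) := fun c => by simp [Φ]
  have hrat' := compatWithRat_symm hrat
  obtain ⟨x₀, y₀, hxy₀⟩ := htr
  have hxy : Indep k (algebraMap K P x₀) (algebraMap K P y₀) := indep_algebraMap_iff.2 hxy₀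
  have coreF : Core ℓ p k P := ⟨hp, exists_finset_pow_mem hK, ⟨_, _, hxy⟩⟩
  have coreG : Core ℓ q l Q := by
    refine ⟨hq, exists_finset_pow_mem hL, ?_⟩
    have h := pGen_pencil coreF.fg hxy
    have : Infinite k := IsAlgClosed.instInfinite
    obtain ⟨c, hc⟩ := h.exists
    obtain ⟨c', hc', hne⟩ := (h.and (Set.finite_singleton c).eventually_cofinite_notMem).exists
    have hi := hxy.linear (c := c) (c' := c') (fun h => hne h.symm)
    obtain ⟨x, hx, hx'⟩ := exists_rat_correspondence hp hq hK hrat hΦ hc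
    obtain ⟨y, hy, hy'⟩ := exists_rat_correspondence hp hq hK hrat hΦ hc'
    refine ⟨x, y, indep_of_RA_ne hq hx hy fun heq => RA_ne_of_indep coreF hi ?_⟩
    ext c
    rw [hx', hy', heq]
  have H : Compat p q k l Φ :=
    { coreF := coreF
      coreG := coreG
      st := fun v w h => isSt_comp_of_compatWithK2 hp hq h2 hΦ h
      st' := fun v w h => isSt_comp_of_compatWithK2 hq hp (compatWithK2_symm h2) hΦ' h
      rat := fun x hx => exists_rat_correspondence hp hq hK hrat hΦ hx
      rat' := fun x' hx' => by
        obtain ⟨x, hx, h⟩ := exists_rat_correspondence hq hp hL hrat' hΦ' hx'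
        exact ⟨x, hx, fun c => by rw [h, MulEquiv.symm_apply_apply]⟩ }
  exact H.nonempty_ringEquiv

end Reconstruction

section Transport

lemma exists_pow_mul_eq {ℓ p : ℕ} [Fact ℓ.Prime] (hp : (p : ZMod ℓ) ≠ 0) (n : ℕ) :
    ∃ m d : ℕ, p ^ n * m = 1 + ℓ * d := by
  obtain ⟨m, hm⟩ := exists_pow_inv hp n
  have h1 := (ZMod.natCast_eq_natCast_iff _ _ _).1 hm
  have hpos : 1 ≤ p ^ n * m := by
    by_contra h0
    rw [Nat.lt_one_iff.1 (not_le.1 h0), Nat.cast_zero, Nat.cast_one] at hm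
    exact zero_ne_one hm
  obtain ⟨d, hd⟩ := (Nat.modEq_iff_dvd' hpos).1 h1.symm
  exact ⟨m, d, by omega⟩

lemma milnorKMod_eq_zero_of_nsmul {ℓ p : ℕ} [Fact ℓ.Prime] (hp : (p : ZMod ℓ) ≠ 0) {n : ℕ}
    {L : Type*} [Field L] {x : MilnorKMod ℓ 2 L} (h : p ^ n • x = 0) : x = 0 := by
  obtain ⟨m, d, hmd⟩ := exists_pow_mul_eq hp n
  have h1 : (p ^ n * m) • x = 0 := by rw [mul_comm, mul_nsmul', h, nsmul_zero]
  rwa [hmd, add_nsmul, one_nsmul, mul_comm, mul_nsmul', milnorKMod_nsmul, nsmul_zero,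
    add_zero] at h1

lemma mem_fieldRange_of_pow {ℓ q : ℕ} [Fact ℓ.Prime] (hq : (q : ZMod ℓ) ≠ 0)
    {L Q : Type*} [Field L] [Field Q] [Algebra L Q] {u : Q} {n : ℕ}
    (h1 : u ^ ℓ ∈ (algebraMap L Q).fieldRange) (h2 : u ^ q ^ n ∈ (algebraMap L Q).fieldRange) :
    u ∈ (algebraMap L Q).fieldRange := by
  rcases eq_or_ne u 0 with rfl | hu
  · exact zero_mem _
  obtain ⟨m, d, hmd⟩ := exists_pow_mul_eq hq n
  have : u = (u ^ q ^ n) ^ m / (u ^ ℓ) ^ d := by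
    rw [eq_div_iff (by positivity), ← pow_mul, ← pow_mul, hmd, pow_add, pow_one]
  rw [this]
  exact div_mem (pow_mem h2 _) (pow_mem h1 _)

/-- An algebraically closed subfield of a perfect closure of a function field lies in the field of
constants. -/
lemma mem_range_of_isAlgClosed {ℓ q : ℕ} [Fact ℓ.Prime] (hq : (q : ZMod ℓ) ≠ 0)
    {l L Q k : Type*} [Field l] [Field L] [Algebra l L] [Field Q] [Algebra L Q] [Algebra l Q]
    [IsScalarTower l L Q] [IsPurelyInseparable L Q] [IsAlgClosed l] [ExpChar L q]
    (hL : IsFunctionField l L) [Field k] [IsAlgClosed k] (f : k →+* Q) (c : k) :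
    f c ∈ Set.range (algebraMap l Q) := by
  by_contra hc
  have hℓ := (Fact.out : ℓ.Prime)
  obtain ⟨n, s, hs⟩ := IsPurelyInseparable.pow_mem L q (f c)
  have hroot : ∀ x : k, ∃ z, z ^ ℓ = x := fun x => IsAlgClosed.exists_pow_nat_eq x hℓ.pos
  choose g hg using hroot
  let v : ℕ → k := fun j => g^[j] (c ^ q ^ n)
  have hv : ∀ j, v (j + 1) ^ ℓ = v j := fun j => by
    simp only [v, Function.iterate_succ_apply']
    exact hg _
  have hmem : ∀ j, f (v j) ∈ (algebraMap L Q).fieldRange := by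
    intro j
    induction j with
    | zero => exact ⟨s, by rw [hs]; simp [v]⟩
    | succ j ih =>
      obtain ⟨m, y, hy⟩ := IsPurelyInseparable.pow_mem L q (f (v (j + 1)))
      exact mem_fieldRange_of_pow hq (by rwa [← _root_.map_pow, hv]) ⟨y, hy⟩
  choose w hw using hmem
  refine not_exists_root_sequence hL (u := w) ?_ hℓ.two_le fun j => ?_
  · rw [← transcendental_algebraMap_iff (algebraMap L Q).injective, hw]
    simp only [v, Function.iterate_zero, id_eq, _root_.map_pow]
    exact (transcendental_iff_notMem_range.2 hc).pow (expChar_pow_pos L q n)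
  · apply (algebraMap L Q).injective
    rw [_root_.map_pow, hw, hw, ← _root_.map_pow, hv]

section Constants

variable {k P l Q : Type*} [Field k] [Field P] [Algebra k P] [Field l] [Field Q] [Algebra l Q]

lemma exists_map_aeval {σ : P →+* Q}
    (h : ∀ c, σ (algebraMap k P c) ∈ Set.range (algebraMap l Q)) (f : k[X]) :
    ∃ g : l[X], ∀ T, σ (aeval T f) = aeval (σ T) g := by
  induction f using Polynomial.induction_on' with
  | add f₁ f₂ h₁ h₂ =>
    obtain ⟨g₁, h₁⟩ := h₁
    obtain ⟨g₂, h₂⟩ := h₂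
    exact ⟨g₁ + g₂, fun T => by simp [h₁, h₂]⟩
  | monomial n c =>
    obtain ⟨d, hd⟩ := h c
    exact ⟨monomial n d, fun T => by simp [aeval_monomial, hd]⟩

lemma map_mem_adjoin {σ : P →+* Q}
    (h : ∀ c, σ (algebraMap k P c) ∈ Set.range (algebraMap l Q)) {T y : P} (hy : y ∈ k⟮T⟯) :
    σ y ∈ l⟮σ T⟯ := by
  obtain ⟨N, D, hD, hND⟩ := mem_adjoin_iff_exists_poly.1 hy
  obtain ⟨N', hN⟩ := exists_map_aeval h N
  obtain ⟨D', hD'⟩ := exists_map_aeval h D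
  refine mem_adjoin_iff_exists_poly.2 ⟨N', D', ?_, ?_⟩
  · rwa [← hD', _root_.map_ne_zero]
  · rw [← hD', ← hN, ← _root_.map_mul, hND]

lemma clMap_mem_RA {ℓ : ℕ} [Fact ℓ.Prime] {σ : P →+* Q}
    (h : ∀ c, σ (algebraMap k P c) ∈ Set.range (algebraMap l Q)) {T : P} {c : Cl ℓ P}
    (hc : c ∈ RA ℓ k T) : clMap ℓ σ c ∈ RA ℓ l (σ T) := by
  obtain ⟨f, hf, rfl⟩ := hc
  obtain ⟨g, hg⟩ := exists_map_aeval h f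
  exact ⟨g, by rwa [← hg, _root_.map_ne_zero], by rw [← hg, clMap_cls]⟩

lemma PGen.map_ringEquiv {p : ℕ} [IsAlgClosed k] [IsAlgClosed l] {σ : P ≃+* Q}
    (h : ∀ c, σ (algebraMap k P c) ∈ Set.range (algebraMap l Q))
    (h' : ∀ c, σ.symm (algebraMap l Q c) ∈ Set.range (algebraMap k P)) {T : P}
    (hT : PGen p k T) : PGen p l (σ T) := by
  refine ⟨transcendental_iff_notMem_range.2 ?_, fun y hy => ?_⟩
  · rintro ⟨d, hd⟩
    obtain ⟨c, hc⟩ := h' d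
    refine transcendental_iff_notMem_range.1 hT.1 ⟨c, ?_⟩
    rw [hc, hd, RingEquiv.symm_apply_apply]
  · have hmem : ∀ z ∈ k⟮T⟯, σ z ∈ l⟮σ T⟯ := fun z hz => map_mem_adjoin (σ := (σ : P →+* Q)) h hz
    have hmem' : ∀ z ∈ l⟮σ T⟯, σ.symm z ∈ k⟮T⟯ := fun z hz => by
      have := map_mem_adjoin (σ := (σ.symm : Q →+* P)) h' hz
      simpa using this
    have halg : IsAlgebraic k⟮T⟯ (σ.symm y) :=
      hy.ringHom_of_comp_eq ((σ.symm : Q →+* P).restrict l⟮σ T⟯ k⟮T⟯ hmem') (σ.symm : Q →+* P)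
        (RingHom.injective _) rfl
    obtain ⟨n, hn⟩ := hT.2 _ halg
    refine ⟨n, ?_⟩
    have := hmem _ hn
    rwa [_root_.map_pow, RingEquiv.apply_symm_apply] at this

/-- The isomorphism on classes induced by an isomorphism of fields. -/
def clMapEquiv (ℓ : ℕ) (σ : P ≃+* Q) : Cl ℓ P ≃* Cl ℓ Q :=
  MonoidHom.toMulEquiv (clMap ℓ (σ : P →+* Q)) (clMap ℓ (σ.symm : Q →+* P))
    (by
      ext c
      obtain ⟨x, hx, rfl⟩ := cls_surj c
      simp [clMap_cls])
    (by
      ext c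
      obtain ⟨x, hx, rfl⟩ := cls_surj c
      simp [clMap_cls])

end Constants

section Induced

variable {ℓ : ℕ} [Fact ℓ.Prime] {K P L Q : Type*} [Field K] [Field P] [Algebra K P]
  [IsPurelyInseparable K P] {p : ℕ} [ExpChar K p] [Field L] [Field Q] [Algebra L Q]
  [IsPurelyInseparable L Q] [ExpChar L p]

lemma exists_milnorKMod_map [ExpChar Q p] (hp : (p : ZMod ℓ) ≠ 0) {σ : P ≃+* Q}
    {φ : K1 ℓ K ≃* K1 ℓ L}
    (hφ : ∀ c, clEquiv p Q hp (φ c) = clMapEquiv ℓ σ (clEquiv p P hp c)) :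
    ∃ D : MilnorKMod ℓ 2 K →+ MilnorKMod ℓ 2 L, ∀ (a b : Kˣ) (a' b' : Lˣ),
      φ (K1proj ℓ K a) = K1proj ℓ L a' → φ (K1proj ℓ K b) = K1proj ℓ L b' →
        D (milnorSymbol ℓ ![a, b]) = milnorSymbol ℓ ![a', b'] := by
  choose s hs using fun a : Kˣ => K1proj_surjective (φ (K1proj ℓ K a))
  have hmul : ∀ a b, K1proj ℓ L (s (a * b)) = K1proj ℓ L (s a * s b) := fun a b => by
    rw [hs, _root_.map_mul, _root_.map_mul, _root_.map_mul, hs, hs]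
  have hcls : ∀ a : Kˣ, cls ℓ (algebraMap L Q (s a)) = cls ℓ (σ (algebraMap K P a)) := fun a => by
    rw [← clEquiv_proj hp, hs, hφ, clEquiv_proj]
    exact clMap_cls _ _
  have hst : ∀ a b : Kˣ, (a : K) + b = 1 → milnorSymbol ℓ ![s a, s b] = 0 := by
    intro a b hab
    obtain ⟨n, x, y, hx, hy⟩ := exists_pow_pair (K := L) (p := p) (σ (algebraMap K P a))
      (σ (algebraMap K P b))
    have ha0 : σ (algebraMap K P a) ≠ 0 := by simp
    have hb0 : σ (algebraMap K P b) ≠ 0 := by simp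
    have hx0 : x ≠ 0 := by
      rintro rfl
      rw [_root_.map_zero] at hx
      exact pow_ne_zero _ ha0 hx.symm
    have hy0 : y ≠ 0 := by
      rintro rfl
      rw [_root_.map_zero] at hy
      exact pow_ne_zero _ hb0 hy.symm
    have hxy : x + y = 1 := by
      apply (algebraMap L Q).injective
      rw [_root_.map_add, hx, hy, ← add_pow_expChar_pow, ← _root_.map_add, ← _root_.map_add, hab]
      simp
    have key : ∀ (c : Kˣ) (z : Lˣ), algebraMap L Q z = σ (algebraMap K P c) ^ p ^ n →
        K1proj ℓ L z = K1proj ℓ L (s c ^ p ^ n) := fun c z hz => by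
      apply (clEquiv p Q hp).injective
      rw [clEquiv_proj, clEquiv_proj, hz, Units.val_pow_eq_pow_val, _root_.map_pow,
        cls_pow (by simp), cls_pow (by simp), hcls]
    have h0 := milnorSymbol_eq_zero (ℓ := ℓ) (a := Units.mk0 x hx0) (b := Units.mk0 y hy0) hxy
    rw [milnorSymbol_congr (key a _ hx) (key b _ hy), milnorSymbol_pow_left,
      milnorSymbol_pow_right] at h0
    exact milnorKMod_eq_zero_of_nsmul hp (milnorKMod_eq_zero_of_nsmul hp h0)
  obtain ⟨D, hD⟩ := exists_milnorKMod_lift (ℓ := ℓ) (K := K) (M := MilnorKMod ℓ 2 L)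
    (fun a b => milnorSymbol ℓ ![s a, s b])
    (fun a b c => by rw [milnorSymbol_congr (hmul a b) rfl, milnorSymbol_mul_left])
    (fun a b c => by rw [milnorSymbol_congr rfl (hmul b c), milnorSymbol_mul_right])
    hst milnorKMod_torsion
  refine ⟨D, fun a b a' b' ha hb => ?_⟩
  rw [hD]
  exact milnorSymbol_congr ((hs a).trans ha) ((hs b).trans hb)

lemma symm_clMapEquiv_compat (hp : (p : ZMod ℓ) ≠ 0) {σ : P ≃+* Q} {φ : K1 ℓ K ≃* K1 ℓ L}
    (hφ : ∀ c, clEquiv p Q hp (φ c) = clMapEquiv ℓ σ (clEquiv p P hp c)) (c : K1 ℓ L) :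
    clEquiv p P hp (φ.symm c) = clMapEquiv ℓ σ.symm (clEquiv p Q hp c) := by
  change _ = (clMapEquiv ℓ σ).symm _
  rw [MulEquiv.eq_symm_apply, ← hφ, MulEquiv.apply_symm_apply]

lemma compatWithK2_of_ringEquiv [ExpChar P p] [ExpChar Q p] (hp : (p : ZMod ℓ) ≠ 0) {σ : P ≃+* Q}
    {φ : K1 ℓ K ≃* K1 ℓ L}
    (hφ : ∀ c, clEquiv p Q hp (φ c) = clMapEquiv ℓ σ (clEquiv p P hp c)) : CompatWithK2 ℓ φ := by
  obtain ⟨D, hD⟩ := exists_milnorKMod_map hp hφ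
  obtain ⟨E, hE⟩ := exists_milnorKMod_map hp (symm_clMapEquiv_compat hp hφ)
  refine ⟨D.toAddEquiv E (milnorKMod_hom_ext fun a b => ?_) (milnorKMod_hom_ext fun a b => ?_), hD⟩
  · obtain ⟨a', ha'⟩ := K1proj_surjective (φ (K1proj ℓ K a))
    obtain ⟨b', hb'⟩ := K1proj_surjective (φ (K1proj ℓ K b))
    simp only [AddMonoidHom.comp_apply, AddMonoidHom.id_apply]
    rw [hD _ _ _ _ ha'.symm hb'.symm]
    exact hE _ _ _ _ (by rw [ha', MulEquiv.symm_apply_apply])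
      (by rw [hb', MulEquiv.symm_apply_apply])
  · obtain ⟨a', ha'⟩ := K1proj_surjective (φ.symm (K1proj ℓ L a))
    obtain ⟨b', hb'⟩ := K1proj_surjective (φ.symm (K1proj ℓ L b))
    simp only [AddMonoidHom.comp_apply, AddMonoidHom.id_apply]
    rw [hE _ _ _ _ ha'.symm hb'.symm]
    exact hD _ _ _ _ (by rw [ha', MulEquiv.apply_symm_apply])
      (by rw [hb', MulEquiv.apply_symm_apply])

variable {k l : Type*} [Field k] [Algebra k K] [Algebra k P] [IsScalarTower k K P] [IsAlgClosed k]
  [Field l] [Algebra l L] [Algebra l Q] [IsScalarTower l L Q] [IsAlgClosed l]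
  [ExpChar P p] [PerfectRing P p] [ExpChar Q p] [PerfectRing Q p]

lemma isRationalSubgroup_map_of_ringEquiv (hp : (p : ZMod ℓ) ≠ 0) (hK : IsFunctionField k K)
    (hL : IsFunctionField l L) {σ : P ≃+* Q} {φ : K1 ℓ K ≃* K1 ℓ L}
    (hφ : ∀ c, clEquiv p Q hp (φ c) = clMapEquiv ℓ σ (clEquiv p P hp c)) {A : Subgroup (K1 ℓ K)}
    (hA : IsRationalSubgroup ℓ k A) : IsRationalSubgroup ℓ l (A.map φ.toMonoidHom) := by
  have h : ∀ c, σ (algebraMap k P c) ∈ Set.range (algebraMap l Q) :=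
    mem_range_of_isAlgClosed hp hL ((σ : P →+* Q).comp (algebraMap k P))
  have h' : ∀ c, σ.symm (algebraMap l Q c) ∈ Set.range (algebraMap k P) :=
    mem_range_of_isAlgClosed hp hK ((σ.symm : Q →+* P).comp (algebraMap l Q))
  obtain ⟨T, hT, hAT⟩ := (isRationalSubgroup_iff (P := P) hp hK).1 hA
  refine (isRationalSubgroup_iff (P := Q) hp hL).2 ⟨σ T, hT.map_ringEquiv h h', ?_⟩
  ext d
  obtain ⟨c, rfl⟩ := (clEquiv (K := L) p Q hp).surjective d
  obtain ⟨c, rfl⟩ := φ.surjective c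
  rw [mem_map_mulEquiv, mem_map_mulEquiv, hφ, ← mem_map_mulEquiv (clEquiv (K := K) p P hp), hAT]
  refine ⟨fun hc => clMap_mem_RA (σ := (σ : P →+* Q)) h hc, fun hc => ?_⟩
  have := clMap_mem_RA (σ := (σ.symm : Q →+* P)) h' hc
  have h2 : clMap ℓ (σ.symm : Q →+* P) (clMapEquiv ℓ σ (clEquiv p P hp c)) = clEquiv p P hp c :=
    (clMapEquiv ℓ σ).symm_apply_apply _
  rw [h2] at this
  simpa using this

lemma compatWithRat_of_ringEquiv (hp : (p : ZMod ℓ) ≠ 0) (hK : IsFunctionField k K)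
    (hL : IsFunctionField l L) {σ : P ≃+* Q} {φ : K1 ℓ K ≃* K1 ℓ L}
    (hφ : ∀ c, clEquiv p Q hp (φ c) = clMapEquiv ℓ σ (clEquiv p P hp c)) :
    CompatWithRat ℓ k l φ := by
  refine ⟨fun A hA => isRationalSubgroup_map_of_ringEquiv hp hK hL hφ hA, fun B hB =>
    ⟨_, isRationalSubgroup_map_of_ringEquiv hp hL hK (symm_clMapEquiv_compat hp hφ) hB, ?_⟩⟩
  ext c
  rw [Subgroup.mem_map_equiv]
  simp

theorem exists_compat_of_ringEquiv (hp : (p : ZMod ℓ) ≠ 0) (hK : IsFunctionField k K)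
    (hL : IsFunctionField l L) (σ : P ≃+* Q) :
    ∃ φ : K1 ℓ K ≃* K1 ℓ L, CompatWithK2 ℓ φ ∧ CompatWithRat ℓ k l φ := by
  let φ : K1 ℓ K ≃* K1 ℓ L :=
    ((clEquiv p P hp).trans (clMapEquiv ℓ σ)).trans (clEquiv p Q hp).symm
  have hφ : ∀ c, clEquiv p Q hp (φ c) = clMapEquiv ℓ σ (clEquiv p P hp c) := fun c => by simp [φ]
  exact ⟨φ, compatWithK2_of_ringEquiv hp hφ, compatWithRat_of_ringEquiv hp hK hL hφ⟩

end Induced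

lemma expChar_cast_ne_zero {ℓ : ℕ} (hℓ : ℓ.Prime) {k : Type*} [Field k] {p : ℕ} [ExpChar k p]
    (h : ringChar k ≠ ℓ) : (p : ZMod ℓ) ≠ 0 := by
  have : Fact ℓ.Prime := ⟨hℓ⟩
  rcases (inferInstance : ExpChar k p) with _ | hp
  · simp
  · rw [ne_eq, ZMod.natCast_eq_zero_iff, Nat.prime_dvd_prime_iff_eq hℓ hp]
    rintro rfl
    exact h (ringChar.eq k ℓ)

lemma TrdegGe.exists_indep {k K : Type*} [Field k] [Field K] [Algebra k K] {m : ℕ} (hm : 2 ≤ m)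
    (h : TrdegGe k K m) : ∃ x y : K, Indep k x y := by
  obtain ⟨x, hx⟩ := h
  refine ⟨x ⟨0, by omega⟩, x ⟨1, by omega⟩, indep_iff_algebraicIndependent.2 ?_⟩
  convert hx.comp ![⟨0, by omega⟩, ⟨1, by omega⟩] ?_ using 1
  · ext i
    fin_cases i <;> rfl
  · intro i j hij
    fin_cases i <;> fin_cases j <;> simp_all

/-- The perfect closure inside an algebraic closure. -/
def perfectClosureOf (K : Type u) [Field K] : PerfectClosureOf K where
  carrier := perfectClosure K (AlgebraicClosure K)
  purelyInseparable := inferInstance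
  perfect := inferInstance

/-- Isomorphisms of perfect closures exist if and only if compatible isomorphisms of the first mod-`ℓ`
Milnor K-groups exist. -/
theorem nonempty_ringEquiv_iff_exists_compat {ℓ : ℕ} [Fact ℓ.Prime] {k K : Type u} {l L : Type v}
    [Field k] [Field K] [Algebra k K] [IsAlgClosed k] [Field l] [Field L] [Algebra l L]
    [IsAlgClosed l] (hk : ringChar k ≠ ℓ) (hl : ringChar l ≠ ℓ) (hK : IsFunctionField k K)
    (hL : IsFunctionField l L) (htr : ∃ x y : K, Indep k x y) (PK : PerfectClosureOf K)
    (PL : PerfectClosureOf L) :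
    Nonempty (PK.carrier ≃+* PL.carrier) ↔
      ∃ φ : K1 ℓ K ≃* K1 ℓ L, CompatWithK2 ℓ φ ∧ CompatWithRat ℓ k l φ := by
  obtain ⟨p, hkp⟩ := ExpChar.exists k
  obtain ⟨q, hlq⟩ := ExpChar.exists l
  have hp : (p : ZMod ℓ) ≠ 0 := expChar_cast_ne_zero (ℓ := ℓ) Fact.out hk
  have hq : (q : ZMod ℓ) ≠ 0 := expChar_cast_ne_zero (ℓ := ℓ) Fact.out hl
  let : Algebra k PK.carrier := ((algebraMap K PK.carrier).comp (algebraMap k K)).toAlgebra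
  let : Algebra l PL.carrier := ((algebraMap L PL.carrier).comp (algebraMap l L)).toAlgebra
  have : IsScalarTower k K PK.carrier := .of_algebraMap_eq fun _ => rfl
  have : IsScalarTower l L PL.carrier := .of_algebraMap_eq fun _ => rfl
  have := PK.purelyInseparable
  have := PL.purelyInseparable
  have := PK.perfect
  have := PL.perfect
  have : ExpChar K p := expChar_of_injective_algebraMap (algebraMap k K).injective p
  have : ExpChar L q := expChar_of_injective_algebraMap (algebraMap l L).injective q
  have : ExpChar PK.carrier p :=
    expChar_of_injective_algebraMap (algebraMap K PK.carrier).injective p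
  have : ExpChar PL.carrier q :=
    expChar_of_injective_algebraMap (algebraMap L PL.carrier).injective q
  constructor
  · rintro ⟨σ⟩
    have : ExpChar PL.carrier p :=
        expChar_of_injective_ringHom (f := (σ : PK.carrier →+* PL.carrier)) σ.injective p
    obtain rfl : p = q := ExpChar.eq ‹_› ‹_›
    exact exists_compat_of_ringEquiv hp hK hL σ
  · rintro ⟨φ, h2, hrat⟩
    exact nonempty_ringEquiv_of_compat hp hq hK hL htr h2 hrat

end Transport

end MilnorRec

theorem statement_18 (ℓ : ℕ) (hℓ : ℓ.Prime)
    (k : Type u) (K : Type u) (l : Type v) (L : Type v)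
    [Field k] [Field K] [Algebra k K] [IsAlgClosed k]
    [Field l] [Field L] [Algebra l L] [IsAlgClosed l]
    (hchark : ringChar k ≠ ℓ) (hcharl : ringChar l ≠ ℓ)
    (hK : IsFunctionField k K) (hL : IsFunctionField l L)
    (htr : TrdegGe k K 5) :
    (∃ (PK : PerfectClosureOf K) (PL : PerfectClosureOf L),
        Nonempty (PK.carrier ≃+* PL.carrier)) ↔
      (∃ φ : K1 ℓ K ≃* K1 ℓ L, CompatWithK2 ℓ φ ∧ CompatWithRat ℓ k l φ) := by
  have : Fact ℓ.Prime := ⟨hℓ⟩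
  have main := MilnorRec.nonempty_ringEquiv_iff_exists_compat hchark hcharl hK hL
    (MilnorRec.TrdegGe.exists_indep (by norm_num) htr)
  exact ⟨fun ⟨PK, PL, h⟩ => (main PK PL).1 h,
    fun h => ⟨MilnorRec.perfectClosureOf K, MilnorRec.perfectClosureOf L, (main _ _).2 h⟩⟩

end
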